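/- arXiv:1304.5444 — 7 statements merged into one kernel-verified Lean document; each statement's English description precedes it below -/
import Mathlib

section
/- Let n ≥ 5 and k ≥ 1, and let G = (A_n)^k be the k-th direct power of the alternating group A_n. Then the following are equivalent: (i) G is a Beauville group; (ii) G can be generated by two elements and G is not isomorphic to A_5; (iii) either n = 5 and 2 ≤ k ≤ 19, or n > 5 and k ≤ d₂(A_n). -/
/-- The set of elements of `G` conjugate to a power of `a`, `b` or `c`. -/
def SigmaSet {G : Type*} [Group G] (a b c : G) : Set G :=
  {g | ∃ d ∈ ({a, b, c} : Set G), ∃ m : ℤ, IsConj (d ^ m) g}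

/-- `G` is an (unmixed) Beauville group. -/
def IsBeauvilleGroup (G : Type*) [Group G] : Prop :=
  ∃ a₁ b₁ c₁ a₂ b₂ c₂ : G,
    (Subgroup.closure {a₁, b₁, c₁} = ⊤ ∧ a₁ * b₁ * c₁ = 1 ∧
      (1 : ℚ) / (orderOf a₁) + 1 / (orderOf b₁) + 1 / (orderOf c₁) < 1) ∧
    (Subgroup.closure {a₂, b₂, c₂} = ⊤ ∧ a₂ * b₂ * c₂ = 1 ∧
      (1 : ℚ) / (orderOf a₂) + 1 / (orderOf b₂) + 1 / (orderOf c₂) < 1) ∧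
    SigmaSet a₁ b₁ c₁ ∩ SigmaSet a₂ b₂ c₂ = {1}

/-- `d₂ H`: the number of orbits of `Aut H` on ordered generating pairs of `H`. -/
noncomputable def d2 (H : Type*) [Group H] : ℕ :=
  Nat.card (Quot (fun p q : {p : H × H // Subgroup.closure {p.1, p.2} = ⊤} =>
    ∃ φ : MulAut H, φ p.val.1 = q.val.1 ∧ φ p.val.2 = q.val.2))

section Pairs

open scoped commutatorElement

variable {T : Type*} [Group T]

/-- Two pairs of group elements are in the same orbit of the automorphism group. -/
def AutEquiv (p q : T × T) : Prop :=
  ∃ φ : MulAut T, φ p.1 = q.1 ∧ φ p.2 = q.2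

/-- A pair of elements generates the group. -/
def Generates (p : T × T) : Prop :=
  Subgroup.closure {p.1, p.2} = ⊤

theorem AutEquiv.refl (p : T × T) : AutEquiv p p := ⟨1, rfl, rfl⟩

theorem AutEquiv.symm {p q : T × T} (h : AutEquiv p q) : AutEquiv q p := by
  obtain ⟨φ, h₁, h₂⟩ := h
  exact ⟨φ⁻¹, by simp [← h₁, ← MulAut.mul_apply], by simp [← h₂, ← MulAut.mul_apply]⟩

theorem AutEquiv.trans {p q r : T × T} (h : AutEquiv p q) (h' : AutEquiv q r) :
    AutEquiv p r := by
  obtain ⟨φ, h₁, h₂⟩ := h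
  obtain ⟨ψ, h₃, h₄⟩ := h'
  exact ⟨ψ * φ, by simp [h₁, h₃], by simp [h₂, h₄]⟩

/-- The pair of coordinate functions of a family of pairs generates the power. -/
def PowerGenerates {ι : Type*} (t : ι → T × T) : Prop :=
  Subgroup.closure {(fun i => (t i).1), (fun i => (t i).2)} = (⊤ : Subgroup (ι → T))

theorem PowerGenerates.generates {ι : Type*} {t : ι → T × T} (h : PowerGenerates t) (i : ι) :
    Generates (t i) := by
  have := congrArg (Subgroup.map (Pi.evalMonoidHom (fun _ : ι => T) i)) h
  rw [MonoidHom.map_closure, Set.image_pair, Subgroup.map_top_of_surjective] at this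
  · exact this
  · exact Function.surjective_eval i

theorem PowerGenerates.not_autEquiv [Nontrivial T] {ι : Type*} {t : ι → T × T}
    (h : PowerGenerates t) {i j : ι} (hij : i ≠ j) : ¬ AutEquiv (t i) (t j) := by
  classical
  rintro ⟨φ, h₁, h₂⟩
  let e := Pi.evalMonoidHom (fun _ : ι => T)
  have hle : Subgroup.closure {(fun i => (t i).1), (fun i => (t i).2)} ≤
      (φ.toMonoidHom.comp (e i)).eqLocus (e j) := by
    rw [Subgroup.closure_le]
    rintro x (rfl | rfl)
    · exact h₁
    · exact h₂
  obtain ⟨a, ha⟩ := exists_ne (1 : T)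
  have hmem : Pi.mulSingle j a ∈ (φ.toMonoidHom.comp (e i)).eqLocus (e j) := by
    apply hle
    rw [show Subgroup.closure _ = _ from h]
    trivial
  have : φ ((Pi.mulSingle j a : ι → T) i) = (Pi.mulSingle j a : ι → T) j := hmem
  rw [Pi.mulSingle_eq_of_ne hij, map_one, Pi.mulSingle_eq_same] at this
  exact ha this.symm

/-- The values at `j` of those members of `H` that are trivial on `s`. -/
def sliceSubgroup {ι : Type*} (H : Subgroup (ι → T)) (s : Set ι) (j : ι) : Subgroup T :=
  (H ⊓ Subgroup.pi s fun _ => ⊥).map (Pi.evalMonoidHom (fun _ : ι => T) j)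

theorem mem_sliceSubgroup {ι : Type*} {H : Subgroup (ι → T)} {s : Set ι} {j : ι} {a : T} :
    a ∈ sliceSubgroup H s j ↔ ∃ h ∈ H, (∀ i ∈ s, h i = 1) ∧ h j = a := by
  simp [sliceSubgroup, Subgroup.mem_map, Subgroup.mem_pi, and_assoc]

theorem sliceSubgroup_normal {ι : Type*} {H : Subgroup (ι → T)} {s : Set ι} {j : ι}
    (hH : ∀ a, ∃ h ∈ H, h j = a) : (sliceSubgroup H s j).Normal := by
  refine ⟨fun a ha g => ?_⟩
  obtain ⟨k, hk, rfl⟩ := hH g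
  obtain ⟨h, hh, hs, rfl⟩ := mem_sliceSubgroup.1 ha
  exact mem_sliceSubgroup.2 ⟨k * h * k⁻¹, H.mul_mem (H.mul_mem hk hh) (H.inv_mem hk),
    fun i hi => by simp [hs i hi], rfl⟩

section Simple

variable [IsSimpleGroup T]

theorem commutator_eq_top_of_isSimpleGroup (hT : ∃ a b : T, a * b ≠ b * a) :
    commutator T = ⊤ := by
  refine (inferInstance : (commutator T).Normal).eq_bot_or_eq_top.resolve_left fun h => ?_
  obtain ⟨a, b, hab⟩ := hT
  have : ⁅a, b⁆ ∈ commutator T :=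
    Subgroup.commutator_mem_commutator (Subgroup.mem_top _) (Subgroup.mem_top _)
  rw [h, Subgroup.mem_bot, commutatorElement_eq_one_iff_mul_comm] at this
  exact hab this

theorem sliceSubgroup_eq_top (hT : ∃ a b : T, a * b ≠ b * a) {ι : Type*}
    {H : Subgroup (ι → T)} {j : ι} (hH : ∀ a, ∃ h ∈ H, h j = a)
    (hne : ∀ i, i ≠ j → ∃ h ∈ H, h i = 1 ∧ h j ≠ 1) (s : Finset ι) (hs : j ∉ s) :
    sliceSubgroup H s j = ⊤ := by
  classical
  induction s using Finset.induction_on with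
  | empty =>
    rw [eq_top_iff]
    intro a _
    obtain ⟨h, hh, rfl⟩ := hH a
    exact mem_sliceSubgroup.2 ⟨h, hh, by simp, rfl⟩
  | insert i s _ ih =>
    rw [Finset.mem_insert, not_or] at hs
    have h₁ : sliceSubgroup H {i} j = ⊤ := by
      refine (sliceSubgroup_normal hH).eq_bot_or_eq_top.resolve_left fun hbot => ?_
      obtain ⟨h, hh, hi, hj⟩ := hne i (Ne.symm hs.1)
      apply hj
      rw [← Subgroup.mem_bot, ← hbot]
      exact mem_sliceSubgroup.2 ⟨h, hh, by simpa using hi, rfl⟩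
    rw [eq_top_iff, ← commutator_eq_top_of_isSimpleGroup hT, commutator_def,
      Subgroup.commutator_le]
    intro a _ b _
    obtain ⟨h, hh, hhs, rfl⟩ := mem_sliceSubgroup.1 (ih hs.2 ▸ Subgroup.mem_top a)
    obtain ⟨k, hk, hks, rfl⟩ := mem_sliceSubgroup.1 (h₁ ▸ Subgroup.mem_top b)
    refine mem_sliceSubgroup.2 ⟨⁅h, k⁆, ?_, ?_, rfl⟩
    · rw [commutatorElement_def]
      exact H.mul_mem (H.mul_mem (H.mul_mem hh hk) (H.inv_mem hh)) (H.inv_mem hk)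
    · intro l hl
      rw [Finset.coe_insert, Set.mem_insert_iff] at hl
      rcases hl with rfl | hl
      · simp [commutatorElement_def, hks l rfl]
      · simp [commutatorElement_def, hhs l hl]

theorem powerGenerates_of_pairwise [Finite T] (hT : ∃ a b : T, a * b ≠ b * a)
    {ι : Type*} [Finite ι] {t : ι → T × T} (hg : ∀ i, Generates (t i))
    (ht : Pairwise fun i j => ¬ AutEquiv (t i) (t j)) : PowerGenerates t := by
  classical
  have := Fintype.ofFinite ι
  let H : Subgroup (ι → T) := Subgroup.closure {(fun i => (t i).1), (fun i => (t i).2)}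
  have hx : (fun i => (t i).1) ∈ H := Subgroup.subset_closure (by simp)
  have hy : (fun i => (t i).2) ∈ H := Subgroup.subset_closure (by simp)
  have hH : ∀ j a, ∃ h ∈ H, h j = a := by
    intro j a
    have : H.map (Pi.evalMonoidHom (fun _ : ι => T) j) = ⊤ := by
      rw [MonoidHom.map_closure, Set.image_pair]
      exact hg j
    exact Subgroup.mem_map.1 (this ▸ Subgroup.mem_top a)
  have hne : ∀ j i, i ≠ j → ∃ h ∈ H, h i = 1 ∧ h j ≠ 1 := by
    intro j i hij
    by_contra! hcon
    let f : H →* T := (Pi.evalMonoidHom (fun _ : ι => T) i).comp H.subtype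
    let g : H →* T := (Pi.evalMonoidHom (fun _ : ι => T) j).comp H.subtype
    have hf : Function.Surjective f := fun a => by
      obtain ⟨h, hh, rfl⟩ := hH i a
      exact ⟨⟨h, hh⟩, rfl⟩
    have hfg : f.ker ≤ g.ker := fun h hh => hcon h h.2 hh
    let φ : T →* T := f.liftOfSurjective hf ⟨g, hfg⟩
    have hφ : ∀ h, φ (f h) = g h := fun h =>
      MonoidHom.liftOfRightInverse_comp_apply f _ (Function.rightInverse_surjInv hf) ⟨g, hfg⟩ h
    have hsurj : Function.Surjective φ := fun a => by
      obtain ⟨h, hh, rfl⟩ := hH j a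
      exact ⟨f ⟨h, hh⟩, hφ _⟩
    exact ht hij ⟨MulEquiv.ofBijective φ ⟨Finite.injective_iff_surjective.2 hsurj, hsurj⟩,
      hφ ⟨_, hx⟩, hφ ⟨_, hy⟩⟩
  rw [PowerGenerates, eq_top_iff]
  intro a _
  refine Subgroup.pi_mem_of_mulSingle_mem a fun j => ?_
  obtain ⟨h, hh, hs, hj⟩ := mem_sliceSubgroup.1
    (sliceSubgroup_eq_top hT (hH j) (hne j) (Finset.univ.erase j) (by simp) ▸
      Subgroup.mem_top (a j))
  convert hh
  ext i
  by_cases hij : i = j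
  · subst hij
    simp [hj]
  · rw [Pi.mulSingle_eq_of_ne hij, hs i (by simpa using hij)]

end Simple

end Pairs

section Triples

variable {T : Type*} [Group T]

/-- The triple with product `1` determined by a pair. -/
def triple (p : T × T) : Fin 3 → T := ![p.1, p.2, (p.1 * p.2)⁻¹]

/-- The orders of the members of the triple satisfy the hyperbolicity condition. -/
def Hyperbolic (p : T × T) : Prop :=
  (1 : ℚ) / (orderOf (triple p 0)) + 1 / (orderOf (triple p 1)) + 1 / (orderOf (triple p 2)) < 1

/-- Powers of members of the two triples of prime order are never conjugate. -/
def PrimeDisjoint (P Q : T × T) : Prop :=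
  ∀ p : ℕ, p.Prime → ∀ (d e : Fin 3) (m m' : ℕ),
    IsConj (triple P d ^ m) (triple Q e ^ m') → triple P d ^ (m * p) = 1 → triple P d ^ m = 1

theorem closure_triple {a b c : T} (h : a * b * c = 1) :
    Subgroup.closure {a, b, c} = Subgroup.closure {a, b} := by
  apply le_antisymm
  · rw [Subgroup.closure_le]
    have ha : a ∈ Subgroup.closure {a, b} := Subgroup.subset_closure (by simp)
    have hb : b ∈ Subgroup.closure {a, b} := Subgroup.subset_closure (by simp)
    rintro x (rfl | rfl | rfl)
    · exact ha
    · exact hb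
    · rw [eq_inv_of_mul_eq_one_right h]
      exact Subgroup.inv_mem _ (Subgroup.mul_mem _ ha hb)
  · exact Subgroup.closure_mono (by intro x; simp; tauto)

theorem mem_sigmaSet_triple {P : T × T} {g : T} [Finite T] :
    g ∈ SigmaSet (triple P 0) (triple P 1) (triple P 2) ↔
      ∃ (d : Fin 3) (m : ℕ), IsConj (triple P d ^ m) g := by
  have key : ∀ a : T, (∃ m : ℤ, IsConj (a ^ m) g) ↔ ∃ m : ℕ, IsConj (a ^ m) g := by
    intro a
    constructor
    · rintro ⟨m, hm⟩
      obtain ⟨k, hk⟩ := mem_powers_iff_mem_zpowers.2 (Subgroup.zpow_mem_zpowers a m)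
      exact ⟨k, by simpa [← hk] using hm⟩
    · rintro ⟨m, hm⟩
      exact ⟨m, by simpa using hm⟩
  simp [SigmaSet, key, Fin.exists_fin_succ, -isConj_iff]

theorem IsBeauvilleGroup.of_pairs [Finite T] {P Q : T × T} (hP : Generates P) (hQ : Generates Q)
    (hP' : Hyperbolic P) (hQ' : Hyperbolic Q) (h : PrimeDisjoint P Q) : IsBeauvilleGroup T := by
  have hmul : ∀ p : T × T, triple p 0 * triple p 1 * triple p 2 = 1 := fun p => by simp [triple]
  refine ⟨triple P 0, triple P 1, triple P 2, triple Q 0, triple Q 1, triple Q 2,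
    ⟨?_, hmul P, hP'⟩, ⟨?_, hmul Q, hQ'⟩, ?_⟩
  · rw [closure_triple (hmul P)]; exact hP
  · rw [closure_triple (hmul Q)]; exact hQ
  · ext g
    rw [Set.mem_inter_iff, mem_sigmaSet_triple, mem_sigmaSet_triple, Set.mem_singleton_iff]
    constructor
    · rintro ⟨⟨d, m, hd⟩, e, m', he⟩
      by_contra hg
      have hne : triple P d ^ m ≠ 1 := fun h1 => hg (isConj_one_right.1 (h1 ▸ hd))
      set a := triple P d with ha
      have hN : orderOf (a ^ m) ≠ 1 := by rwa [Ne, orderOf_eq_one_iff]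
      obtain ⟨q, hq⟩ := Nat.minFac_dvd (orderOf (a ^ m))
      have hp := Nat.minFac_prime hN
      set p := (orderOf (a ^ m)).minFac
      have hc : IsConj (a ^ (m * q)) (triple Q e ^ (m' * q)) := by
        rw [pow_mul, pow_mul]
        have := hd.trans he.symm
        obtain ⟨c, hc⟩ := isConj_iff.1 this
        exact isConj_iff.2 ⟨c, by rw [← hc, conj_pow]⟩
      have h1 := h p hp d e (m * q) (m' * q) hc (by
        rw [mul_assoc, mul_comm q p, ← hq, pow_mul, pow_orderOf_eq_one])
      rw [← ha, pow_mul] at h1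
      have hdvd := orderOf_dvd_of_pow_eq_one h1
      have hpos : 0 < orderOf (a ^ m) := orderOf_pos _
      have hq0 : 0 < q := by
        rcases Nat.eq_zero_or_pos q with h0 | h0
        · rw [h0, mul_zero] at hq
          omega
        · exact h0
      have := Nat.le_of_dvd hq0 hdvd
      rw [hq] at this
      nlinarith [hp.two_le]
    · rintro rfl
      exact ⟨⟨0, 0, by simp⟩, ⟨0, 0, by simp⟩⟩

theorem IsBeauvilleGroup.exists_generates (h : IsBeauvilleGroup T) :
    ∃ x y : T, Subgroup.closure {x, y} = ⊤ := by
  obtain ⟨a, b, c, -, -, -, ⟨h₁, h₂, -⟩, -⟩ := h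
  exact ⟨a, b, by rw [← closure_triple h₂, h₁]⟩

theorem IsBeauvilleGroup.of_mulEquiv {S : Type*} [Group S] (e : S ≃* T)
    (h : IsBeauvilleGroup S) : IsBeauvilleGroup T := by
  have hcl : ∀ a b c : S, Subgroup.closure {a, b, c} = ⊤ →
      Subgroup.closure {e a, e b, e c} = ⊤ := by
    intro a b c h
    have := congrArg (Subgroup.map e.toMonoidHom) h
    rw [MonoidHom.map_closure, Set.image_insert_eq, Set.image_pair,
      Subgroup.map_top_of_surjective _ e.surjective] at this
    exact this
  have hσ : ∀ (a b c : S) (g : T), g ∈ SigmaSet (e a) (e b) (e c) →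
      e.symm g ∈ SigmaSet a b c := by
    rintro a b c g ⟨d, hd, m, hm⟩
    have hm' := e.symm.toMonoidHom.map_isConj hm
    refine ⟨e.symm d, ?_, m, by simpa using hm'⟩
    rcases hd with rfl | rfl | rfl <;> simp
  obtain ⟨a, b, c, a', b', c', ⟨h₁, h₂, h₃⟩, ⟨h₄, h₅, h₆⟩, h₇⟩ := h
  refine ⟨e a, e b, e c, e a', e b', e c', ⟨hcl _ _ _ h₁, by simp [← map_mul, h₂], by
    simpa using h₃⟩, ⟨hcl _ _ _ h₄, by simp [← map_mul, h₅], by simpa using h₆⟩, ?_⟩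
  ext g
  constructor
  · rintro ⟨hg, hg'⟩
    have : e.symm g ∈ SigmaSet a b c ∩ SigmaSet a' b' c' := ⟨hσ _ _ _ _ hg, hσ _ _ _ _ hg'⟩
    rw [h₇] at this
    simpa using this
  · rintro rfl
    exact ⟨⟨e a, by simp, 0, by simp⟩, ⟨e a', by simp, 0, by simp⟩⟩

/-- The pair of coordinate functions of a family of pairs. -/
def coordPair {ι : Type*} (t : ι → T × T) : (ι → T) × (ι → T) :=
  (fun i => (t i).1, fun i => (t i).2)

theorem triple_coordPair {ι : Type*} (t : ι → T × T) (d : Fin 3) :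
    triple (coordPair t) d = fun i => triple (t i) d := by
  fin_cases d <;> rfl

theorem Hyperbolic.coordPair [Finite T] {ι : Type*} [Finite ι] {t : ι → T × T} {o : ι}
    (h : Hyperbolic (t o)) : Hyperbolic (coordPair t) := by
  refine lt_of_le_of_lt ?_ h
  have key : ∀ d, (1 : ℚ) / orderOf (triple (_root_.coordPair t) d) ≤
      1 / orderOf (triple (t o) d) := by
    intro d
    have hdvd : orderOf (triple (t o) d) ∣ orderOf (triple (_root_.coordPair t) d) := by
      rw [triple_coordPair]
      exact orderOf_map_dvd (Pi.evalMonoidHom (fun _ : ι => T) o) _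
    apply one_div_le_one_div_of_le
    · exact_mod_cast orderOf_pos _
    · exact_mod_cast Nat.le_of_dvd (orderOf_pos _) hdvd
  have h0 := key 0
  have h1 := key 1
  have h2 := key 2
  linarith

theorem IsBeauvilleGroup.power_of_families [Finite T] [IsSimpleGroup T]
    (hT : ∃ a b : T, a * b ≠ b * a) {ι : Type*} [Finite ι] (o : ι) {t u : ι → T × T}
    (ht : ∀ i, Generates (t i)) (ht' : Pairwise fun i j => ¬ AutEquiv (t i) (t j))
    (hu : ∀ i, Generates (u i)) (hu' : Pairwise fun i j => ¬ AutEquiv (u i) (u j))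
    (hto : Hyperbolic (t o)) (huo : Hyperbolic (u o))
    (h : ∀ p : ℕ, p.Prime → ∀ (d e : Fin 3) (m m' : ℕ),
      (∀ i, IsConj (triple (t i) d ^ m) (triple (u i) e ^ m')) →
      (∀ i, triple (t i) d ^ (m * p) = 1) → ∀ i, triple (t i) d ^ m = 1) :
    IsBeauvilleGroup (ι → T) := by
  refine IsBeauvilleGroup.of_pairs (P := coordPair t) (Q := coordPair u)
    (powerGenerates_of_pairwise hT ht ht') (powerGenerates_of_pairwise hT hu hu')
    hto.coordPair huo.coordPair ?_
  intro p hp d e m m' hc h1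
  simp only [triple_coordPair] at hc h1 ⊢
  exact funext fun i => h p hp d e m m'
    (fun i => (Pi.evalMonoidHom (fun _ : ι => T) i).map_isConj hc) (fun i => congrFun h1 i) i

end Triples

section Counting

theorem pow_eq_one_of_factorization_le {T : Type*} [Group T] [Finite T] {p : ℕ} (hp : p.Prime)
    {t g : T} (h : (orderOf t).factorization p ≤ (orderOf g).factorization p) {m : ℕ}
    (ht : t ^ (m * p) = 1) (hg : g ^ m = 1) : t ^ m = 1 := by
  rw [← orderOf_dvd_iff_pow_eq_one] at ht hg ⊢
  have hcop : Nat.Coprime (orderOf t / p ^ (orderOf t).factorization p) p :=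
    (Nat.coprime_ordCompl hp (orderOf_pos t).ne').symm
  rw [← Nat.ordProj_mul_ordCompl_eq_self (orderOf t) p]
  refine Nat.Coprime.mul_dvd_of_dvd_of_dvd (hcop.symm.pow_left _) ?_ ?_
  · exact ((pow_dvd_pow p h).trans (Nat.ordProj_dvd _ _)).trans hg
  · exact hcop.dvd_of_dvd_mul_right ((Nat.ordCompl_dvd _ _).trans ht)

/-- Representatives of distinct classes can be chosen with prescribed values on a finite set. -/
theorem exists_pairwise_extension {ι X : Type*} {r : X → X → Prop} (hr : Equivalence r)
    {Q : X → Prop} {s : ι → X} (hs : ∀ i, Q (s i)) (hs' : Pairwise fun i j => ¬ r (s i) (s j))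
    (I : Finset ι) {g : ι → X} (hg : ∀ i ∈ I, Q (g i))
    (hg' : ∀ i ∈ I, ∀ j ∈ I, i ≠ j → ¬ r (g i) (g j)) :
    ∃ u : ι → X, (∀ i, Q (u i)) ∧ (Pairwise fun i j => ¬ r (u i) (u j)) ∧
      ∀ i ∈ I, u i = g i := by
  classical
  induction I using Finset.induction_on with
  | empty => exact ⟨s, hs, hs', by simp⟩
  | insert i I hi ih =>
    obtain ⟨u, hu, hu', huI⟩ := ih (fun j hj => hg j (Finset.mem_insert_of_mem hj))
      (fun j hj k hk => hg' j (Finset.mem_insert_of_mem hj) k (Finset.mem_insert_of_mem hk))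
    have hmain : ∃ v : ι → X, (∀ i, Q (v i)) ∧ (Pairwise fun i j => ¬ r (v i) (v j)) ∧
        (∀ j ∈ I, v j = g j) ∧ ∀ j, j ≠ i → ¬ r (g i) (v j) := by
      by_cases hex : ∃ j, r (g i) (u j)
      · obtain ⟨j, hj⟩ := hex
        have hjI : j ∉ I := fun hjI => hg' i (Finset.mem_insert_self _ _) j
          (Finset.mem_insert_of_mem hjI) (fun h => hi (h ▸ hjI)) (huI j hjI ▸ hj)
        refine ⟨u ∘ Equiv.swap i j, fun k => hu _,
          fun a b hab => hu' ((Equiv.swap i j).injective.ne hab), fun k hk => ?_,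
          fun k hk hrk => ?_⟩
        · rw [Function.comp_apply, Equiv.swap_apply_of_ne_of_ne (ne_of_mem_of_not_mem hk hi)
            (ne_of_mem_of_not_mem hk hjI), huI k hk]
        · refine hu' (i := j) (j := Equiv.swap i j k) ?_ (hr.trans (hr.symm hj) hrk)
          intro h
          apply hk
          rw [eq_comm, Equiv.swap_apply_eq_iff, Equiv.swap_apply_right] at h
          exact h
      · push Not at hex
        exact ⟨u, hu, hu', huI, fun j _ => hex j⟩
    obtain ⟨v, hv, hv', hvI, hvi⟩ := hmain
    refine ⟨Function.update v i (g i), fun k => ?_, fun a b hab => ?_, fun k hk => ?_⟩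
    · by_cases hk : k = i
      · subst hk
        simpa using hg k (Finset.mem_insert_self _ _)
      · simpa [Function.update_of_ne hk] using hv k
    · change ¬ r (Function.update v i (g i) a) (Function.update v i (g i) b)
      by_cases ha : a = i
      · subst ha
        rw [Function.update_self, Function.update_of_ne hab.symm]
        exact hvi b hab.symm
      · rw [Function.update_of_ne ha]
        by_cases hb : b = i
        · subst hb
          rw [Function.update_self]
          exact fun h => hvi a hab (hr.symm h)
        · rw [Function.update_of_ne hb]
          exact hv' hab
    · by_cases hki : k = i
      · subst hki
        simp
      · rw [Function.update_of_ne hki]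
        exact hvI k ((Finset.mem_insert.1 hk).resolve_left hki)

variable {T : Type*} [Group T]

theorem AutEquiv.equivalence : Equivalence (AutEquiv : T × T → T × T → Prop) :=
  ⟨AutEquiv.refl, AutEquiv.symm, AutEquiv.trans⟩

/-- The `p`-part of the order of `g` is as large as possible. -/
def FullAt (p : ℕ) (g : T) : Prop :=
  ∀ t : T, (orderOf t).factorization p ≤ (orderOf g).factorization p

theorem IsBeauvilleGroup.power_of_counting [Finite T] [IsSimpleGroup T]
    (hT : ∃ a b : T, a * b ≠ b * a) {κ : Type*} [Fintype κ] {k₀ : κ} {t₀ : T × T}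
    {w : κ → T × T}
    (ht₀ : Generates t₀) (ht₀' : Hyperbolic t₀) (hw : ∀ i, Generates (w i))
    (hw' : Pairwise fun i j => ¬ AutEquiv (w i) (w j)) (hw₀ : Hyperbolic (w k₀))
    (hdisj : PrimeDisjoint t₀ (w k₀))
    (hord : ∀ i e, orderOf (triple (w i) e) ∣ orderOf (triple (w k₀) e))
    (D : Finset (ℕ × Fin 3)) (hD : D.card < Fintype.card κ)
    (hfull : ∀ p : ℕ, p.Prime → ∀ d : Fin 3, (p, d) ∈ D ∨ FullAt p (triple t₀ d) ∨
      ∀ e, FullAt p (triple (w k₀) e))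
    {ι : Type*} [Finite ι] [Nonempty ι]
    (h2 : ∃ x y : ι → T, Subgroup.closure {x, y} = ⊤) : IsBeauvilleGroup (ι → T) := by
  classical
  obtain ⟨x, y, hxy⟩ := h2
  have hs : PowerGenerates fun i => (x i, y i) := hxy
  have hs' : Pairwise fun i j => ¬ AutEquiv (x i, y i) (x j, y j) :=
    fun i j hij => hs.not_autEquiv hij
  obtain ⟨o⟩ := ‹Nonempty ι›
  obtain ⟨t, ht, ht', hto⟩ := exists_pairwise_extension AutEquiv.equivalence hs.generates hs' {o}
    (g := fun _ => t₀) (fun _ _ => ht₀) (by simp +contextual)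
  have hto : t o = t₀ := hto o (Finset.mem_singleton_self o)
  have hwit : ∀ q : ℕ × Fin 3, ∃ i, ∀ j,
      (orderOf (triple (t j) q.2)).factorization q.1 ≤
        (orderOf (triple (t i) q.2)).factorization q.1 := fun q => by
    have : Nonempty ι := ⟨o⟩
    exact Finite.exists_max fun i => (orderOf (triple (t i) q.2)).factorization q.1
  choose wit hwit using hwit
  set I : Finset ι := insert o (D.image wit) with hI
  have hIcard : I.card ≤ Fintype.card κ := by
    exact (Finset.card_insert_le _ _).trans
      ((Nat.succ_le_succ Finset.card_image_le).trans (Nat.succ_le_of_lt hD))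
  obtain ⟨f, hf, hfo⟩ : ∃ f : ι → κ, Set.InjOn f I ∧ f o = k₀ := by
    have hle : Fintype.card I ≤ Fintype.card κ := by rwa [Fintype.card_coe]
    obtain ⟨f₀⟩ := Function.Embedding.nonempty_of_card_le hle
    have hoI : o ∈ I := Finset.mem_insert_self _ _
    refine ⟨fun i => if h : i ∈ I then Equiv.swap (f₀ ⟨o, hoI⟩) k₀ (f₀ ⟨i, h⟩) else k₀,
      fun i hi j hj hij => ?_, by simp [hoI]⟩
    have hi' : i ∈ I := hi
    have hj' : j ∈ I := hj
    simp only [hi', hj', dif_pos] at hij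
    simpa using f₀.injective ((Equiv.swap _ _).injective hij)
  obtain ⟨u, hu, hu', huI⟩ := exists_pairwise_extension AutEquiv.equivalence hs.generates hs' I
    (g := fun i => w (f i)) (fun i _ => hw _)
    (fun i hi j hj hij => hw' fun h => hij (hf hi hj h))
  have huo : u o = w k₀ := by rw [huI o (Finset.mem_insert_self _ _), hfo]
  refine IsBeauvilleGroup.power_of_families hT o ht ht' hu hu' (hto ▸ ht₀') (huo ▸ hw₀) ?_
  intro p hp d e m m' hc h1
  have ho : triple t₀ d ^ m = 1 := by
    have hco := hc o
    have h1o := h1 o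
    rw [hto] at hco h1o
    rw [huo] at hco
    exact hdisj p hp d e m m' hco h1o
  have ho' : triple (w k₀) e ^ m' = 1 := by
    have hco := hc o
    rw [hto, huo, ho] at hco
    exact isConj_one_right.1 hco
  rcases hfull p hp d with h | h | h
  · have hw1 : triple (u (wit (p, d))) e ^ m' = 1 := by
      have hmem : wit (p, d) ∈ I :=
        Finset.mem_insert_of_mem (Finset.mem_image_of_mem wit h)
      rw [huI _ hmem, ← orderOf_dvd_iff_pow_eq_one]
      exact (hord _ e).trans (orderOf_dvd_iff_pow_eq_one.2 ho')
    have hw2 : triple (t (wit (p, d))) d ^ m = 1 := by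
      have := hc (wit (p, d))
      rw [hw1] at this
      exact isConj_one_left.1 this
    exact fun i => pow_eq_one_of_factorization_le hp (hwit (p, d) i) (h1 i) hw2
  · exact fun i => pow_eq_one_of_factorization_le hp (h _) (h1 i) ho
  · intro i
    have h2 : triple (u i) e ^ (m' * p) = 1 := by
      obtain ⟨c, hc'⟩ := isConj_iff.1 (hc i)
      rw [pow_mul, ← hc', conj_pow, ← pow_mul, h1 i]
      simp
    have h3 := pow_eq_one_of_factorization_le hp (h e _) h2 ho'
    have := hc i
    rw [h3] at this
    exact isConj_one_left.1 this

/-- Every nonempty finite power that is two-generated is a Beauville group. -/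
def PowersBeauville (T : Type*) [Group T] : Prop :=
  ∀ k : ℕ, 0 < k → (∃ x y : Fin k → T, Subgroup.closure {x, y} = ⊤) →
    IsBeauvilleGroup (Fin k → T)

theorem exists_generates_of_mulEquiv {G H : Type*} [Group G] [Group H] (e : G ≃* H)
    (h : ∃ x y : G, Subgroup.closure {x, y} = ⊤) : ∃ x y : H, Subgroup.closure {x, y} = ⊤ := by
  obtain ⟨x, y, hxy⟩ := h
  refine ⟨e x, e y, ?_⟩
  have := congrArg (Subgroup.map e.toMonoidHom) hxy
  rw [MonoidHom.map_closure, Set.image_pair, Subgroup.map_top_of_surjective _ e.surjective] at this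
  exact this

theorem PowersBeauville.of_mulEquiv {S : Type*} [Group S] (e : S ≃* T)
    (h : PowersBeauville S) : PowersBeauville T := by
  intro k hk h2
  let e' : (Fin k → S) ≃* (Fin k → T) := MulEquiv.piCongrRight fun _ => e
  exact (h k hk (exists_generates_of_mulEquiv e'.symm h2)).of_mulEquiv e'

end Counting

section Alternating

open Equiv.Perm MulAction
open scoped Pointwise

variable {α : Type*} [Fintype α] [DecidableEq α]

theorem exists_mul_ne_mul_alternatingGroup (h : 5 ≤ Nat.card α) :
    ∃ a b : alternatingGroup α, a * b ≠ b * a := by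
  by_contra! hcon
  have h1 : IsMulCommutative (alternatingGroup α) := ⟨⟨hcon⟩⟩
  rw [alternatingGroup.isMulCommutative_iff_card_le_three] at h1
  omega

theorem factorization_orderOf_perm_le {p e : ℕ} (hp : p.Prime)
    (h : Fintype.card α < p ^ (e + 1)) (t : Equiv.Perm α) :
    (orderOf t).factorization p ≤ e := by
  by_contra! hcon
  have hL : orderOf t ≠ 0 := (orderOf_pos t).ne'
  have hdvd : p ∣ orderOf t := by
    by_contra h0
    rw [Nat.factorization_eq_zero_of_not_dvd h0] at hcon
    omega
  obtain ⟨q, hq⟩ := hdvd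
  have hne : t ^ q ≠ 1 := by
    intro h1
    have h2 := orderOf_dvd_of_pow_eq_one h1
    have hq0 : 0 < q := Nat.pos_of_ne_zero (by rintro rfl; exact hL hq)
    have := Nat.le_of_dvd hq0 h2
    rw [hq] at this
    nlinarith [hp.two_le]
  obtain ⟨a, ha⟩ : ∃ a, (t ^ q) a ≠ a := by
    by_contra! h1
    exact hne (Equiv.ext h1)
  have h1 : Function.minimalPeriod (t • ·) a ∣ p * q := by
    rw [← pow_smul_eq_iff_minimalPeriod_dvd, ← hq, pow_orderOf_eq_one, one_smul]
  have h2 : ¬ Function.minimalPeriod (t • ·) a ∣ q := by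
    rwa [← pow_smul_eq_iff_minimalPeriod_dvd]
  have hcard : Function.minimalPeriod (t • ·) a ≤ Fintype.card α := by
    classical
    rw [minimalPeriod_eq_card]
    exact set_fintype_card_le_univ _
  set k := Function.minimalPeriod (t • ·) a
  have h3 : p ^ (e + 1) ∣ k := by
    by_contra h4
    apply h2
    have hk0 : k ≠ 0 := by rintro hk0; rw [hk0] at h4; simp at h4
    have hq0 : q ≠ 0 := by rintro rfl; exact hL hq
    rw [← Nat.factorization_le_iff_dvd hk0 hq0]
    intro r
    have h5 := (Nat.factorization_le_iff_dvd hk0 (mul_ne_zero hp.ne_zero hq0)).2 h1 r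
    rw [Nat.factorization_mul hp.ne_zero hq0, hp.factorization, Finsupp.add_apply] at h5
    by_cases hr : r = p
    · subst hr
      have h6 : k.factorization r < e + 1 := by
        by_contra! h7
        exact h4 ((hp.pow_dvd_iff_le_factorization hk0).2 h7)
      rw [hq, Nat.factorization_mul hp.ne_zero hq0, hp.factorization, Finsupp.add_apply,
        Finsupp.single_eq_same] at hcon
      omega
    · rw [Finsupp.single_eq_of_ne hr] at h5
      omega
  have hk : 0 < k := by
    rcases Nat.eq_zero_or_pos k with hk | hk
    · rw [hk, zero_dvd_iff] at h1
      omega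
    · exact hk
  exact absurd (Nat.le_of_dvd hk h3) (by omega)

theorem fullAt_of_card_lt {p e : ℕ} (hp : p.Prime) (h : Fintype.card α < p ^ (e + 1))
    {g : alternatingGroup α} (hg : p ^ e ∣ orderOf g) : FullAt p g := by
  intro t
  rw [← Subgroup.orderOf_coe t]
  exact (factorization_orderOf_perm_le hp h _).trans
    ((hp.pow_dvd_iff_le_factorization (orderOf_pos g).ne').1 hg)

/-- A nontrivial block is invariant under the three-cycles of the group. -/
theorem MulAction.IsBlock.threeCycle_apply_mem {K : Subgroup (Equiv.Perm α)} {B : Set α}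
    (hB : IsBlock K B) (hB' : B.Nontrivial) {g : Equiv.Perm α} (hg : g ∈ K)
    (hg3 : g.IsThreeCycle) {b : α} (hb : b ∈ B) : g b ∈ B := by
  have hsmul : ∀ c ∈ B, g c ∈ (⟨g, hg⟩ : K) • B := fun c hc => Set.smul_mem_smul_set hc
  rcases isBlock_iff_smul_eq_or_disjoint.1 hB ⟨g, hg⟩ with h | h
  · exact h ▸ hsmul b hb
  · have hmove : ∀ c ∈ B, c ∈ g.support := by
      intro c hc
      rw [mem_support]
      intro h1
      exact Set.disjoint_left.1 h (hsmul c hc) (h1.symm ▸ hc)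
    obtain ⟨c, hc, hcb⟩ := hB'.exists_ne b
    have hgne : ∀ d ∈ B, ∀ d' ∈ B, g d ≠ d' := fun d hd d' hd' hdd' =>
      Set.disjoint_left.1 h (hsmul d hd) (hdd' ▸ hd')
    have hsub : ({b, c, g b, g c} : Finset α) ⊆ g.support := by
      intro d hd
      simp only [Finset.mem_insert, Finset.mem_singleton] at hd
      rcases hd with rfl | rfl | rfl | rfl
      · exact hmove _ hb
      · exact hmove _ hc
      · exact apply_mem_support.2 (hmove _ hb)
      · exact apply_mem_support.2 (hmove _ hc)
    have hcard := Finset.card_le_card hsub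
    rw [hg3.card_support, Finset.card_insert_of_notMem, Finset.card_insert_of_notMem,
      Finset.card_insert_of_notMem, Finset.card_singleton] at hcard
    · omega
    · simpa using hcb.symm
    · simpa using ⟨(hgne b hb c hc).symm, (hgne c hc c hc).symm⟩
    · simpa using ⟨hcb.symm, (hgne b hb b hb).symm, (hgne c hc b hb).symm⟩

/-- A group of permutations contains the alternating group if it contains a three-cycle and its
three-cycles connect all points. -/
theorem alternatingGroup_le_of_connected_threeCycles {K : Subgroup (Equiv.Perm α)}
    {c : Equiv.Perm α} (hc : c ∈ K) (hc3 : c.IsThreeCycle)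
    (h : ∀ S : Set α, S.Nonempty → (∀ g ∈ K, g.IsThreeCycle → ∀ b ∈ S, g b ∈ S) →
      S = Set.univ) : alternatingGroup α ≤ K := by
  obtain ⟨a, ha⟩ := hc3.isCycle.nonempty_support
  have horb : orbit K a = Set.univ := h _ ⟨a, mem_orbit_self a⟩ fun g hg _ b hb =>
    mem_orbit_of_mem_orbit (⟨g, hg⟩ : K) hb
  have : IsPretransitive K α := by
    rw [isPretransitive_iff_orbit_eq_univ]
    exact horb
  have : IsPreprimitive K α := ⟨fun {B} hB => by
    by_cases hB' : B.Nontrivial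
    · exact Or.inr (h B hB'.nonempty fun g hg hg3 b hb => hB.threeCycle_apply_mem hB' hg hg3 hb)
    · exact Or.inl (Set.not_nontrivial_iff.1 hB')⟩
  exact alternatingGroup_le_of_isPreprimitive_of_isThreeCycle_mem this hc3 hc

theorem generates_of_connected_threeCycles {x y : alternatingGroup α}
    {c : alternatingGroup α} (hc : c ∈ Subgroup.closure {x, y})
    (hc3 : (c : Equiv.Perm α).IsThreeCycle)
    (h : ∀ S : Set α, S.Nonempty → (∀ g ∈ Subgroup.closure {x, y},
      (g : Equiv.Perm α).IsThreeCycle → ∀ b ∈ S, (g : Equiv.Perm α) b ∈ S) → S = Set.univ) :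
    Generates (x, y) := by
  have hle := alternatingGroup_le_of_connected_threeCycles
    (K := (Subgroup.closure {x, y}).map (alternatingGroup α).subtype)
    (Subgroup.mem_map_of_mem _ hc) hc3 fun S hS hS' => h S hS fun g hg hg3 b hb =>
      hS' _ (Subgroup.mem_map_of_mem _ hg) hg3 b hb
  rw [Generates, eq_top_iff]
  intro g _
  obtain ⟨g', hg', hgg'⟩ := Subgroup.mem_map.1 (hle g.2)
  rwa [← Subtype.ext hgg']

end Alternating

section Embedding

open Equiv

theorem Equiv.Perm.viaEmbeddingHom_swap {β α : Type*} [DecidableEq β] [DecidableEq α] (e : β ↪ α)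
    (a b : β) : Equiv.Perm.viaEmbeddingHom e (swap a b) = swap (e a) (e b) := by
  ext z
  rw [Equiv.Perm.viaEmbeddingHom_apply]
  by_cases hz : z ∈ Set.range e
  · obtain ⟨w, rfl⟩ := hz
    rw [Equiv.Perm.viaEmbedding_apply, e.injective.map_swap]
  · rw [Equiv.Perm.viaEmbedding_apply_of_notMem _ _ _ hz, swap_apply_of_ne_of_ne]
    · rintro rfl; exact hz ⟨_, rfl⟩
    · rintro rfl; exact hz ⟨_, rfl⟩

theorem Equiv.Perm.card_support_viaEmbeddingHom_le {β α : Type*} [Fintype β]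
    [Fintype α] [DecidableEq α] (e : β ↪ α) (σ : Perm β) :
    (Equiv.Perm.viaEmbeddingHom e σ).support.card ≤ Fintype.card β := by
  classical
  have : (Equiv.Perm.viaEmbeddingHom e σ).support ⊆ Finset.univ.image e := by
    intro z hz
    by_contra hcon
    rw [Equiv.Perm.mem_support, Equiv.Perm.viaEmbeddingHom_apply,
      Equiv.Perm.viaEmbedding_apply_of_notMem _ _ _ (by simpa using hcon)] at hz
    exact hz rfl
  exact (Finset.card_le_card this).trans Finset.card_image_le

theorem Equiv.Perm.conj_swap {α : Type*} [DecidableEq α] (x : Perm α) (a b : α) :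
    MulAut.conj x (swap a b) = swap (x a) (x b) := by
  rw [MulAut.conj_apply, Equiv.mul_swap_eq_swap_mul, mul_inv_cancel_right]

/-- A set closed under the three-cycles of a group meets the support of such a three-cycle in the
empty set or the whole support. -/
theorem mem_iff_of_threeCycle_mem {α : Type*} [Fintype α] [DecidableEq α]
    {K : Subgroup (Perm α)} {S : Set α}
    (hS : ∀ g ∈ K, g.IsThreeCycle → ∀ b ∈ S, g b ∈ S) {a b c : α} (hab : a ≠ b) (hac : a ≠ c)
    (hbc : b ≠ c) (h : swap a b * swap b c ∈ K) : (a ∈ S ↔ b ∈ S) ∧ (c ∈ S ↔ b ∈ S) := by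
  have h3 : (swap a b * swap b c).IsThreeCycle := by
    rw [swap_comm a b]
    exact Equiv.Perm.isThreeCycle_swap_mul_swap_same hab.symm hbc hac
  have ha : a ∈ S → b ∈ S := fun hs => by
    simpa [swap_apply_of_ne_of_ne hab hac] using hS _ h h3 a hs
  have hb : b ∈ S → c ∈ S := fun hs => by
    simpa [swap_apply_of_ne_of_ne hac.symm hbc.symm] using hS _ h h3 b hs
  have hc : c ∈ S → a ∈ S := fun hs => by simpa using hS _ h h3 c hs
  tauto

end Embedding

section Rotation

open Equiv

variable (f m : ℕ)

/-- The rotation of `ZMod m`, fixing `f` further points. -/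
def shiftPerm : Perm (Fin f ⊕ ZMod m) := Equiv.sumCongr (Equiv.refl _) (Equiv.addRight 1)

/-- The points moved by `shiftPerm`. -/
def rotPoint (k : ℕ) : Fin f ⊕ ZMod m := Sum.inr (k : ZMod m)

theorem shiftPerm_pow_inl (k : ℕ) (a : Fin f) : (shiftPerm f m ^ k) (Sum.inl a) = Sum.inl a := by
  induction k with
  | zero => rfl
  | succ k ih => rw [pow_succ', Perm.mul_apply, ih]; rfl

theorem shiftPerm_pow_inr (k : ℕ) (a : ZMod m) :
    (shiftPerm f m ^ k) (Sum.inr a) = Sum.inr (a + k) := by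
  induction k with
  | zero => simp
  | succ k ih =>
    rw [pow_succ', Perm.mul_apply, ih]
    simp [shiftPerm, add_assoc]

theorem shiftPerm_pow_rotPoint (k l : ℕ) :
    (shiftPerm f m ^ k) (rotPoint f m l) = rotPoint f m (l + k) := by
  rw [rotPoint, shiftPerm_pow_inr, rotPoint, Nat.cast_add]

theorem shiftPerm_inl (a : Fin f) : shiftPerm f m (Sum.inl a) = Sum.inl a := rfl

theorem shiftPerm_rotPoint (l : ℕ) : shiftPerm f m (rotPoint f m l) = rotPoint f m (l + 1) := by
  simpa using shiftPerm_pow_rotPoint f m 1 l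

theorem shiftPerm_pow_eq_one_iff (k : ℕ) : shiftPerm f m ^ k = 1 ↔ (k : ZMod m) = 0 := by
  constructor
  · intro h
    have := congrArg (fun σ : Perm _ => σ (Sum.inr 0)) h
    simpa [shiftPerm_pow_inr] using this
  · intro h
    ext (a | a)
    · rw [shiftPerm_pow_inl]; rfl
    · rw [shiftPerm_pow_inr, h, add_zero]; rfl

theorem orderOf_shiftPerm : orderOf (shiftPerm f m) = m := by
  apply Nat.dvd_antisymm
  · exact orderOf_dvd_of_pow_eq_one ((shiftPerm_pow_eq_one_iff f m m).2 (ZMod.natCast_self m))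
  · rw [← CharP.cast_eq_zero_iff (ZMod m) m, ← shiftPerm_pow_eq_one_iff f m, pow_orderOf_eq_one]

variable {f m}

theorem rotPoint_inj {k l : ℕ} (hk : k < m) (hl : l < m) :
    rotPoint f m k = rotPoint f m l ↔ k = l := by
  rw [rotPoint, rotPoint, Sum.inr.injEq, ZMod.natCast_eq_natCast_iff', Nat.mod_eq_of_lt hk,
    Nat.mod_eq_of_lt hl]

variable [NeZero m]

theorem forall_rotPoint {P : Fin f ⊕ ZMod m → Prop} (h : ∀ i, P (Sum.inl i))
    (h' : ∀ k, P (rotPoint f m k)) (z) : P z := by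
  rcases z with a | a
  · exact h a
  · simpa [rotPoint] using h' a.val

theorem card_support_shiftPerm_pow (k : ℕ) :
    shiftPerm f m ^ k = 1 ∨ (shiftPerm f m ^ k).support.card = m := by
  by_cases h : (k : ZMod m) = 0
  · exact Or.inl ((shiftPerm_pow_eq_one_iff f m k).2 h)
  · right
    have : (shiftPerm f m ^ k).support = Finset.univ.map ⟨Sum.inr, Sum.inr_injective⟩ := by
      ext (a | a)
      · simp [shiftPerm_pow_inl]
      · simp [shiftPerm_pow_inr, h]
    rw [this, Finset.card_map, Finset.card_univ, ZMod.card]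

theorem sign_shiftPerm (hm : Odd m) : Perm.sign (shiftPerm f m) = 1 := by
  have h : Perm.sign (shiftPerm f m) ^ m = 1 := by
    rw [← map_pow, (shiftPerm_pow_eq_one_iff f m m).2 (ZMod.natCast_self m), map_one]
  rcases Int.units_eq_one_or (Perm.sign (shiftPerm f m)) with h1 | h1
  · exact h1
  · rw [h1, hm.neg_one_pow] at h
    exact absurd h (by decide)

end Rotation

section TwistPair

open Equiv

variable {f m : ℕ} [NeZero m]

/-- The rotation together with its commutator with `g`. -/
def twistPair (hm : Odd m) (g : Perm (Fin f ⊕ ZMod m)) :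
    alternatingGroup (Fin f ⊕ ZMod m) × alternatingGroup (Fin f ⊕ ZMod m) :=
  (⟨shiftPerm f m, Perm.mem_alternatingGroup.2 (sign_shiftPerm hm)⟩,
    ⟨g * (MulAut.conj (shiftPerm f m) g)⁻¹, Perm.mem_alternatingGroup.2 (by
      rw [MulAut.conj_apply]
      simp [sign_shiftPerm hm])⟩)

theorem coe_triple_twistPair_two (hm : Odd m) (g : Perm (Fin f ⊕ ZMod m)) :
    (triple (twistPair hm g) 2).1 =
      (shiftPerm f m * g) * (shiftPerm f m)⁻¹ * (shiftPerm f m * g)⁻¹ := by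
  simp [triple, twistPair, mul_assoc]

theorem card_support_triple_twistPair_pow (hm : Odd m) (g : Perm (Fin f ⊕ ZMod m)) {d : Fin 3}
    (hd : d ≠ 1) (k : ℕ) : triple (twistPair hm g) d ^ k = 1 ∨
      ((triple (twistPair hm g) d ^ k : alternatingGroup _) :
        Perm (Fin f ⊕ ZMod m)).support.card = m := by
  have h : triple (twistPair hm g) d ^ k = 1 ↔
      ((triple (twistPair hm g) d ^ k : alternatingGroup _) : Perm (Fin f ⊕ ZMod m)) = 1 :=
    OneMemClass.coe_eq_one.symm
  rw [h, Subgroup.coe_pow]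
  fin_cases d
  · exact card_support_shiftPerm_pow k
  · exact absurd rfl hd
  · change (triple (twistPair hm g) 2).1 ^ k = 1 ∨
      ((triple (twistPair hm g) 2).1 ^ k).support.card = m
    rw [coe_triple_twistPair_two, conj_pow, Perm.card_support_conj, inv_pow, Perm.support_inv]
    rcases card_support_shiftPerm_pow (f := f) (m := m) k with h | h
    · left; simp [h]
    · exact Or.inr h

theorem orderOf_triple_twistPair (hm : Odd m) (g : Perm (Fin f ⊕ ZMod m)) {d : Fin 3}
    (hd : d ≠ 1) : orderOf (triple (twistPair hm g) d) = m := by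
  rw [← Subgroup.orderOf_coe]
  fin_cases d
  · exact orderOf_shiftPerm f m
  · exact absurd rfl hd
  · change orderOf (triple (twistPair hm g) 2).1 = m
    rw [coe_triple_twistPair_two, ← MulAut.conj_apply, MulEquiv.orderOf_eq, orderOf_inv,
      orderOf_shiftPerm]

theorem hyperbolic_twistPair (hm : Odd m) (hm5 : 5 ≤ m) {g : Perm (Fin f ⊕ ZMod m)}
    (hg : (twistPair hm g).2 ^ 2 ≠ 1) : Hyperbolic (twistPair hm g) := by
  rw [Hyperbolic, orderOf_triple_twistPair hm g (d := 0) (by decide),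
    orderOf_triple_twistPair hm g (d := 2) (by decide)]
  have h1 : (1 : ℚ) / m ≤ 1 / 5 := by
    apply one_div_le_one_div_of_le <;> [norm_num; exact_mod_cast hm5]
  have h3 : 3 ≤ orderOf (triple (twistPair hm g) 1) := by
    have h0 := orderOf_pos (twistPair hm g).2
    have h4 : ¬ orderOf (twistPair hm g).2 ∣ 2 := by rwa [orderOf_dvd_iff_pow_eq_one]
    change 3 ≤ orderOf (twistPair hm g).2
    by_contra! h5
    interval_cases orderOf (twistPair hm g).2 <;> simp at h4
  have h2 : (1 : ℚ) / orderOf (triple (twistPair hm g) 1) ≤ 1 / 3 := by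
    apply one_div_le_one_div_of_le <;> [norm_num; exact_mod_cast h3]
  linarith

end TwistPair

section TwistFamily

open Equiv

theorem vecCons_injective_iff {α : Type*} {n : ℕ} {a : α} {v : Fin n → α} :
    Function.Injective (Matrix.vecCons a v) ↔ a ∉ Set.range v ∧ Function.Injective v :=
  Fin.cons_injective_iff

/-- Indices for pairs of numbers below `L` which differ by at least two. -/
abbrev GapPairs (L : ℕ) : Type := Option (Σ j : Fin L, Fin (j - 1))

theorem card_gapPairs (L : ℕ) : 2 * Fintype.card (GapPairs (L + 1)) = L * (L - 1) + 2 := by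
  have key : ∀ L : ℕ, 2 * ∑ j ∈ Finset.range (L + 1), (j - 1) = L * (L - 1) := by
    intro L
    induction L with
    | zero => rfl
    | succ L ih =>
      rw [Finset.sum_range_succ, mul_add, ih]
      cases L with
      | zero => rfl
      | succ L => simp only [Nat.add_sub_cancel]; ring
  rw [Fintype.card_option, Fintype.card_sigma]
  simp only [Fintype.card_fin]
  rw [Fin.sum_univ_eq_sum_range (fun j => j - 1), mul_add, key]

/-- The involution exchanging `i` with `j` and `i + 1` with `j + 1`. -/
def gapSwap (i j a : ℕ) : ℕ :=
  if a = i then j else if a = j then i else if a = i + 1 then j + 1 else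
    if a = j + 1 then i + 1 else a

theorem gapSwap_lt {i j a L : ℕ} (hi : i < j) (hj : j < L) (ha : a < L + 1) :
    gapSwap i j a < L + 1 := by
  unfold gapSwap
  split_ifs <;> omega

theorem eq_and_eq_of_gapSwap {i j i' j' : ℕ} (hi : i + 1 < j) (hi' : i' + 1 < j')
    (h : gapSwap i j i = gapSwap i' j' i) (h' : gapSwap i j i' = gapSwap i' j' i') :
    i = i' ∧ j = j' := by
  unfold gapSwap at h h'
  rw [if_pos rfl] at h
  rw [if_pos (rfl : i' = i')] at h'
  have h1 : i = i' ∨ i = i' + 1 := by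
    split_ifs at h <;> omega
  have h2 : i' = i ∨ i' = i + 1 := by
    split_ifs at h' <;> omega
  have h3 : i = i' := by omega
  rw [if_pos h3] at h
  exact ⟨h3, h⟩

variable {f m : ℕ}

theorem swap_mul_swap_rotPoint {s L i j a : ℕ} (hle : s + L + 1 ≤ m) (hij : i + 1 < j)
    (hj : j < L) (ha : a < L + 1) :
    (swap (rotPoint f m (s + i)) (rotPoint f m (s + j)) *
      swap (rotPoint f m (s + i + 1)) (rotPoint f m (s + j + 1))) (rotPoint f m (s + a)) =
    rotPoint f m (s + gapSwap i j a) := by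
  have hswap : ∀ b c a, b < L + 1 → c < L + 1 → a < L + 1 →
      swap (rotPoint f m (s + b)) (rotPoint f m (s + c)) (rotPoint f m (s + a)) =
        rotPoint f m (s + if a = b then c else if a = c then b else a) := by
    intro b c a hb hc ha
    have hinj : ∀ k l, k < L + 1 → l < L + 1 →
        (rotPoint f m (s + k) = rotPoint f m (s + l) ↔ k = l) := fun k l hk hl => by
      rw [rotPoint_inj (by omega) (by omega)]; omega
    rw [swap_apply_def]
    simp only [hinj _ _ ha hb, hinj _ _ ha hc]
    split_ifs <;> rfl
  rw [Perm.mul_apply, add_assoc, add_assoc, hswap _ _ _ (by omega) (by omega) ha,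
    hswap _ _ _ (by omega) (by omega) (by split_ifs <;> omega)]
  congr 2
  unfold gapSwap
  split_ifs <;> omega

variable [NeZero m]

/-- A swap followed by a further swap depending on a pair of indices. -/
def twistFamily (P Q : Fin f ⊕ ZMod m) (s : ℕ) {L : ℕ} :
    GapPairs L → Perm (Fin f ⊕ ZMod m)
  | none => swap P Q
  | some ⟨j, i⟩ => swap P Q * swap (rotPoint f m (s + i)) (rotPoint f m (s + j))

/-- The position of three points relative to the shift. -/
structure TwistFrame (P Q R : Fin f ⊕ ZMod m) (s L : ℕ) : Prop where
  odd : Odd m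
  five_le : 5 ≤ m
  le : s + L + 1 ≤ m
  conj : MulAut.conj (shiftPerm f m) (swap P Q) = swap Q R
  ne₁ : P ≠ Q
  ne₂ : P ≠ R
  ne₃ : Q ≠ R
  ne₄ : ∀ k, s ≤ k → k < m → rotPoint f m k ≠ P
  ne₅ : ∀ k, s ≤ k → k < m → rotPoint f m k ≠ Q
  ne₆ : ∀ k, s ≤ k → k < m → rotPoint f m k ≠ R
  connected : ∀ S : Set (Fin f ⊕ ZMod m), S.Nonempty →
    (∀ g ∈ Subgroup.closure {shiftPerm f m, swap P Q * swap Q R},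
      g.IsThreeCycle → ∀ b ∈ S, g b ∈ S) → S = Set.univ

variable {P Q R : Fin f ⊕ ZMod m} {s L : ℕ}

/-- The family of pairs attached to a frame. -/
def twistFamilyPair (h : TwistFrame P Q R s L) (k : GapPairs L) :
    alternatingGroup (Fin f ⊕ ZMod m) × alternatingGroup (Fin f ⊕ ZMod m) :=
  twistPair h.odd (twistFamily P Q s k)

theorem twistFamilyPair_none (h : TwistFrame P Q R s L) :
    ((twistFamilyPair h none).2 : Perm (Fin f ⊕ ZMod m)) = swap P Q * swap Q R := by
  simp only [twistFamilyPair, twistFamily, twistPair, h.conj, swap_inv]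

/-- The points moved by a member of the family. -/
def framePoints (P Q R : Fin f ⊕ ZMod m) (s i j : ℕ) : Fin 7 → Fin f ⊕ ZMod m :=
  ![P, Q, R, rotPoint f m (s + i), rotPoint f m (s + j), rotPoint f m (s + i + 1),
    rotPoint f m (s + j + 1)]

theorem framePoints_injective (h : TwistFrame P Q R s L) {i j : ℕ} (hi : i + 1 < j) (hj : j < L) :
    Function.Injective (framePoints P Q R s i j) := by
  have hle := h.le
  have h4 := h.ne₄
  have h5 := h.ne₅
  have h6 := h.ne₆
  have h7 : ∀ k l, k < m → l < m → k ≠ l → rotPoint f m k ≠ rotPoint f m l :=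
    fun k l hk hl hkl => by rwa [Ne, rotPoint_inj hk hl]
  simp only [framePoints, vecCons_injective_iff, Matrix.range_cons, Matrix.range_empty,
    Set.union_empty, Set.mem_union, Set.mem_singleton_iff, not_or]
  refine ⟨⟨h.ne₁, h.ne₂, ?_, ?_, ?_, ?_⟩, ⟨h.ne₃, ?_, ?_, ?_, ?_⟩, ⟨?_, ?_, ?_, ?_⟩,
    ⟨?_, ?_, ?_⟩, ⟨?_, ?_⟩, ?_, ?_, ?_⟩
  all_goals first
    | exact (h4 _ (by omega) (by omega)).symm
    | exact (h5 _ (by omega) (by omega)).symm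
    | exact (h6 _ (by omega) (by omega)).symm
    | exact h7 _ _ (by omega) (by omega) (by omega)
    | simp [Function.injective_of_subsingleton]

/-- The pattern of the members of the family. -/
def framePerm : Perm (Fin 7) := swap 0 1 * swap 1 2 * (swap 3 4 * swap 5 6)

theorem twistFamilyPair_some (h : TwistFrame P Q R s L) (j : Fin L) (i : Fin (j - 1)) :
    ((twistFamilyPair h (some ⟨j, i⟩)).2 : Perm (Fin f ⊕ ZMod m)) =
      Perm.viaEmbeddingHom
        ⟨framePoints P Q R s i j, framePoints_injective h (by omega) j.2⟩ framePerm := by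
  have hdec : framePerm = swap 0 1 * swap 3 4 * (swap 1 2 * swap 5 6)⁻¹ := by decide
  rw [hdec]
  simp only [twistFamilyPair, twistFamily, twistPair, map_mul, map_inv, h.conj,
    Perm.viaEmbeddingHom_swap, Perm.conj_swap, shiftPerm_rotPoint]
  rfl

theorem twistFamilyPair_some_eq (h : TwistFrame P Q R s L) (j : Fin L) (i : Fin (j - 1)) :
    ((twistFamilyPair h (some ⟨j, i⟩)).2 : Perm (Fin f ⊕ ZMod m)) =
      swap P Q * swap Q R * (swap (rotPoint f m (s + i)) (rotPoint f m (s + j)) *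
        swap (rotPoint f m (s + i + 1)) (rotPoint f m (s + j + 1))) := by
  rw [twistFamilyPair_some]
  simp only [framePerm, map_mul, Perm.viaEmbeddingHom_swap, Function.Embedding.coeFn_mk,
    framePoints, Matrix.cons_val]

theorem twistFamilyPair_pow_four (h : TwistFrame P Q R s L) (k : GapPairs L) :
    ((twistFamilyPair h k).2 : Perm (Fin f ⊕ ZMod m)) ^ 4 = swap P Q * swap Q R := by
  rcases k with _ | ⟨j, i⟩
  · have h3 : (swap P Q * swap Q R) ^ 3 = 1 := by
      rw [swap_comm P Q, ← (Perm.isThreeCycle_swap_mul_swap_same h.ne₁.symm h.ne₃ h.ne₂).orderOf,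
        pow_orderOf_eq_one]
    rw [twistFamilyPair_none, pow_succ, h3, one_mul]
  · have hdec : framePerm ^ 4 = swap 0 1 * swap 1 2 := by decide +kernel
    rw [twistFamilyPair_some, ← map_pow, hdec, map_mul, Perm.viaEmbeddingHom_swap,
      Perm.viaEmbeddingHom_swap]
    rfl

theorem twistFamilyPair_pow_six (h : TwistFrame P Q R s L) (k : GapPairs L) :
    (twistFamilyPair h k).2 ^ 6 = 1 := by
  have h3 : (swap P Q * swap Q R) ^ 3 = 1 := by
    rw [swap_comm P Q, ← (Perm.isThreeCycle_swap_mul_swap_same h.ne₁.symm h.ne₃ h.ne₂).orderOf,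
      pow_orderOf_eq_one]
  apply Subtype.ext
  rw [Subgroup.coe_pow]
  rcases k with _ | ⟨j, i⟩
  · rw [twistFamilyPair_none, pow_mul _ 3 2, h3]; rfl
  · have hdec : framePerm ^ 6 = 1 := by decide +kernel
    rw [twistFamilyPair_some, ← map_pow, hdec, map_one]; rfl

theorem twistFamilyPair_sq_ne_one (h : TwistFrame P Q R s L) (k : GapPairs L) :
    (twistFamilyPair h k).2 ^ 2 ≠ 1 := by
  intro h1
  have h2 := congrArg (fun a : alternatingGroup (Fin f ⊕ ZMod m) => a.1 ^ 2) h1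
  simp only [Subgroup.coe_pow, ← pow_mul] at h2
  rw [twistFamilyPair_pow_four h k] at h2
  have h3 := Perm.isThreeCycle_swap_mul_swap_same h.ne₁.symm h.ne₃ h.ne₂
  rw [swap_comm Q P, h2] at h3
  simpa using h3.orderOf

theorem orderOf_twistFamilyPair_some (h : TwistFrame P Q R s L) (j : Fin L) (i : Fin (j - 1)) :
    orderOf (twistFamilyPair h (some ⟨j, i⟩)).2 = 6 := by
  have hinj := Perm.viaEmbeddingHom_injective
    ⟨framePoints P Q R s i j, framePoints_injective h (by omega) j.2⟩
  rw [← Subgroup.orderOf_coe, twistFamilyPair_some, orderOf_injective _ hinj]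
  refine orderOf_eq_of_pow_and_pow_div_prime (by norm_num) (by decide +kernel) ?_
  intro p hp hp6
  have : p ≤ 6 := Nat.le_of_dvd (by norm_num) hp6
  interval_cases p
  · exact absurd hp (by norm_num)
  · exact absurd hp (by norm_num)
  · decide +kernel
  · decide +kernel
  · omega
  · omega
  · exact absurd hp (by norm_num)

theorem card_support_twistFamilyPair (h : TwistFrame P Q R s L) (k : GapPairs L) :
    ((twistFamilyPair h k).2 : Perm (Fin f ⊕ ZMod m)).support.card ≤ 7 := by
  rcases k with _ | ⟨j, i⟩
  · rw [twistFamilyPair_none, swap_comm P Q,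
      (Perm.isThreeCycle_swap_mul_swap_same h.ne₁.symm h.ne₃ h.ne₂).card_support]
    norm_num
  · rw [twistFamilyPair_some]
    exact Perm.card_support_viaEmbeddingHom_le _ _

theorem twistFamilyPair_injective (h : TwistFrame P Q R s L) {k l : GapPairs L}
    (hkl : (twistFamilyPair h k).2 = (twistFamilyPair h l).2) : k = l := by
  have h6 : ∀ (j : Fin L) (i : Fin (j - 1)),
      (twistFamilyPair h none).2 ≠ (twistFamilyPair h (some ⟨j, i⟩)).2 := by
    intro j i hji
    have h1 := orderOf_twistFamilyPair_some h j i
    rw [← hji, ← Subgroup.orderOf_coe, twistFamilyPair_none, swap_comm P Q,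
      (Perm.isThreeCycle_swap_mul_swap_same h.ne₁.symm h.ne₃ h.ne₂).orderOf] at h1
    omega
  rcases k with _ | ⟨j, i⟩ <;> rcases l with _ | ⟨j', i'⟩
  · rfl
  · exact absurd hkl (h6 _ _)
  · exact absurd hkl.symm (h6 _ _)
  · have h1 := congrArg (Subtype.val) hkl
    have hle := h.le
    rw [twistFamilyPair_some_eq, twistFamilyPair_some_eq] at h1
    replace h1 := mul_left_cancel h1
    have hi := i.2
    have hi' := i'.2
    have hj := j.2
    have hj' := j'.2
    have hinj : ∀ k l, k < L + 1 → l < L + 1 →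
        rotPoint f m (s + k) = rotPoint f m (s + l) → k = l := fun k l hk hl hkl => by
      rw [rotPoint_inj (by omega) (by omega)] at hkl; omega
    have key : ∀ a, a < L + 1 → gapSwap i j a = gapSwap i' j' a := by
      intro a ha
      refine hinj _ _ (gapSwap_lt (by omega) hj ha) (gapSwap_lt (by omega) hj' ha) ?_
      rw [← swap_mul_swap_rotPoint (f := f) hle (by omega) hj ha,
        ← swap_mul_swap_rotPoint (f := f) hle (by omega) hj' ha, h1]
    obtain ⟨hi1, hj1⟩ := eq_and_eq_of_gapSwap (by omega) (by omega) (key i (by omega))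
      (key i' (by omega))
    obtain rfl := Fin.ext hj1
    obtain rfl := Fin.ext hi1
    rfl

theorem twistFamilyPair_closure (h : TwistFrame P Q R s L) (k : GapPairs L) :
    Subgroup.closure {(twistFamilyPair h k).1, (twistFamilyPair h none).2} = ⊤ := by
  have hmap : (Subgroup.closure {(twistFamilyPair h k).1, (twistFamilyPair h none).2}).map
      (alternatingGroup (Fin f ⊕ ZMod m)).subtype =
      Subgroup.closure {shiftPerm f m, swap P Q * swap Q R} := by
    rw [MonoidHom.map_closure, Set.image_pair, ← twistFamilyPair_none h]
    rfl
  refine generates_of_connected_threeCycles (x := (twistFamilyPair h k).1)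
    (y := (twistFamilyPair h none).2) (c := (twistFamilyPair h none).2)
    (Subgroup.subset_closure (by simp)) ?_ ?_
  · rw [twistFamilyPair_none, swap_comm P Q]
    exact Perm.isThreeCycle_swap_mul_swap_same h.ne₁.symm h.ne₃ h.ne₂
  · intro S hS hS'
    refine h.connected S hS fun g hg hg3 b hb => ?_
    rw [← hmap] at hg
    obtain ⟨g', hg', rfl⟩ := Subgroup.mem_map.1 hg
    exact hS' g' hg' hg3 b hb

theorem twistFamilyPair_snd_none (h : TwistFrame P Q R s L) (k : GapPairs L) :
    (twistFamilyPair h none).2 = (twistFamilyPair h k).2 ^ 4 := by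
  apply Subtype.ext
  rw [twistFamilyPair_none, Subgroup.coe_pow, twistFamilyPair_pow_four]

theorem generates_twistFamilyPair (h : TwistFrame P Q R s L) (k : GapPairs L) :
    Generates (twistFamilyPair h k) := by
  rw [Generates, eq_top_iff, ← twistFamilyPair_closure h k, Subgroup.closure_le]
  rintro g (rfl | rfl)
  · exact Subgroup.subset_closure (by simp)
  · rw [twistFamilyPair_snd_none h k]
    exact Subgroup.pow_mem _ (Subgroup.subset_closure (by simp)) 4

theorem not_autEquiv_twistFamilyPair (h : TwistFrame P Q R s L) {k l : GapPairs L} (hkl : k ≠ l) :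
    ¬ AutEquiv (twistFamilyPair h k) (twistFamilyPair h l) := by
  rintro ⟨φ, h1, h2⟩
  apply hkl
  apply twistFamilyPair_injective h
  have hφ : φ.toMonoidHom = MonoidHom.id _ := by
    refine MonoidHom.eq_of_eqOn_dense (twistFamilyPair_closure h k) ?_
    rintro g (rfl | rfl)
    · exact h1
    · change φ _ = _
      rw [twistFamilyPair_snd_none h k, map_pow, h2, ← twistFamilyPair_snd_none h l]
      exact twistFamilyPair_snd_none h k
  rw [← h2]
  exact (DFunLike.congr_fun hφ _).symm

end TwistFamily

section Transport

open Equiv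

variable {S T : Type*} [Group S] [Group T]

theorem triple_map (φ : S ≃* T) (p : S × S) (d : Fin 3) :
    triple (φ p.1, φ p.2) d = φ (triple p d) := by
  fin_cases d <;> simp [triple]

theorem Generates.map_mulEquiv (φ : S ≃* T) {p : S × S} (h : Generates p) :
    Generates (φ p.1, φ p.2) := by
  have := congrArg (Subgroup.map φ.toMonoidHom) h
  rw [MonoidHom.map_closure, Set.image_pair, Subgroup.map_top_of_surjective _ φ.surjective] at this
  exact this

theorem Hyperbolic.map_mulEquiv (φ : S ≃* T) {p : S × S} (h : Hyperbolic p) :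
    Hyperbolic (φ p.1, φ p.2) := by
  simp only [Hyperbolic, triple_map, MulEquiv.orderOf_eq] at h ⊢
  exact h

end Transport

section Disjoint

open Equiv

variable {α : Type*} [Fintype α] [DecidableEq α]

theorem Equiv.Perm.card_support_permCongr {β : Type*} [Fintype β] [DecidableEq β] (e : β ≃ α)
    (g : Perm β) : (e.permCongr g).support.card = g.support.card := by
  have : (e.permCongr g).support = g.support.map e.toEmbedding := by
    ext a
    simp [Equiv.eq_symm_apply]
  rw [this, Finset.card_map]

theorem Equiv.Perm.card_support_pow_le (g : Perm α) (k : ℕ) :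
    (g ^ k).support.card ≤ g.support.card :=
  Finset.card_le_card (Equiv.Perm.support_pow_le g k)

theorem primeDisjoint_of_card_support {P Q : alternatingGroup α × alternatingGroup α} {a b : ℕ}
    (hab : a ≠ b)
    (hP : ∀ d, d ≠ 1 → ∀ k : ℕ, triple P d ^ k = 1 ∨
      ((triple P d ^ k : alternatingGroup α) : Perm α).support.card = a)
    (hQ : ∀ d, d ≠ 1 → ∀ k : ℕ, triple Q d ^ k = 1 ∨
      ((triple Q d ^ k : alternatingGroup α) : Perm α).support.card = b)
    (hPb : (P.2 : Perm α).support.card < b) (hQa : (Q.2 : Perm α).support.card < a)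
    {q r : ℕ} (hqr : q.Coprime r) (hPq : P.2 ^ q = 1) (hQr : Q.2 ^ r = 1) :
    PrimeDisjoint P Q := by
  intro p _ d e k l hc _
  have hcard : ((triple P d ^ k : alternatingGroup α) : Perm α).support.card =
      ((triple Q e ^ l : alternatingGroup α) : Perm α).support.card := by
    obtain ⟨c, hc⟩ := isConj_iff.1 hc
    rw [← hc, Subgroup.coe_mul, Subgroup.coe_mul, Subgroup.coe_inv, Perm.card_support_conj]
  have hone : triple Q e ^ l = 1 → triple P d ^ k = 1 := fun h => by
    rw [h] at hc
    exact isConj_one_left.1 hc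
  have hP1 := Perm.card_support_pow_le (P.2 : Perm α) k
  have hQ1 := Perm.card_support_pow_le (Q.2 : Perm α) l
  by_cases hd : d = 1 <;> by_cases he : e = 1
  · subst hd he
    obtain ⟨c, hc⟩ := isConj_iff.1 hc
    have h1 : orderOf (P.2 ^ k) ∣ q := by
      rw [orderOf_dvd_iff_pow_eq_one, ← pow_mul, mul_comm, pow_mul, hPq, one_pow]
    have h2 : orderOf (P.2 ^ k) ∣ r := by
      have h3 : c * P.2 ^ k * c⁻¹ = Q.2 ^ l := hc
      have h4 : (c * P.2 ^ k * c⁻¹) ^ r = 1 := by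
        rw [h3, ← pow_mul, mul_comm, pow_mul, hQr, one_pow]
      rw [conj_pow, mul_inv_eq_one, mul_eq_left] at h4
      exact orderOf_dvd_iff_pow_eq_one.2 h4
    exact orderOf_eq_one_iff.1 (Nat.eq_one_of_dvd_coprimes hqr h1 h2)
  · subst hd
    rcases hQ e he l with h | h
    · exact hone h
    · change ((P.2 : Perm α) ^ k).support.card = _ at hcard
      omega
  · subst he
    rcases hP d hd k with h | h
    · exact h
    · change _ = ((Q.2 : Perm α) ^ l).support.card at hcard
      omega
  · rcases hP d hd k with h | h
    · exact h
    · rcases hQ e he l with h' | h'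
      · exact hone h'
      · omega

end Disjoint

section Frames

open Equiv

variable {f m : ℕ}

theorem rotPoint_add_ne {k j : ℕ} (hj : 0 < j) (hjm : j < m) :
    rotPoint f m (k + j) ≠ rotPoint f m k := by
  intro h
  rw [rotPoint, rotPoint, Sum.inr.injEq, Nat.cast_add, add_eq_left,
    CharP.cast_eq_zero_iff (ZMod m) m] at h
  exact absurd (Nat.le_of_dvd hj h) (by omega)

theorem inl_ne_rotPoint (i : Fin f) (k : ℕ) : (Sum.inl i : Fin f ⊕ ZMod m) ≠ rotPoint f m k :=
  Sum.inl_ne_inr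

theorem conj_pow_swap_mul_swap_mem {α : Type*} [DecidableEq α] {K : Subgroup (Perm α)}
    {x : Perm α} (hx : x ∈ K) {a b c : α} (h : swap a b * swap b c ∈ K) (k : ℕ) :
    swap ((x ^ k) a) ((x ^ k) b) * swap ((x ^ k) b) ((x ^ k) c) ∈ K := by
  rw [← Perm.conj_swap, ← Perm.conj_swap, ← map_mul, MulAut.conj_apply]
  exact K.mul_mem (K.mul_mem (K.pow_mem hx k) h) (K.inv_mem (K.pow_mem hx k))

variable [NeZero m]

theorem twistFrame_zero (hm : Odd m) (hm7 : 7 ≤ m) :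
    TwistFrame (rotPoint 0 m 0) (rotPoint 0 m 1) (rotPoint 0 m 2) 3 (m - 4) where
  odd := hm
  five_le := by omega
  le := by omega
  conj := by rw [Perm.conj_swap, shiftPerm_rotPoint, shiftPerm_rotPoint]
  ne₁ := (rotPoint_add_ne (k := 0) (j := 1) (by omega) (by omega)).symm
  ne₂ := (rotPoint_add_ne (k := 0) (j := 2) (by omega) (by omega)).symm
  ne₃ := (rotPoint_add_ne (k := 1) (j := 1) (by omega) (by omega)).symm
  ne₄ k h1 h2 := by rw [Ne, rotPoint_inj h2 (by omega)]; omega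
  ne₅ k h1 h2 := by rw [Ne, rotPoint_inj h2 (by omega)]; omega
  ne₆ k h1 h2 := by rw [Ne, rotPoint_inj h2 (by omega)]; omega
  connected S hS hS' := by
    have key : ∀ k, rotPoint 0 m k ∈ S ↔ rotPoint 0 m (k + 1) ∈ S := by
      intro k
      have h := conj_pow_swap_mul_swap_mem (a := rotPoint 0 m 0) (b := rotPoint 0 m 1)
        (c := rotPoint 0 m 2) (K := Subgroup.closure {shiftPerm 0 m, _})
        (Subgroup.subset_closure (Set.mem_insert _ _))
        (Subgroup.subset_closure (Set.mem_insert_of_mem _ rfl)) k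
      simp only [shiftPerm_pow_rotPoint] at h
      have := (mem_iff_of_threeCycle_mem hS'
        (by rw [Ne, add_comm 0, add_comm 1, ← Ne]
            exact (rotPoint_add_ne (k := k + 0) (j := 1) (by omega) (by omega)).symm)
        (by rw [Ne, add_comm 0, add_comm 2, ← Ne]
            exact (rotPoint_add_ne (k := k + 0) (j := 2) (by omega) (by omega)).symm)
        (by rw [Ne, add_comm 1, add_comm 2, ← Ne]
            exact (rotPoint_add_ne (k := k + 1) (j := 1) (by omega) (by omega)).symm) h).1
      rwa [zero_add, add_comm 1] at this
    have key' : ∀ k, rotPoint 0 m k ∈ S ↔ rotPoint 0 m 0 ∈ S := by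
      intro k
      induction k with
      | zero => rfl
      | succ k ih => rw [← key, ih]
    obtain ⟨z, hz⟩ := hS
    have h0 : rotPoint 0 m 0 ∈ S := by
      revert hz
      exact forall_rotPoint (P := fun z => z ∈ S → rotPoint 0 m 0 ∈ S) (fun i => i.elim0)
        (fun k => (key' k).1) z
    exact Set.eq_univ_of_forall (forall_rotPoint (fun i => i.elim0) fun k => (key' k).2 h0)

theorem twistFrame_one (hm : Odd m) (hm7 : 7 ≤ m) :
    TwistFrame (rotPoint 1 m 0) (Sum.inl 0) (rotPoint 1 m 1) 2 (m - 3) where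
  odd := hm
  five_le := by omega
  le := by omega
  conj := by rw [Perm.conj_swap, shiftPerm_rotPoint, shiftPerm_inl, swap_comm]
  ne₁ := (inl_ne_rotPoint _ _).symm
  ne₂ := (rotPoint_add_ne (k := 0) (j := 1) (by omega) (by omega)).symm
  ne₃ := inl_ne_rotPoint _ _
  ne₄ k h1 h2 := by rw [Ne, rotPoint_inj h2 (by omega)]; omega
  ne₅ k h1 h2 := (inl_ne_rotPoint _ _).symm
  ne₆ k h1 h2 := by rw [Ne, rotPoint_inj h2 (by omega)]; omega
  connected S hS hS' := by
    have key : ∀ k, rotPoint 1 m k ∈ S ↔ Sum.inl 0 ∈ S := by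
      intro k
      have h := conj_pow_swap_mul_swap_mem (a := rotPoint 1 m 0) (b := Sum.inl 0)
        (c := rotPoint 1 m 1) (K := Subgroup.closure {shiftPerm 1 m, _})
        (Subgroup.subset_closure (Set.mem_insert _ _))
        (Subgroup.subset_closure (Set.mem_insert_of_mem _ rfl)) k
      simp only [shiftPerm_pow_rotPoint, shiftPerm_pow_inl] at h
      have := (mem_iff_of_threeCycle_mem hS' (inl_ne_rotPoint _ _).symm
        (by rw [Ne, add_comm 0, add_comm 1, ← Ne]
            exact (rotPoint_add_ne (k := k + 0) (j := 1) (by omega) (by omega)).symm)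
        (inl_ne_rotPoint _ _) h).1
      rwa [zero_add] at this
    obtain ⟨z, hz⟩ := hS
    have h0 : Sum.inl 0 ∈ S := by
      revert hz
      exact forall_rotPoint (P := fun z => z ∈ S → Sum.inl 0 ∈ S)
        (fun i => by rw [Subsingleton.elim i 0]; exact id) (fun k => (key k).1) z
    exact Set.eq_univ_of_forall
      (forall_rotPoint (fun i => by rw [Subsingleton.elim i 0]; exact h0) fun k => (key k).2 h0)

end Frames

section Bridge

open Equiv

theorem generates_of_connected_coe {α : Type*} [Fintype α] [DecidableEq α]
    {p : alternatingGroup α × alternatingGroup α} {c : Perm α}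
    (hc : c ∈ Subgroup.closure {(p.1 : Perm α), (p.2 : Perm α)}) (hc3 : c.IsThreeCycle)
    (h : ∀ S : Set α, S.Nonempty →
      (∀ g ∈ Subgroup.closure {(p.1 : Perm α), (p.2 : Perm α)}, g.IsThreeCycle →
        ∀ b ∈ S, g b ∈ S) → S = Set.univ) : Generates p := by
  have hmap : (Subgroup.closure {p.1, p.2}).map (alternatingGroup α).subtype =
      Subgroup.closure {(p.1 : Perm α), (p.2 : Perm α)} := by
    rw [MonoidHom.map_closure, Set.image_pair]
    rfl
  rw [← hmap] at hc
  obtain ⟨c, hc', rfl⟩ := Subgroup.mem_map.1 hc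
  refine generates_of_connected_threeCycles (x := p.1) (y := p.2) hc' hc3
    fun S hS hS' => h S hS fun g hg hg3 b hb => ?_
  rw [← hmap] at hg
  obtain ⟨g, hg', rfl⟩ := Subgroup.mem_map.1 hg
  exact hS' g hg' hg3 b hb

variable {f m : ℕ} [NeZero m]

/-- The points `inl 0, …, inl (f - 1)` followed by `f + 3` consecutive points of the rotation. -/
def bridgePoints (f m : ℕ) : Fin (f + (f + 3)) → Fin f ⊕ ZMod m :=
  Fin.append Sum.inl (fun i : Fin (f + 3) => rotPoint f m i)

omit [NeZero m] in
theorem bridgePoints_injective (h : f + 3 ≤ m) : Function.Injective (bridgePoints f m) := by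
  rw [bridgePoints, Fin.append_injective_iff]
  refine ⟨Sum.inl_injective, fun i j hij => ?_, fun i j => inl_ne_rotPoint _ _⟩
  exact Fin.ext ((rotPoint_inj (by omega) (by omega)).1 hij)

omit [NeZero m] in
omit [NeZero m] in
/-- The embedding of the bridge points. -/
def bridgeEmbedding (h : f + 3 ≤ m) : Fin (f + (f + 3)) ↪ Fin f ⊕ ZMod m :=
  ⟨bridgePoints f m, bridgePoints_injective h⟩

theorem conj_pow_twistPair_snd (hm : Odd m) (g : Perm (Fin f ⊕ ZMod m)) (s : ℕ) :
    MulAut.conj (shiftPerm f m ^ s) (twistPair hm g).2.1 =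
      MulAut.conj (shiftPerm f m ^ s) g * (MulAut.conj (shiftPerm f m ^ (s + 1)) g)⁻¹ := by
  simp only [twistPair, map_mul, map_inv, pow_succ, MulAut.mul_apply]

theorem conj_pow_mem_closure {G : Type*} [Group G] (x y : G) (s : ℕ) :
    MulAut.conj (x ^ s) y ∈ Subgroup.closure {x, y} := by
  have hx : x ∈ Subgroup.closure {x, y} := Subgroup.subset_closure (by simp)
  have hy : y ∈ Subgroup.closure {x, y} := Subgroup.subset_closure (by simp)
  exact Subgroup.mul_mem _ (Subgroup.mul_mem _ (Subgroup.pow_mem _ hx s) hy)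
    (Subgroup.inv_mem _ (Subgroup.pow_mem _ hx s))

section Two

/-- The conjugates of the bridging element, for two fixed points. -/
def bridgePermTwo : Fin 3 → Perm (Fin 7) :=
  ![swap 0 2 * swap 1 3 * (swap 0 3 * swap 1 4)⁻¹,
    swap 0 3 * swap 1 4 * (swap 0 4 * swap 1 5)⁻¹,
    swap 0 4 * swap 1 5 * (swap 0 5 * swap 1 6)⁻¹]

theorem bridgePermTwo_word : bridgePermTwo 0 * bridgePermTwo 0 * bridgePermTwo 2 *
    bridgePermTwo 1 * (bridgePermTwo 2)⁻¹ = swap 1 6 * swap 6 2 := by decide +kernel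

theorem bridgePermTwo_word' : bridgePermTwo 0 * (swap 1 6 * swap 6 2) * (bridgePermTwo 0)⁻¹ =
    swap 4 6 * swap 6 0 := by decide +kernel

/-- The swaps joining the fixed points to the rotation. -/
def bridgeSwapsTwo (m : ℕ) : Perm (Fin 2 ⊕ ZMod m) :=
  swap (Sum.inl 0) (rotPoint 2 m 0) * swap (Sum.inl 1) (rotPoint 2 m 1)

theorem conj_twistPair_two (hm : Odd m) (h5 : 2 + 3 ≤ m) (s : Fin 3) :
    MulAut.conj (shiftPerm 2 m ^ (s : ℕ)) (twistPair hm (bridgeSwapsTwo m)).2.1 =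
      Perm.viaEmbeddingHom (bridgeEmbedding h5) (bridgePermTwo s) := by
  rw [conj_pow_twistPair_snd, bridgeSwapsTwo]
  simp only [map_mul, Perm.conj_swap, shiftPerm_pow_inl, shiftPerm_pow_rotPoint]
  obtain rfl | rfl | rfl : s = 0 ∨ s = 1 ∨ s = 2 := by fin_cases s <;> simp
  all_goals
    simp only [bridgePermTwo, map_mul, map_inv, Perm.viaEmbeddingHom_swap, Matrix.cons_val]
    rfl

theorem twistPair_two_snd (hm : Odd m) (h5 : 2 + 3 ≤ m) :
    (twistPair hm (bridgeSwapsTwo m)).2.1 =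
      Perm.viaEmbeddingHom (bridgeEmbedding h5) (bridgePermTwo 0) := by
  rw [← conj_twistPair_two hm h5 0]
  simp

theorem generates_twistPair_two (hm : Odd m) (h5 : 2 + 3 ≤ m) :
    Generates (twistPair hm (bridgeSwapsTwo m)) := by
  set x := shiftPerm 2 m
  set y := (twistPair hm (bridgeSwapsTwo m)).2.1 with hy
  have hs : ∀ s : Fin 3, Perm.viaEmbeddingHom (bridgeEmbedding h5) (bridgePermTwo s) ∈
      Subgroup.closure {x, y} := fun s => by
    rw [← conj_twistPair_two hm]
    exact conj_pow_mem_closure _ _ _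
  set φ := Perm.viaEmbeddingHom (bridgeEmbedding h5)
  set K := Subgroup.closure {x, y}
  have hc : swap (Sum.inl 1) (rotPoint 2 m 4) * swap (rotPoint 2 m 4) (rotPoint 2 m 0) ∈ K := by
    have h1 : φ (swap 1 6 * swap 6 2) ∈ K := by
      rw [← bridgePermTwo_word]
      simp only [map_mul, map_inv]
      exact K.mul_mem (K.mul_mem (K.mul_mem (K.mul_mem (hs 0) (hs 0)) (hs 2)) (hs 1))
        (K.inv_mem (hs 2))
    rwa [map_mul, Perm.viaEmbeddingHom_swap, Perm.viaEmbeddingHom_swap] at h1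
  have hc' : swap (rotPoint 2 m 2) (rotPoint 2 m 4) * swap (rotPoint 2 m 4) (Sum.inl 0) ∈ K := by
    have h1 : φ (swap 4 6 * swap 6 0) ∈ K := by
      rw [← bridgePermTwo_word']
      simp only [map_mul, map_inv, Perm.viaEmbeddingHom_swap, φ]
      exact K.mul_mem (K.mul_mem (hs 0) hc) (K.inv_mem (hs 0))
    rwa [map_mul, Perm.viaEmbeddingHom_swap, Perm.viaEmbeddingHom_swap] at h1
  refine generates_of_connected_coe hc ?_ ?_
  · rw [swap_comm]
    exact Perm.isThreeCycle_swap_mul_swap_same (inl_ne_rotPoint _ _).symm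
      (rotPoint_add_ne (k := 0) (j := 4) (by omega) (by omega)) (inl_ne_rotPoint _ _)
  · intro S hS hS'
    have key : ∀ k, rotPoint 2 m k ∈ S ↔ Sum.inl 1 ∈ S := by
      intro k
      have h := conj_pow_swap_mul_swap_mem (K := K)
        (Subgroup.subset_closure (Set.mem_insert _ _)) hc k
      simp only [x, shiftPerm_pow_rotPoint, shiftPerm_pow_inl] at h
      have := mem_iff_of_threeCycle_mem hS' (inl_ne_rotPoint _ _) (inl_ne_rotPoint _ _)
        (by rw [Ne, add_comm 0, add_comm 4, ← Ne]
            exact rotPoint_add_ne (k := k + 0) (j := 4) (by omega) (by omega)) h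
      rw [zero_add] at this
      exact this.2.trans this.1.symm
    have key' := mem_iff_of_threeCycle_mem hS'
      (rotPoint_add_ne (k := 2) (j := 2) (by omega) (by omega)).symm
      (inl_ne_rotPoint _ _).symm (inl_ne_rotPoint _ _).symm hc'
    have key0 : ∀ i : Fin 2, Sum.inl i ∈ S ↔ Sum.inl 1 ∈ S := by
      intro i
      fin_cases i
      · exact key'.2.trans (key 4)
      · rfl
    obtain ⟨z, hz⟩ := hS
    have h0 : Sum.inl 1 ∈ S := by
      revert hz
      exact forall_rotPoint (P := fun z => z ∈ S → Sum.inl 1 ∈ S)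
        (fun i => (key0 i).1) (fun k => (key k).1) z
    exact Set.eq_univ_of_forall (forall_rotPoint (fun i => (key0 i).2 h0) fun k => (key k).2 h0)

theorem twistPair_two_pow (hm : Odd m) (h5 : 2 + 3 ≤ m) :
    (twistPair hm (bridgeSwapsTwo m)).2 ^ 5 = 1 := by
  have hdec : bridgePermTwo 0 ^ 5 = 1 := by decide +kernel
  apply Subtype.ext
  rw [Subgroup.coe_pow, twistPair_two_snd hm h5, ← map_pow, hdec, map_one, Subgroup.coe_one]

theorem twistPair_two_sq (hm : Odd m) (h5 : 2 + 3 ≤ m) :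
    (twistPair hm (bridgeSwapsTwo m)).2 ^ 2 ≠ 1 := by
  have hdec : bridgePermTwo 0 ^ 2 ≠ 1 := by decide +kernel
  intro h
  have h2 := congrArg Subtype.val h
  rw [Subgroup.coe_pow, twistPair_two_snd hm h5, ← map_pow, Subgroup.coe_one] at h2
  exact hdec (Perm.viaEmbeddingHom_injective (bridgeEmbedding h5) (h2.trans (map_one _).symm))

theorem card_support_twistPair_two (hm : Odd m) (h5 : 2 + 3 ≤ m) :
    (twistPair hm (bridgeSwapsTwo m)).2.1.support.card ≤ 7 := by
  rw [twistPair_two_snd hm h5]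
  exact Perm.card_support_viaEmbeddingHom_le _ _

end Two

section Three

/-- The conjugates of the bridging element, for three fixed points. -/
def bridgePermThree : Fin 3 → Perm (Fin 9) :=
  ![swap 0 3 * swap 1 4 * swap 2 5 * (swap 0 4 * swap 1 5 * swap 2 6)⁻¹,
    swap 0 4 * swap 1 5 * swap 2 6 * (swap 0 5 * swap 1 6 * swap 2 7)⁻¹,
    swap 0 5 * swap 1 6 * swap 2 7 * (swap 0 6 * swap 1 7 * swap 2 8)⁻¹]

theorem bridgePermThree_word : bridgePermThree 0 * bridgePermThree 2 * (bridgePermThree 0)⁻¹ *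
    (bridgePermThree 1)⁻¹ * (bridgePermThree 2)⁻¹ = swap 0 8 * swap 8 2 := by decide +kernel

theorem bridgePermThree_word' :
    bridgePermThree 0 * (swap 0 8 * swap 8 2) * (bridgePermThree 0)⁻¹ =
      swap 1 8 * swap 8 6 := by decide +kernel

/-- The swaps joining the fixed points to the rotation. -/
def bridgeSwapsThree (m : ℕ) : Perm (Fin 3 ⊕ ZMod m) :=
  swap (Sum.inl 0) (rotPoint 3 m 0) * swap (Sum.inl 1) (rotPoint 3 m 1) *
    swap (Sum.inl 2) (rotPoint 3 m 2)

theorem conj_twistPair_three (hm : Odd m) (h6 : 3 + 3 ≤ m) (s : Fin 3) :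
    MulAut.conj (shiftPerm 3 m ^ (s : ℕ)) (twistPair hm (bridgeSwapsThree m)).2.1 =
      Perm.viaEmbeddingHom (bridgeEmbedding h6) (bridgePermThree s) := by
  rw [conj_pow_twistPair_snd, bridgeSwapsThree]
  simp only [map_mul, Perm.conj_swap, shiftPerm_pow_inl, shiftPerm_pow_rotPoint]
  obtain rfl | rfl | rfl : s = 0 ∨ s = 1 ∨ s = 2 := by fin_cases s <;> simp
  all_goals
    simp only [bridgePermThree, map_mul, map_inv, Perm.viaEmbeddingHom_swap, Matrix.cons_val]
    rfl

theorem twistPair_three_snd (hm : Odd m) (h6 : 3 + 3 ≤ m) :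
    (twistPair hm (bridgeSwapsThree m)).2.1 =
      Perm.viaEmbeddingHom (bridgeEmbedding h6) (bridgePermThree 0) := by
  rw [← conj_twistPair_three hm h6 0]
  simp

theorem generates_twistPair_three (hm : Odd m) (h6 : 3 + 3 ≤ m) :
    Generates (twistPair hm (bridgeSwapsThree m)) := by
  set x := shiftPerm 3 m
  set y := (twistPair hm (bridgeSwapsThree m)).2.1 with hy
  have hs : ∀ s : Fin 3, Perm.viaEmbeddingHom (bridgeEmbedding h6) (bridgePermThree s) ∈
      Subgroup.closure {x, y} := fun s => by
    rw [← conj_twistPair_three hm]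
    exact conj_pow_mem_closure _ _ _
  set φ := Perm.viaEmbeddingHom (bridgeEmbedding h6)
  set K := Subgroup.closure {x, y}
  have hc : swap (Sum.inl 0) (rotPoint 3 m 5) * swap (rotPoint 3 m 5) (Sum.inl 2) ∈ K := by
    have h1 : φ (swap 0 8 * swap 8 2) ∈ K := by
      rw [← bridgePermThree_word]
      simp only [map_mul, map_inv]
      exact K.mul_mem (K.mul_mem (K.mul_mem (K.mul_mem (hs 0) (hs 2)) (K.inv_mem (hs 0)))
        (K.inv_mem (hs 1))) (K.inv_mem (hs 2))
    rwa [map_mul, Perm.viaEmbeddingHom_swap, Perm.viaEmbeddingHom_swap] at h1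
  have hc' : swap (Sum.inl 1) (rotPoint 3 m 5) * swap (rotPoint 3 m 5) (rotPoint 3 m 3) ∈ K := by
    have h1 : φ (swap 1 8 * swap 8 6) ∈ K := by
      rw [← bridgePermThree_word']
      simp only [map_mul, map_inv, Perm.viaEmbeddingHom_swap, φ]
      exact K.mul_mem (K.mul_mem (hs 0) hc) (K.inv_mem (hs 0))
    rwa [map_mul, Perm.viaEmbeddingHom_swap, Perm.viaEmbeddingHom_swap] at h1
  have h02 : (Sum.inl 0 : Fin 3 ⊕ ZMod m) ≠ Sum.inl 2 := by simp
  refine generates_of_connected_coe hc ?_ ?_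
  · rw [swap_comm]
    exact Perm.isThreeCycle_swap_mul_swap_same (inl_ne_rotPoint _ _).symm
      (inl_ne_rotPoint _ _).symm h02
  · intro S hS hS'
    have key : ∀ k, (Sum.inl 0 ∈ S ↔ rotPoint 3 m (5 + k) ∈ S) ∧
        (Sum.inl 2 ∈ S ↔ rotPoint 3 m (5 + k) ∈ S) := by
      intro k
      have h := conj_pow_swap_mul_swap_mem (K := K)
        (Subgroup.subset_closure (Set.mem_insert _ _)) hc k
      simp only [x, shiftPerm_pow_rotPoint, shiftPerm_pow_inl] at h
      exact mem_iff_of_threeCycle_mem hS' (inl_ne_rotPoint _ _) h02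
        (inl_ne_rotPoint _ _).symm h
    have keyr : ∀ k, rotPoint 3 m k ∈ S ↔ Sum.inl 0 ∈ S := by
      intro k
      have h1 : rotPoint 3 m k = rotPoint 3 m (5 + (k + (m - 5))) := by
        rw [rotPoint, rotPoint, show 5 + (k + (m - 5)) = k + m by omega, Nat.cast_add,
          ZMod.natCast_self, add_zero]
      rw [h1]
      exact (key _).1.symm
    have key' := mem_iff_of_threeCycle_mem hS' (inl_ne_rotPoint _ _) (inl_ne_rotPoint _ _)
      (rotPoint_add_ne (k := 3) (j := 2) (by omega) (by omega)) hc'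
    have key0 : ∀ i : Fin 3, Sum.inl i ∈ S ↔ Sum.inl 0 ∈ S := by
      intro i
      fin_cases i
      · rfl
      · exact key'.1.trans (keyr 5)
      · exact (key 0).2.trans (key 0).1.symm
    obtain ⟨z, hz⟩ := hS
    have h0 : Sum.inl 0 ∈ S := by
      revert hz
      exact forall_rotPoint (P := fun z => z ∈ S → Sum.inl 0 ∈ S)
        (fun i => (key0 i).1) (fun k => (keyr k).1) z
    exact Set.eq_univ_of_forall (forall_rotPoint (fun i => (key0 i).2 h0) fun k => (keyr k).2 h0)

theorem twistPair_three_pow (hm : Odd m) (h6 : 3 + 3 ≤ m) :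
    (twistPair hm (bridgeSwapsThree m)).2 ^ 7 = 1 := by
  have hdec : bridgePermThree 0 ^ 7 = 1 := by decide +kernel
  apply Subtype.ext
  rw [Subgroup.coe_pow, twistPair_three_snd hm h6, ← map_pow, hdec, map_one, Subgroup.coe_one]

theorem twistPair_three_sq (hm : Odd m) (h6 : 3 + 3 ≤ m) :
    (twistPair hm (bridgeSwapsThree m)).2 ^ 2 ≠ 1 := by
  have hdec : bridgePermThree 0 ^ 2 ≠ 1 := by decide +kernel
  intro h
  have h2 := congrArg Subtype.val h
  rw [Subgroup.coe_pow, twistPair_three_snd hm h6, ← map_pow, Subgroup.coe_one] at h2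
  exact hdec (Perm.viaEmbeddingHom_injective (bridgeEmbedding h6) (h2.trans (map_one _).symm))

theorem card_support_twistPair_three (hm : Odd m) (h6 : 3 + 3 ≤ m) :
    (twistPair hm (bridgeSwapsThree m)).2.1.support.card ≤ 9 := by
  rw [twistPair_three_snd hm h6]
  exact Perm.card_support_viaEmbeddingHom_le _ _

end Three

end Bridge

section Large

open Equiv

theorem card_filter_prime_le (n : ℕ) (hn : 12 ≤ n) :
    2 * ((Finset.range (n + 1)).filter Nat.Prime).card ≤ n := by
  induction n using Nat.strong_induction_on with
  | _ n ih =>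
    by_cases h : n < 14
    · interval_cases n <;> decide +kernel
    · obtain ⟨k, rfl⟩ : ∃ k, n = k + 2 := ⟨n - 2, by omega⟩
      have h1 := ih k (by omega) (by omega)
      have h2 : ¬ (Nat.Prime (k + 1) ∧ Nat.Prime (k + 2)) := by
        rintro ⟨ha, hb⟩
        rcases ha.eq_two_or_odd with h | h
        · omega
        · rcases hb.eq_two_or_odd with h' | h' <;> omega
      rw [Finset.range_add_one, Finset.range_add_one, Finset.filter_insert, Finset.filter_insert]
      have h3 : ∀ (a : ℕ) (s : Finset ℕ), (insert a s).card ≤ s.card + 1 :=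
        fun a s => Finset.card_insert_le a s
      split_ifs with ha hb hb
      · exact absurd ⟨hb, ha⟩ h2
      · exact (Nat.mul_le_mul_left 2 (h3 _ _)).trans (by omega)
      · exact (Nat.mul_le_mul_left 2 (h3 _ _)).trans (by omega)
      · omega

theorem three_mul_card_prime_lt {n : ℕ} (hn : 11 ≤ n) :
    3 * ((Finset.range (n + 1)).filter Nat.Prime).card < Fintype.card (GapPairs (n - 4)) := by
  obtain ⟨l, rfl⟩ : ∃ l, n = l + 11 := ⟨n - 11, by omega⟩
  have h1 := card_gapPairs (l + 6)
  rw [show l + 11 - 4 = l + 6 + 1 by omega]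
  rw [show l + 6 - 1 = l + 5 by omega] at h1
  rcases l with _ | l
  · have : ((Finset.range (0 + 11 + 1)).filter Nat.Prime).card = 5 := by decide +kernel
    omega
  · have h2 := card_filter_prime_le (l + 1 + 11) (by omega)
    nlinarith

theorem powersBeauville_of_twistFrame {f m f' m' : ℕ} [NeZero m] [NeZero m']
    {P Q R : Fin f ⊕ ZMod m} {s : ℕ} (h : TwistFrame P Q R s (f + m - 4))
    (hn : 11 ≤ f + m) (hm : 10 ≤ m) (hm' : 9 ≤ m') (hmm : m' ≠ m) (hfm : f' + m' = f + m)
    (hodd : Odd m') {g : Perm (Fin f' ⊕ ZMod m')} (hg : Generates (twistPair hodd g))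
    (hg2 : (twistPair hodd g).2 ^ 2 ≠ 1) (hg9 : (twistPair hodd g).2.1.support.card ≤ 9)
    {q : ℕ} (hq : q.Coprime 6) (hgq : (twistPair hodd g).2 ^ q = 1) :
    PowersBeauville (alternatingGroup (Fin f ⊕ ZMod m)) := by
  have hcard : Fintype.card (Fin f ⊕ ZMod m) = f + m := by
    rw [Fintype.card_sum, Fintype.card_fin, ZMod.card]
  have hcard' : 5 ≤ Nat.card (Fin f ⊕ ZMod m) := by
    rw [Nat.card_eq_fintype_card]; omega
  have : IsSimpleGroup (alternatingGroup (Fin f ⊕ ZMod m)) := alternatingGroup.isSimpleGroup hcard'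
  have e : Fin f' ⊕ ZMod m' ≃ Fin f ⊕ ZMod m := Fintype.equivOfCardEq (by
    rw [hcard, Fintype.card_sum, Fintype.card_fin, ZMod.card, hfm])
  set φ := e.altCongrHom
  set t₀ := (φ (twistPair hodd g).1, φ (twistPair hodd g).2)
  have h2 : 2 < f + m - 4 := by omega
  set k₀ : GapPairs (f + m - 4) := some ⟨⟨2, h2⟩, ⟨0, by simp⟩⟩
  have hsupp : ∀ a : alternatingGroup (Fin f' ⊕ ZMod m'),
      ((φ a : alternatingGroup _) : Perm (Fin f ⊕ ZMod m)).support.card = a.1.support.card :=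
    fun a => Perm.card_support_permCongr e a.1
  have hdisj : PrimeDisjoint t₀ (twistFamilyPair h k₀) := by
    refine primeDisjoint_of_card_support hmm ?_
      (fun d hd k => card_support_triple_twistPair_pow _ _ hd k) (q := q) (r := 6) ?_ ?_ hq ?_
      (twistFamilyPair_pow_six h k₀)
    · intro d hd k
      rw [triple_map, ← map_pow, hsupp, map_eq_one_iff _ φ.injective]
      exact card_support_triple_twistPair_pow _ _ hd k
    · rw [hsupp]
      omega
    · exact (card_support_twistFamilyPair h k₀).trans_lt (by omega)
    · rw [← map_pow, hgq, map_one]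
  have hord : ∀ i d, orderOf (triple (twistFamilyPair h i) d) ∣
      orderOf (triple (twistFamilyPair h k₀) d) := by
    intro i d
    by_cases hd : d = 1
    · subst hd
      change orderOf (twistFamilyPair h i).2 ∣ orderOf (twistFamilyPair h k₀).2
      rw [orderOf_twistFamilyPair_some, orderOf_dvd_iff_pow_eq_one]
      exact twistFamilyPair_pow_six h i
    · rw [twistFamilyPair, twistFamilyPair, orderOf_triple_twistPair _ _ hd,
        orderOf_triple_twistPair _ _ hd]
  intro k hk hgen
  have : Nonempty (Fin k) := ⟨⟨0, hk⟩⟩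
  refine IsBeauvilleGroup.power_of_counting (exists_mul_ne_mul_alternatingGroup hcard')
    (hg.map_mulEquiv φ) ((hyperbolic_twistPair hodd (by omega) hg2).map_mulEquiv φ)
    (generates_twistFamilyPair h) (fun i j hij => not_autEquiv_twistFamilyPair h hij)
    (hyperbolic_twistPair h.odd h.five_le (twistFamilyPair_sq_ne_one h k₀)) hdisj hord
    (((Finset.range (f + m + 1)).filter Nat.Prime) ×ˢ Finset.univ) ?_ ?_ hgen
  · rw [Finset.card_product, Finset.card_univ, Fintype.card_fin, mul_comm]
    exact three_mul_card_prime_lt hn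
  · intro p hp d
    by_cases hpn : p < f + m + 1
    · left
      simp [hp, hpn]
    · right; left
      exact fullAt_of_card_lt (e := 0) hp (by rw [hcard, zero_add, pow_one]; omega) (by simp)

theorem powersBeauville_alternatingGroup_of_le {n : ℕ} (hn : 11 ≤ n) :
    PowersBeauville (alternatingGroup (Fin n)) := by
  rcases Nat.even_or_odd n with he | ho
  · obtain ⟨m, rfl⟩ : ∃ m, n = m + 3 := ⟨n - 3, by omega⟩
    have h9 : 9 ≤ m := by
      by_contra! h
      obtain rfl : m = 8 := by omega
      exact absurd he (by decide)
    have h1 : Odd m := by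
      rcases Nat.even_or_odd m with h | h
      · exact absurd (h.add_odd (by decide : Odd 3)) (Nat.not_odd_iff_even.2 he)
      · exact h
    have : NeZero m := ⟨by omega⟩
    have : NeZero (m + 2) := ⟨by omega⟩
    have h := powersBeauville_of_twistFrame (f := 1) (m := m + 2) (f' := 3) (m' := m)
      (by convert twistFrame_one (m := m + 2) (h1.add_even even_two) (by omega) using 1; omega)
      (by omega) (by omega) h9 (by omega) (by omega) h1 (generates_twistPair_three h1 (by omega))
      (twistPair_three_sq h1 (by omega)) (card_support_twistPair_three h1 (by omega))
      (by decide : Nat.Coprime 7 6) (twistPair_three_pow h1 (by omega))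
    exact h.of_mulEquiv (Fintype.equivOfCardEq (by
      rw [Fintype.card_sum, Fintype.card_fin, ZMod.card, Fintype.card_fin]; omega)).altCongrHom
  · obtain ⟨m, rfl⟩ : ∃ m, n = m + 2 := ⟨n - 2, by omega⟩
    have h1 : Odd m := by
      rcases Nat.even_or_odd m with h | h
      · exact absurd (h.add even_two) (Nat.not_even_iff_odd.2 ho)
      · exact h
    have : NeZero m := ⟨by omega⟩
    have : NeZero (m + 2) := ⟨by omega⟩
    have h := powersBeauville_of_twistFrame (f := 0) (m := m + 2) (f' := 2) (m' := m)
      (by convert twistFrame_zero (m := m + 2) (h1.add_even even_two) (by omega) using 1; omega)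
      (by omega) (by omega) (by omega) (by omega) (by omega) h1
      (generates_twistPair_two h1 (by omega)) (twistPair_two_sq h1 (by omega))
      ((card_support_twistPair_two h1 (by omega)).trans (by omega))
      (by decide : Nat.Coprime 5 6) (twistPair_two_pow h1 (by omega))
    exact h.of_mulEquiv (Fintype.equivOfCardEq (by
      rw [Fintype.card_sum, Fintype.card_fin, ZMod.card, Fintype.card_fin]; omega)).altCongrHom

end Large

section Tables

open Equiv

/-- A permutation given by the tables of its values and of the values of its inverse. -/
def tablePerm {n : ℕ} (f g : Fin n → Fin n)
    (h : (∀ i, g (f i) = i) ∧ ∀ i, f (g i) = i := by decide +kernel) : Perm (Fin n) :=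
  ⟨f, g, h.1, h.2⟩

/-- The word `x ^ i₁ * y ^ i₂ * x ^ i₃ * ⋯` with the given list of exponents. -/
def alternatingWord {G : Type*} [Monoid G] (x y : G) : List ℕ → G
  | [] => 1
  | i :: l => x ^ i * alternatingWord y x l

theorem alternatingWord_mem {G : Type*} [Group G] {K : Subgroup G} {x y : G} (hx : x ∈ K)
    (hy : y ∈ K) (l : List ℕ) : alternatingWord x y l ∈ K := by
  induction l generalizing x y with
  | nil => exact K.one_mem
  | cons i l ih => exact K.mul_mem (K.pow_mem hx i) (ih hy hx)

/-- A pair of even permutations, a word with a power representing a three-cycle, and words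
conjugating it to three-cycles which map `0` to every point. -/
structure GeneratingTable (n : ℕ) [NeZero n] where
  fst : Perm (Fin n)
  snd : Perm (Fin n)
  word : List ℕ
  exponent : ℕ
  conj : Fin n → List ℕ

namespace GeneratingTable

variable {n : ℕ} [NeZero n]

/-- The three-cycle described by the table. -/
def cycle (t : GeneratingTable n) : Perm (Fin n) :=
  alternatingWord t.fst t.snd t.word ^ t.exponent

/-- The elements conjugating the three-cycle of the table. -/
def conjugator (t : GeneratingTable n) (z : Fin n) : Perm (Fin n) :=
  alternatingWord t.fst t.snd (t.conj z)

/-- The words of the table have the required properties. -/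
def Valid (t : GeneratingTable n) : Prop :=
  Perm.sign t.fst = 1 ∧ Perm.sign t.snd = 1 ∧ t.cycle.support.card = 3 ∧
    ∀ z, (t.conjugator z * t.cycle * (t.conjugator z)⁻¹) 0 = z

instance (t : GeneratingTable n) : Decidable t.Valid :=
  inferInstanceAs (Decidable (_ ∧ _))

/-- The pair of elements of the alternating group described by a valid table. -/
def pair (t : GeneratingTable n) (h : t.Valid) :
    alternatingGroup (Fin n) × alternatingGroup (Fin n) :=
  (⟨t.fst, h.1⟩, ⟨t.snd, h.2.1⟩)

theorem generates_pair (t : GeneratingTable n) (h : t.Valid) : Generates (t.pair h) := by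
  have hx : t.fst ∈ Subgroup.closure {t.fst, t.snd} := Subgroup.subset_closure (by simp)
  have hy : t.snd ∈ Subgroup.closure {t.fst, t.snd} := Subgroup.subset_closure (by simp)
  have hc : t.cycle ∈ Subgroup.closure {t.fst, t.snd} :=
    pow_mem (alternatingWord_mem hx hy _) _
  have hc3 : t.cycle.IsThreeCycle := card_support_eq_three_iff.1 h.2.2.1
  have hg : ∀ z, t.conjugator z ∈ Subgroup.closure {t.fst, t.snd} := fun z =>
    alternatingWord_mem hx hy _
  have hd : ∀ z, t.conjugator z * t.cycle * (t.conjugator z)⁻¹ ∈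
      Subgroup.closure {t.fst, t.snd} := fun z =>
    mul_mem (mul_mem (hg z) hc) (inv_mem (hg z))
  have hd3 : ∀ z, (t.conjugator z * t.cycle * (t.conjugator z)⁻¹).IsThreeCycle := fun z => by
    rw [Perm.IsThreeCycle, Perm.cycleType_conj]
    exact hc3
  refine generates_of_connected_coe (p := t.pair h) hc hc3 fun S ⟨b, hb⟩ hS => ?_
  have h0 : (0 : Fin n) ∈ S := by
    have := hS _ (inv_mem (hd b)) (hd3 b).inv b hb
    rwa [Perm.inv_eq_iff_eq.2 (h.2.2.2 b).symm] at this
  refine Set.eq_univ_of_forall fun z => ?_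
  have := hS _ (hd z) (hd3 z) 0 h0
  rwa [h.2.2.2 z] at this

/-- The three elements of the triple of the table, up to inversion. -/
def perm (t : GeneratingTable n) : Fin 3 → Perm (Fin n) := ![t.fst, t.snd, t.fst * t.snd]

theorem orderOf_triple_pair (t : GeneratingTable n) (h : t.Valid) (d : Fin 3) :
    orderOf (triple (t.pair h) d) = orderOf (t.perm d) := by
  rw [← Subgroup.orderOf_coe]
  fin_cases d
  · rfl
  · rfl
  · exact orderOf_inv _

/-- The order of `g` is `m`, in a decidable form. -/
def HasOrder {G : Type*} [Monoid G] (g : G) (m : ℕ) : Prop :=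
  0 < m ∧ g ^ m = 1 ∧ ∀ p ∈ m.primeFactorsList, g ^ (m / p) ≠ 1

instance {G : Type*} [Monoid G] [DecidableEq G] (g : G) (m : ℕ) : Decidable (HasOrder g m) :=
  inferInstanceAs (Decidable (_ ∧ _))

theorem HasOrder.orderOf_eq {G : Type*} [Monoid G] {g : G} {m : ℕ} (h : HasOrder g m) :
    orderOf g = m :=
  orderOf_eq_of_pow_and_pow_div_prime h.1 h.2.1 fun p hp hpm =>
    h.2.2 p ((Nat.mem_primeFactorsList h.1.ne').2 ⟨hp, hpm⟩)

/-- The outcomes of a list of tests of the form `(x ^ a * y ^ b) ^ k = 1`. -/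
def outcome (t : GeneratingTable n) {r : ℕ} (tests : Fin r → Fin 3 → ℕ) : Fin r → Bool :=
  fun j => decide ((t.fst ^ tests j 0 * t.snd ^ tests j 1) ^ tests j 2 = 1)

theorem not_autEquiv {s t : GeneratingTable n} (hs : s.Valid) (ht : t.Valid) {r : ℕ}
    {tests : Fin r → Fin 3 → ℕ} (h : s.outcome tests ≠ t.outcome tests) :
    ¬ AutEquiv (s.pair hs) (t.pair ht) := by
  rintro ⟨φ, h₁, h₂⟩
  refine h (funext fun j => decide_eq_decide.2 ?_)
  have e : ∀ (q : GeneratingTable n) (hq : q.Valid),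
      (q.fst ^ tests j 0 * q.snd ^ tests j 1) ^ tests j 2 = 1 ↔
      ((q.pair hq).1 ^ tests j 0 * (q.pair hq).2 ^ tests j 1) ^ tests j 2 = 1 := fun q hq => by
    rw [Subtype.ext_iff]
    rfl
  rw [e s hs, e t ht, ← h₁, ← h₂, ← map_pow, ← map_pow, ← map_mul, ← map_pow,
    EmbeddingLike.map_eq_one_iff]

/-- The prime `p` can obstruct the argument at the member `d` of the triple. -/
def Deficient (n : ℕ) (a b : Fin 3 → ℕ) (q : ℕ × Fin 3) : Prop :=
  q.1.Prime ∧ ¬ q.1 ^ Nat.log q.1 n ∣ a q.2 ∧ ¬ ∀ e, q.1 ^ Nat.log q.1 n ∣ b e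

instance (n : ℕ) (a b : Fin 3 → ℕ) : DecidablePred (Deficient n a b) := fun _ =>
  inferInstanceAs (Decidable (_ ∧ _ ∧ _))

theorem hyperbolic_pair {t : GeneratingTable n} (ht : t.Valid) {a : Fin 3 → ℕ}
    (ha : ∀ d, HasOrder (t.perm d) (a d))
    (h : a 1 * a 2 + a 0 * a 2 + a 0 * a 1 < a 0 * a 1 * a 2) : Hyperbolic (t.pair ht) := by
  rw [Hyperbolic, orderOf_triple_pair, orderOf_triple_pair, orderOf_triple_pair,
    (ha 0).orderOf_eq, (ha 1).orderOf_eq, (ha 2).orderOf_eq]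
  have h0 : (0 : ℚ) < a 0 := by exact_mod_cast (ha 0).1
  have h1 : (0 : ℚ) < a 1 := by exact_mod_cast (ha 1).1
  have h2 : (0 : ℚ) < a 2 := by exact_mod_cast (ha 2).1
  have h' : (a 1 * a 2 + a 0 * a 2 + a 0 * a 1 : ℚ) < a 0 * a 1 * a 2 := by exact_mod_cast h
  have e : (1 : ℚ) / a 0 + 1 / a 1 + 1 / a 2 =
      (a 1 * a 2 + a 0 * a 2 + a 0 * a 1) / (a 0 * a 1 * a 2) := by
    field_simp
  rw [e, div_lt_one (by positivity)]
  exact h'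

theorem powersBeauville (hn : 5 ≤ n) {m : ℕ} (t : GeneratingTable n)
    (u : Fin (m + 1) → GeneratingTable n) (a b : Fin 3 → ℕ) {r : ℕ} (tests : Fin r → Fin 3 → ℕ)
    (ht : t.Valid) (hu : ∀ i, (u i).Valid) (ha : ∀ d, HasOrder (t.perm d) (a d))
    (hb : ∀ d, HasOrder ((u 0).perm d) (b d)) (hub : ∀ i d, (u i).perm d ^ b d = 1)
    (hout : ∀ i j, (u i).outcome tests = (u j).outcome tests → i = j)
    (hab : (∀ d e, (a d).Coprime (b e)) ∧
      a 1 * a 2 + a 0 * a 2 + a 0 * a 1 < a 0 * a 1 * a 2 ∧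
      b 1 * b 2 + b 0 * b 2 + b 0 * b 1 < b 0 * b 1 * b 2 ∧
      ((Finset.range (n + 1) ×ˢ Finset.univ).filter (Deficient n a b)).card ≤ m) :
    PowersBeauville (alternatingGroup (Fin n)) := by
  intro k hk h2
  have : NeZero k := ⟨hk.ne'⟩
  have hn' : 5 ≤ Nat.card (Fin n) := by simpa using hn
  have := alternatingGroup.isSimpleGroup hn'
  obtain ⟨hab, ha', hb', hD⟩ := hab
  have hta : ∀ d, orderOf (triple (t.pair ht) d) = a d := fun d => by
    rw [orderOf_triple_pair, (ha d).orderOf_eq]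
  have hub' : ∀ d, orderOf (triple ((u 0).pair (hu 0)) d) = b d := fun d => by
    rw [orderOf_triple_pair, (hb d).orderOf_eq]
  refine IsBeauvilleGroup.power_of_counting (exists_mul_ne_mul_alternatingGroup hn')
    (k₀ := (0 : Fin (m + 1))) (w := fun i => (u i).pair (hu i)) (generates_pair t ht)
    (hyperbolic_pair ht ha ha') (fun i => generates_pair _ (hu i))
    (fun i j hij => not_autEquiv _ _ fun h => hij (hout i j h))
    (hyperbolic_pair (hu 0) hb hb') ?_ ?_ _
    (lt_of_le_of_lt hD (by simp)) ?_ h2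
  · intro p hp d e k l hkl hkp
    obtain ⟨g, hg⟩ := isConj_iff.1 hkl
    have h₁ : (triple (t.pair ht) d ^ k) ^ a d = 1 := by
      rw [← pow_mul, mul_comm, pow_mul, ← hta d, pow_orderOf_eq_one, one_pow]
    have h₂ : (triple (t.pair ht) d ^ k) ^ b e = 1 := by
      have : (triple ((u 0).pair (hu 0)) e ^ l) ^ b e = 1 := by
        rw [← pow_mul, mul_comm, pow_mul, ← hub' e, pow_orderOf_eq_one, one_pow]
      rw [← hg, conj_pow] at this
      simpa using this
    have := Nat.dvd_gcd (orderOf_dvd_of_pow_eq_one h₁) (orderOf_dvd_of_pow_eq_one h₂)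
    rw [(hab d e : Nat.gcd _ _ = 1), Nat.dvd_one, orderOf_eq_one_iff] at this
    exact this
  · intro i e
    rw [hub' e, orderOf_triple_pair]
    exact orderOf_dvd_of_pow_eq_one (hub i e)
  · intro p hp d
    have hlog : Fintype.card (Fin n) < p ^ (Nat.log p n + 1) := by
      simpa using Nat.lt_pow_succ_log_self hp.one_lt n
    by_cases hdef : Deficient n a b (p, d)
    · refine Or.inl (Finset.mem_filter.2 ⟨Finset.mem_product.2 ⟨?_, Finset.mem_univ _⟩, hdef⟩)
      rw [Finset.mem_range]
      by_contra! hlt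
      refine hdef.2.1 ?_
      rw [Nat.log_of_lt (show n < p by omega), pow_zero]
      exact one_dvd _
    · refine Or.inr ?_
      simp only [Deficient, hp, true_and, not_and_or, not_not] at hdef
      refine hdef.imp (fun h => fullAt_of_card_lt hp hlog ?_)
        fun h e => fullAt_of_card_lt hp hlog ?_
      · rwa [hta d]
      · rw [hub' e]
        exact h e

end GeneratingTable

end Tables

section SmallDegree

open Equiv

/-- A permutation of order 5. -/
def rotationSix : Perm (Fin 6) :=
  tablePerm ![1, 2, 3, 4, 0, 5] ![4, 0, 1, 2, 3, 5]

theorem powersBeauville_alternatingGroup_six :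
    PowersBeauville (alternatingGroup (Fin 6)) := by
  refine GeneratingTable.powersBeauville (by norm_num)
    ⟨tablePerm ![0, 1, 2, 4, 5, 3] ![0, 1, 2, 5, 3, 4],
      tablePerm ![4, 2, 5, 1, 0, 3] ![4, 3, 1, 5, 0, 2],
      [1, 1, 1, 2], 1,
      ![[0, 1], [0, 2], [0, 2, 1], [0, 0, 1], [0, 0, 2], []]⟩
    ![⟨rotationSix,
        tablePerm ![0, 3, 1, 5, 2, 4] ![0, 2, 4, 1, 5, 3],
        [1, 2, 2, 1], 1,
        ![[0, 0, 2], [0, 2], [0, 1], [0, 0, 1], [], [0, 1, 1]]⟩,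
      ⟨rotationSix,
        tablePerm ![2, 1, 4, 5, 3, 0] ![5, 1, 0, 4, 2, 3],
        [1, 2, 2, 1], 1,
        ![[0, 0, 2], [0, 0, 1], [0, 1, 1], [0, 1], [2, 1], []]⟩,
      ⟨rotationSix,
        tablePerm ![1, 5, 2, 0, 3, 4] ![3, 0, 2, 4, 5, 1],
        [1, 1, 3, 2], 1,
        ![[], [0, 0, 2], [0, 0, 1], [0, 1], [0, 2], [0, 2, 1]]⟩,
      ⟨rotationSix,
        tablePerm ![3, 0, 2, 4, 5, 1] ![1, 5, 2, 0, 3, 4],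
        [1, 2, 2, 1], 1,
        ![[], [0, 0, 2], [0, 0, 1], [0, 4], [0, 1], [1, 1]]⟩]
    ![3, 4, 3] ![5, 5, 5] ![![1, 4, 4], ![1, 2, 4]]
    ?_ ?_ ?_ ?_ ?_ ?_ ?_ <;> decide +kernel

/-- A permutation of order 7. -/
def rotationSeven : Perm (Fin 7) :=
  tablePerm ![1, 2, 3, 4, 5, 6, 0] ![6, 0, 1, 2, 3, 4, 5]

theorem powersBeauville_alternatingGroup_seven :
    PowersBeauville (alternatingGroup (Fin 7)) := by
  refine GeneratingTable.powersBeauville (by norm_num)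
    ⟨tablePerm ![6, 2, 4, 3, 0, 5, 1] ![4, 6, 1, 3, 2, 5, 0],
      tablePerm ![0, 6, 1, 5, 4, 2, 3] ![0, 2, 5, 6, 4, 3, 1],
      [1, 3], 2,
      ![[0, 0, 2], [0, 0, 1], [0, 4, 1], [1, 1], [], [1, 2], [0, 1, 1]]⟩
    ![⟨rotationSeven,
        tablePerm ![5, 6, 0, 4, 2, 1, 3] ![2, 5, 4, 6, 3, 0, 1],
        [2, 1], 1,
        ![[], [0, 2, 1], [0, 3], [1, 2], [0, 4], [0, 0, 2], [0, 0, 1]]⟩,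
      ⟨rotationSeven,
        tablePerm ![4, 5, 3, 1, 6, 0, 2] ![5, 3, 6, 2, 0, 1, 4],
        [1, 2], 1,
        ![[], [0, 3], [1, 1], [0, 0, 4], [1, 3, 1], [0, 0, 1], [0, 1, 1]]⟩,
      ⟨rotationSeven,
        tablePerm ![4, 2, 3, 6, 5, 1, 0] ![6, 5, 1, 2, 0, 4, 3],
        [2, 3], 1,
        ![[0, 0, 2], [0, 0, 1], [2, 2], [], [0, 1], [2, 2, 1], [2, 1, 1]]⟩,
      ⟨rotationSeven,
        tablePerm ![4, 5, 6, 0, 2, 3, 1] ![3, 6, 4, 5, 0, 1, 2],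
        [1, 3], 1,
        ![[], [2, 2], [1, 1], [0, 3, 2], [0, 1, 1], [0, 0, 1], [3, 1, 1]]⟩,
      ⟨rotationSeven,
        tablePerm ![4, 3, 5, 6, 1, 0, 2] ![5, 4, 6, 1, 0, 2, 3],
        [1, 2], 1,
        ![[0, 0, 1], [0, 1, 3], [], [0, 2, 2], [0, 1, 5], [2, 1], [0, 2]]⟩,
      ⟨rotationSeven,
        tablePerm ![3, 6, 0, 5, 2, 1, 4] ![2, 5, 4, 0, 6, 3, 1],
        [2, 1], 1,
        ![[0, 0, 1], [2, 2], [1, 2], [0, 1, 2], [0, 2, 1], [], [0, 3, 3]]⟩,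
      ⟨rotationSeven,
        tablePerm ![1, 3, 4, 6, 5, 0, 2] ![5, 0, 6, 1, 2, 4, 3],
        [1, 1, 2, 1], 1,
        ![[], [0, 2, 1], [0, 1, 2], [0, 4, 2], [0, 3], [0, 2], [0, 1, 1]]⟩]
    ![5, 5, 5] ![7, 7, 7] ![![1, 2, 3], ![1, 3, 6], ![2, 2, 5]]
    ?_ ?_ ?_ ?_ ?_ ?_ ?_ <;> decide +kernel

/-- A permutation of order 7. -/
def rotationEight : Perm (Fin 8) :=
  tablePerm ![1, 2, 3, 4, 5, 6, 0, 7] ![6, 0, 1, 2, 3, 4, 5, 7]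

theorem powersBeauville_alternatingGroup_eight :
    PowersBeauville (alternatingGroup (Fin 8)) := by
  refine GeneratingTable.powersBeauville (by norm_num)
    ⟨tablePerm ![3, 7, 6, 5, 2, 0, 1, 4] ![5, 6, 4, 0, 7, 3, 2, 1],
      tablePerm ![5, 6, 0, 1, 7, 2, 4, 3] ![2, 3, 5, 7, 6, 0, 1, 4],
      [5, 5], 1,
      ![[0, 0, 1], [0, 1], [], [1, 1], [0, 2, 2], [0, 0, 2], [0, 2, 1], [0, 0, 3]]⟩
    ![⟨rotationEight,
        tablePerm ![4, 0, 3, 7, 2, 5, 1, 6] ![1, 6, 4, 2, 0, 5, 7, 3],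
        [1, 2], 2,
        ![[], [0, 1], [2, 1], [0, 0, 2], [0, 1, 2], [0, 2], [0, 0, 1], [0, 2, 1]]⟩,
      ⟨rotationEight,
        tablePerm ![0, 5, 7, 2, 1, 6, 3, 4] ![0, 4, 3, 6, 7, 1, 5, 2],
        [1, 3], 2,
        ![[0, 0, 1], [0, 1], [2, 1], [0, 4], [], [0, 2], [0, 3], [1, 1, 1]]⟩,
      ⟨rotationEight,
        tablePerm ![0, 3, 5, 6, 7, 4, 2, 1] ![0, 7, 6, 1, 5, 2, 3, 4],
        [1, 1, 2, 4], 1,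
        ![[0, 0, 2], [1, 2, 1], [0, 1], [0, 0, 1], [0, 3], [0, 2], [], [0, 4]]⟩,
      ⟨rotationEight,
        tablePerm ![0, 4, 6, 2, 5, 7, 1, 3] ![0, 6, 3, 7, 1, 4, 2, 5],
        [2, 3], 2,
        ![[0, 0, 2], [0, 1], [0, 1, 1], [0, 0, 1], [0, 2], [0, 3], [], [0, 4]]⟩,
      ⟨rotationEight,
        tablePerm ![4, 0, 6, 1, 2, 5, 7, 3] ![1, 3, 4, 7, 0, 5, 2, 6],
        [1, 1, 2, 4], 1,
        ![[0, 1], [0, 0, 1], [0, 0, 3], [1, 3, 1], [], [0, 1, 1], [0, 1, 2], [0, 4]]⟩,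
      ⟨rotationEight,
        tablePerm ![2, 5, 1, 3, 0, 6, 7, 4] ![4, 2, 0, 3, 7, 1, 5, 6],
        [1, 1, 4, 2], 1,
        ![[], [3, 1], [2, 1], [1, 2], [0, 1], [0, 2, 1], [0, 2], [0, 0, 3]]⟩,
      ⟨rotationEight,
        tablePerm ![0, 7, 6, 5, 2, 4, 1, 3] ![0, 6, 4, 7, 5, 3, 2, 1],
        [1, 2], 2,
        ![[0, 0, 1], [0, 3], [0, 1], [0, 5], [], [0, 6], [0, 2], [1, 1, 1]]⟩]
    ![15, 15, 5] ![7, 7, 7] ![![1, 6, 6], ![2, 2, 15], ![1, 4, 7]]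
    ?_ ?_ ?_ ?_ ?_ ?_ ?_ <;> decide +kernel

/-- A permutation of order 7. -/
def rotationNine : Perm (Fin 9) :=
  tablePerm ![1, 2, 3, 4, 5, 6, 0, 7, 8] ![6, 0, 1, 2, 3, 4, 5, 7, 8]

theorem powersBeauville_alternatingGroup_nine :
    PowersBeauville (alternatingGroup (Fin 9)) := by
  refine GeneratingTable.powersBeauville (by norm_num)
    ⟨tablePerm ![1, 8, 7, 6, 4, 3, 2, 5, 0] ![8, 0, 6, 5, 4, 7, 3, 2, 1],
      tablePerm ![4, 2, 5, 7, 1, 0, 3, 6, 8] ![5, 4, 1, 6, 0, 2, 7, 3, 8],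
      [2, 1], 2,
      ![[], [0, 0, 2], [0, 1], [0, 0, 1], [1, 1, 1], [0, 2, 3], [0, 3, 2], [0, 0, 4], [0, 3]]⟩
    ![⟨rotationNine,
        tablePerm ![0, 5, 2, 8, 3, 4, 7, 1, 6] ![0, 7, 2, 4, 5, 1, 8, 6, 3],
        [1, 6, 3, 2], 1,
        ![[0, 0, 1], [1, 1], [3, 1], [0, 2], [0, 1], [], [0, 1, 2], [0, 2, 2], [0, 0, 2]]⟩,
      ⟨rotationNine,
        tablePerm ![0, 8, 1, 7, 2, 4, 6, 5, 3] ![0, 2, 4, 8, 5, 7, 6, 3, 1],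
        [1, 4], 2,
        ![[0, 0, 2], [0, 1, 1], [0, 0, 1], [0, 3, 1], [1, 2], [0, 5, 1], [], [1, 3], [1, 1]]⟩,
      ⟨rotationNine,
        tablePerm ![6, 0, 2, 3, 7, 8, 4, 5, 1] ![1, 8, 2, 3, 6, 7, 0, 4, 5],
        [1, 1, 2, 2], 2,
        ![[0, 0, 1], [0, 0, 3], [0, 0, 2], [0, 1, 3], [], [0, 3, 1], [1, 4], [1, 1], [0, 1, 1]]⟩,
      ⟨rotationNine,
        tablePerm ![6, 1, 3, 7, 4, 2, 5, 8, 0] ![8, 1, 5, 2, 4, 6, 0, 3, 7],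
        [2, 2], 2,
        ![[], [0, 3], [0, 1, 2], [1, 1, 4], [0, 1, 1], [0, 0, 4], [0, 1, 4], [0, 1], [1, 2]]⟩,
      ⟨rotationNine,
        tablePerm ![0, 2, 8, 7, 3, 4, 6, 1, 5] ![0, 7, 1, 4, 5, 8, 6, 3, 2],
        [2, 2], 2,
        ![[], [2, 3], [2, 2, 1], [0, 3, 1], [0, 2, 1], [0, 1, 1], [1, 1], [0, 4, 1], [0, 0, 1]]⟩,
      ⟨rotationNine,
        tablePerm ![0, 4, 1, 7, 3, 2, 6, 8, 5] ![0, 2, 5, 4, 1, 8, 6, 3, 7],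
        [2, 3, 3, 2], 1,
        ![[], [2, 1], [1, 2], [1, 1], [1, 4], [0, 1, 2], [0, 0, 1], [1, 5], [0, 0, 2]]⟩,
      ⟨rotationNine,
        tablePerm ![0, 1, 7, 2, 6, 3, 5, 8, 4] ![0, 1, 3, 5, 8, 6, 4, 2, 7],
        [3, 2], 2,
        ![[0, 0, 1], [1, 5], [1, 1, 1], [0, 5], [0, 2], [0, 4], [0, 3], [], [0, 1]]⟩]
    ![15, 15, 15] ![7, 7, 7] ![![1, 3, 15], ![3, 1, 15], ![2, 2, 9]]
    ?_ ?_ ?_ ?_ ?_ ?_ ?_ <;> decide +kernel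

/-- A permutation of order 7. -/
def rotationTen : Perm (Fin 10) :=
  tablePerm ![1, 2, 3, 4, 5, 6, 0, 7, 8, 9] ![6, 0, 1, 2, 3, 4, 5, 7, 8, 9]

theorem powersBeauville_alternatingGroup_ten :
    PowersBeauville (alternatingGroup (Fin 10)) := by
  refine GeneratingTable.powersBeauville (by norm_num)
    ⟨tablePerm ![7, 3, 1, 9, 0, 2, 4, 8, 6, 5] ![4, 2, 5, 1, 6, 9, 8, 0, 7, 3],
      tablePerm ![3, 9, 0, 4, 7, 8, 5, 2, 1, 6] ![2, 8, 7, 0, 3, 6, 9, 4, 5, 1],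
      [1, 2], 2,
      ![[], [2, 4], [0, 0, 3], [1, 3, 1], [0, 1, 3], [0, 1, 1], [1, 1], [4, 1, 2], [2, 1, 1],
        [0, 3, 2]]⟩
    ![⟨rotationTen,
        tablePerm ![4, 1, 2, 3, 9, 8, 0, 5, 6, 7] ![6, 1, 2, 3, 0, 7, 8, 9, 5, 4],
        [1, 1], 7,
        ![[0, 0, 1], [0, 2, 1], [1, 1, 1], [1, 1, 2], [0, 3], [], [0, 1, 1], [0, 2, 4], [0, 0, 2],
          [0, 2]]⟩,
      ⟨rotationTen,
        tablePerm ![0, 8, 2, 3, 1, 6, 9, 5, 7, 4] ![0, 4, 2, 3, 9, 7, 5, 8, 1, 6],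
        [1, 1, 2, 1], 2,
        ![[], [0, 0, 2], [1, 3, 1], [3, 2, 1], [0, 5, 1], [0, 2, 1], [0, 3, 1], [0, 1, 1],
          [0, 0, 1], [1, 1]]⟩,
      ⟨rotationTen,
        tablePerm ![3, 1, 2, 8, 0, 5, 7, 4, 9, 6] ![4, 1, 2, 0, 7, 5, 9, 6, 3, 8],
        [1, 1], 7,
        ![[], [0, 0, 2], [2, 3], [0, 3], [0, 2, 1], [0, 2], [2, 2], [0, 0, 1], [0, 2, 2],
          [0, 3, 1]]⟩,
      ⟨rotationTen,
        tablePerm ![7, 4, 2, 3, 9, 8, 6, 1, 0, 5] ![8, 7, 2, 3, 1, 9, 6, 0, 5, 4],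
        [1, 1], 7,
        ![[], [1, 1, 1], [0, 1, 1], [0, 1, 2], [0, 1], [1, 4, 1], [0, 1, 5], [0, 2], [0, 0, 2],
          [0, 1, 3]]⟩,
      ⟨rotationTen,
        tablePerm ![4, 1, 2, 5, 9, 8, 6, 3, 0, 7] ![8, 1, 2, 7, 0, 3, 6, 9, 5, 4],
        [1, 1, 1, 2], 2,
        ![[], [0, 0, 2], [3, 3], [0, 0, 1], [1, 4, 1], [1, 1, 1], [0, 2], [1, 3, 1], [5, 1],
          [1, 2, 1]]⟩,
      ⟨rotationTen,
        tablePerm ![0, 2, 8, 3, 9, 5, 7, 4, 6, 1] ![0, 9, 1, 3, 7, 5, 8, 6, 2, 4],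
        [1, 1], 7,
        ![[], [0, 0, 2], [0, 1, 2], [2, 4], [0, 1, 1], [3, 1, 3], [2, 2], [0, 0, 1], [0, 2, 2],
          [0, 2, 1]]⟩,
      ⟨rotationTen,
        tablePerm ![3, 1, 2, 4, 7, 5, 9, 6, 0, 8] ![8, 1, 2, 0, 3, 5, 7, 4, 9, 6],
        [1, 1], 7,
        ![[0, 0, 1], [2, 1, 1], [1, 1, 1], [1, 1, 2], [], [1, 1, 3], [0, 4], [0, 0, 3], [0, 3, 2],
          [1, 2]]⟩]
    ![5, 5, 5] ![7, 7, 21] ![![1, 6, 12], ![2, 1, 12], ![2, 2, 12]]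
    ?_ ?_ ?_ ?_ ?_ ?_ ?_ <;> decide +kernel

end SmallDegree

section DegreeFive

open Equiv

/-- Representatives of the conjugacy classes of permutations of `Fin 5` which are even. -/
def standardPerm : Fin 4 → Perm (Fin 5) :=
  ![1, tablePerm ![0, 2, 1, 4, 3] ![0, 2, 1, 4, 3], tablePerm ![0, 1, 3, 4, 2] ![0, 1, 4, 2, 3],
    tablePerm ![1, 2, 3, 4, 0] ![4, 0, 1, 2, 3]]

/-- Representatives of the orbits of the automorphism group of the alternating group of degree
five on generating pairs. -/
def orbitTable : Fin 19 → GeneratingTable 5 :=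
  ![⟨standardPerm 2, tablePerm ![1, 2, 0, 3, 4] ![2, 0, 1, 3, 4],
      [0, 1, 1, 2], 1, ![[0, 1], [0, 1, 1], [0, 0, 2], [], [0, 0, 1]]⟩,
    ⟨standardPerm 1, tablePerm ![1, 2, 3, 4, 0] ![4, 0, 1, 2, 3],
      [0, 2, 1, 2], 1, ![[0, 1], [1, 1, 1], [0, 1, 1], [], [0, 0, 1]]⟩,
    ⟨standardPerm 3, tablePerm ![0, 2, 1, 4, 3] ![0, 2, 1, 4, 3],
      [2, 1, 2], 1, ![[0, 0, 1], [2, 1, 1], [1, 1], [], [0, 1]]⟩,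
    ⟨standardPerm 3, tablePerm ![0, 2, 4, 3, 1] ![0, 4, 1, 3, 2],
      [2, 1, 1], 1, ![[0, 0, 2], [0, 1], [0, 2], [0, 0, 1], []]⟩,
    ⟨standardPerm 3, tablePerm ![0, 1, 3, 4, 2] ![0, 1, 4, 2, 3],
      [0, 0, 0, 1], 1, ![[], [0, 0, 2], [0, 2, 1], [0, 0, 1], [0, 1, 1]]⟩,
    ⟨standardPerm 1, tablePerm ![1, 3, 4, 2, 0] ![4, 0, 3, 1, 2],
      [0, 2, 1, 1], 1, ![[], [0, 2], [0, 1], [0, 1, 1], [1, 1, 1]]⟩,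
    ⟨standardPerm 2, tablePerm ![1, 2, 3, 4, 0] ![4, 0, 1, 2, 3],
      [0, 0, 1], 1, ![[], [0, 2], [2, 1], [0, 1], [1, 1]]⟩,
    ⟨standardPerm 1, tablePerm ![1, 3, 2, 0, 4] ![3, 0, 2, 1, 4],
      [1, 1, 1], 1, ![[0, 1], [1], [], [1, 1, 1, 2], [0, 1, 1, 2]]⟩,
    ⟨standardPerm 3, tablePerm ![0, 1, 4, 2, 3] ![0, 1, 3, 4, 2],
      [0, 0, 0, 2], 1, ![[], [0, 0, 2], [0, 1, 1], [0, 0, 1], [0, 2, 1]]⟩,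
    ⟨standardPerm 2, tablePerm ![2, 3, 0, 1, 4] ![2, 3, 0, 1, 4],
      [0, 1, 1, 1], 1, ![[0, 1], [], [0, 1, 1], [1, 1, 1], [2, 1, 1]]⟩,
    ⟨standardPerm 2, tablePerm ![2, 3, 1, 4, 0] ![4, 2, 0, 1, 3],
      [0, 0, 1], 1, ![[], [0, 1], [0, 2], [1, 2], [2, 2]]⟩,
    ⟨standardPerm 3, tablePerm ![2, 0, 4, 1, 3] ![1, 3, 0, 4, 2],
      [0, 0, 1, 1], 1, ![[0, 0, 1], [1, 2], [0, 2, 1], [], [0, 0, 2]]⟩,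
    ⟨standardPerm 3, tablePerm ![0, 4, 1, 3, 2] ![0, 2, 4, 3, 1],
      [2, 2, 1], 1, ![[0, 0, 2], [0, 2], [0, 1], [0, 0, 1], []]⟩,
    ⟨standardPerm 3, tablePerm ![1, 4, 0, 2, 3] ![2, 0, 3, 4, 1],
      [0, 0, 1, 1], 1, ![[0, 0, 1], [0, 2, 1], [], [0, 1, 2], [0, 1]]⟩,
    ⟨standardPerm 3, tablePerm ![1, 2, 4, 0, 3] ![3, 0, 1, 4, 2],
      [0, 1, 2, 1], 1, ![[], [0, 0, 2], [0, 0, 1], [0, 1], [0, 2]]⟩,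
    ⟨standardPerm 2, tablePerm ![1, 2, 4, 0, 3] ![3, 0, 1, 4, 2],
      [0, 0, 2], 1, ![[], [0, 2], [1, 1], [2, 1], [0, 1]]⟩,
    ⟨standardPerm 3, tablePerm ![1, 3, 0, 4, 2] ![2, 0, 4, 1, 3],
      [0, 1, 2], 1, ![[], [0, 1, 1], [0, 2], [0, 0, 2], [0, 0, 1]]⟩,
    ⟨standardPerm 2, tablePerm ![2, 3, 4, 0, 1] ![3, 4, 0, 1, 2],
      [0, 2, 2, 1], 1, ![[0, 1, 1], [0, 1], [0, 0, 2], [], [0, 0, 1]]⟩,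
    ⟨standardPerm 3, tablePerm ![0, 3, 4, 1, 2] ![0, 3, 4, 1, 2],
      [2, 1, 1, 1], 1, ![[], [0, 1, 2], [0, 1, 1], [0, 0, 2], [0, 0, 1]]⟩]

/-- The orders of the members of the triples of `orbitTable`. -/
def orbitOrder : Fin 19 → Fin 3 → ℕ :=
  ![![3, 3, 5], ![2, 5, 3], ![5, 2, 3], ![5, 3, 5], ![5, 3, 5], ![2, 5, 5],
    ![3, 5, 5], ![2, 3, 5], ![5, 3, 3], ![3, 2, 5], ![3, 5, 5], ![5, 5, 3],
    ![5, 3, 2], ![5, 5, 3], ![5, 5, 2], ![3, 5, 3], ![5, 5, 5], ![3, 5, 2],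
    ![5, 2, 5]]

/-- An ordering of the orbits which is sufficiently different from the given one. -/
def orbitReorder : Fin 19 → Fin 19 :=
  ![6, 10, 0, 13, 5, 9, 17, 7, 16, 8, 12, 14, 1, 18, 3, 4, 11, 15, 2]

/-- Tests distinguishing the orbits. -/
def orbitTests : Fin 5 → Fin 3 → ℕ :=
  ![![2, 1, 10], ![2, 4, 5], ![2, 2, 6], ![1, 1, 5], ![3, 1, 6]]

theorem valid_orbitTable : ∀ i, (orbitTable i).Valid := by decide +kernel

theorem hasOrder_orbitTable :
    ∀ i d, GeneratingTable.HasOrder ((orbitTable i).perm d) (orbitOrder i d) := by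
  decide +kernel

theorem orbitTable_outcome_injective : ∀ i j,
    (orbitTable i).outcome orbitTests = (orbitTable j).outcome orbitTests → i = j := by
  decide +kernel

theorem orbitReorder_injective : Function.Injective orbitReorder := by decide +kernel

theorem prime_orbitOrder : ∀ i d, (orbitOrder i d).Prime := by decide +kernel

theorem exists_orbitOrder_ne : ∀ (d e : Fin 3) (i : Fin 19),
    orbitOrder i d = orbitOrder (orbitReorder i) e → ∃ j ≤ max i 1,
      ¬ (orbitOrder j d = orbitOrder i d ↔ orbitOrder (orbitReorder j) e = orbitOrder i d) := by
  decide +kernel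

/-- The generating pairs of the alternating group of degree five in `orbitTable`. -/
def orbitPair (i : Fin 19) : alternatingGroup (Fin 5) × alternatingGroup (Fin 5) :=
  (orbitTable i).pair (valid_orbitTable i)

theorem generates_orbitPair (i : Fin 19) : Generates (orbitPair i) :=
  GeneratingTable.generates_pair _ _

theorem not_autEquiv_orbitPair {i j : Fin 19} (h : i ≠ j) :
    ¬ AutEquiv (orbitPair i) (orbitPair j) :=
  GeneratingTable.not_autEquiv _ _ fun h' => h (orbitTable_outcome_injective i j h')

theorem orderOf_orbitPair (i : Fin 19) (d : Fin 3) :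
    orderOf (triple (orbitPair i) d) = orbitOrder i d := by
  rw [orbitPair, GeneratingTable.orderOf_triple_pair, (hasOrder_orbitTable i d).orderOf_eq]

theorem pow_eq_one_iff_of_prime_orderOf {G : Type*} [Group G] {g : G} {p m : ℕ}
    (hg : (orderOf g).Prime) (hp : p.Prime) (hm : ¬ p ∣ m) (h : g ^ (m * p) = 1) :
    g ^ m = 1 ↔ orderOf g ≠ p := by
  rw [← orderOf_dvd_iff_pow_eq_one]
  constructor
  · rintro h' rfl
    exact hm h'
  · intro hne
    refine (hg.dvd_mul.1 (orderOf_dvd_of_pow_eq_one h)).resolve_right fun h' => ?_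
    exact hne ((Nat.prime_dvd_prime_iff_eq hg hp).1 h')

theorem orderOf_eq_of_pow_ne_one {G : Type*} [Group G] {g : G} {p m : ℕ}
    (hg : (orderOf g).Prime) (hp : p.Prime) (h : g ^ (m * p) = 1) (hne : g ^ m ≠ 1) :
    orderOf g = p ∧ ¬ p ∣ m := by
  rw [Ne, ← orderOf_dvd_iff_pow_eq_one] at hne
  have := (hg.dvd_mul.1 (orderOf_dvd_of_pow_eq_one h)).resolve_left hne
  have := (Nat.prime_dvd_prime_iff_eq hg hp).1 this
  exact ⟨this, this ▸ hne⟩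

theorem isBeauvilleGroup_alternatingGroup_five {k : ℕ} (hk : 2 ≤ k) (hk' : k ≤ 19) :
    IsBeauvilleGroup (Fin k → alternatingGroup (Fin 5)) := by
  have h5 : 5 ≤ Nat.card (Fin 5) := by simp
  have := alternatingGroup.isSimpleGroup h5
  refine IsBeauvilleGroup.power_of_families (exists_mul_ne_mul_alternatingGroup h5)
    (⟨0, by omega⟩ : Fin k) (t := fun i => orbitPair (Fin.castLE hk' i))
    (u := fun i => orbitPair (orbitReorder (Fin.castLE hk' i)))
    (fun i => generates_orbitPair _)
    (fun i j hij => not_autEquiv_orbitPair fun h => hij (Fin.castLE_injective hk' h))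
    (fun i => generates_orbitPair _)
    (fun i j hij => not_autEquiv_orbitPair fun h =>
      hij (Fin.castLE_injective hk' (orbitReorder_injective h)))
    (GeneratingTable.hyperbolic_pair _ (hasOrder_orbitTable _)
      (show _ from by decide +kernel : orbitOrder 0 1 * orbitOrder 0 2 +
        orbitOrder 0 0 * orbitOrder 0 2 + orbitOrder 0 0 * orbitOrder 0 1 <
        orbitOrder 0 0 * orbitOrder 0 1 * orbitOrder 0 2))
    (GeneratingTable.hyperbolic_pair _ (hasOrder_orbitTable _)
      (show _ from by decide +kernel : orbitOrder (orbitReorder 0) 1 *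
        orbitOrder (orbitReorder 0) 2 + orbitOrder (orbitReorder 0) 0 *
        orbitOrder (orbitReorder 0) 2 + orbitOrder (orbitReorder 0) 0 *
        orbitOrder (orbitReorder 0) 1 < orbitOrder (orbitReorder 0) 0 *
        orbitOrder (orbitReorder 0) 1 * orbitOrder (orbitReorder 0) 2)) ?_
  intro p hp d e m m' hconj hpow i
  have key : ∀ i : Fin k, triple (orbitPair (Fin.castLE hk' i)) d ^ m = 1 ↔
      triple (orbitPair (orbitReorder (Fin.castLE hk' i))) e ^ m' = 1 := fun i => by
    obtain ⟨g, hg⟩ := isConj_iff.1 (hconj i)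
    rw [← hg, conj_eq_one_iff]
  have hpow' : ∀ i : Fin k,
      triple (orbitPair (orbitReorder (Fin.castLE hk' i))) e ^ (m' * p) = 1 := fun i => by
    obtain ⟨g, hg⟩ := isConj_iff.1 (hconj i)
    rw [pow_mul, ← hg, conj_pow, ← pow_mul, hpow i, mul_one, mul_inv_cancel]
  have hq : ∀ j d, (orderOf (triple (orbitPair j) d)).Prime := fun j d => by
    rw [orderOf_orbitPair]
    exact prime_orbitOrder j d
  by_contra hne
  obtain ⟨hi, hm⟩ := orderOf_eq_of_pow_ne_one (hq _ d) hp (hpow i) hne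
  obtain ⟨hi', hm'⟩ := orderOf_eq_of_pow_ne_one (hq _ e) hp (hpow' i) fun h => hne ((key i).2 h)
  rw [orderOf_orbitPair] at hi hi'
  obtain ⟨j, hj, hji⟩ := exists_orbitOrder_ne d e _ (hi.trans hi'.symm)
  obtain ⟨j, rfl⟩ : ∃ l : Fin k, Fin.castLE hk' l = j := by
    have hjk : (j : ℕ) < k := by
      rcases le_max_iff.1 hj with h | h
      · exact lt_of_le_of_lt (Fin.le_def.1 h) i.2
      · exact lt_of_le_of_lt (Fin.le_def.1 h) hk
    exact ⟨⟨j, hjk⟩, rfl⟩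
  refine hji ?_
  have := key j
  rw [pow_eq_one_iff_of_prime_orderOf (hq _ d) hp hm (hpow j),
    pow_eq_one_iff_of_prime_orderOf (hq _ e) hp hm' (hpow' j), not_iff_not,
    orderOf_orbitPair, orderOf_orbitPair] at this
  rwa [hi]

end DegreeFive

section DegreeFiveBound

open Equiv

/-- The exponents of the permutations `standardPerm`. -/
def standardOrder : Fin 4 → ℕ := ![1, 2, 3, 5]

theorem exists_conj_standardPerm : ∀ x : Perm (Fin 5), Perm.sign x = 1 →
    ∃ j, x ^ standardOrder j = 1 ∧
      ∃ s : Perm (Fin 5), ∀ b, standardPerm j (s b) = s (x b) := by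
  decide +kernel

/-- Elements commuting with `standardPerm`. -/
def standardCommuting (j : Fin 4) (a : Fin 5) (b : Fin 2) : Perm (Fin 5) :=
  (![1, tablePerm ![0, 3, 4, 2, 1] ![0, 4, 3, 1, 2], standardPerm 2, standardPerm 3] : Fin 4 → _) j
      ^ (a : ℕ) *
    (![1, tablePerm ![0, 2, 1, 3, 4] ![0, 2, 1, 3, 4], tablePerm ![1, 0, 2, 3, 4] ![1, 0, 2, 3, 4],
      1] : Fin 4 → _) j ^ (b : ℕ)

/-- Generators of the Sylow subgroups of order five. -/
def fiveCycle : Fin 6 → Perm (Fin 5) :=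
  ![tablePerm ![1, 2, 3, 4, 0] ![4, 0, 1, 2, 3],
    tablePerm ![1, 2, 4, 0, 3] ![3, 0, 1, 4, 2],
    tablePerm ![1, 3, 0, 4, 2] ![2, 0, 4, 1, 3],
    tablePerm ![1, 3, 4, 2, 0] ![4, 0, 3, 1, 2],
    tablePerm ![1, 4, 0, 2, 3] ![2, 0, 3, 4, 1],
    tablePerm ![1, 4, 3, 0, 2] ![3, 0, 4, 2, 1]]

/-- `g` preserves the set of the two points. -/
def PreservesPair (a b : Fin 5) (g : Perm (Fin 5)) : Prop :=
  (g a = a ∧ g b = b) ∨ (g a = b ∧ g b = a)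

instance (a b : Fin 5) (g : Perm (Fin 5)) : Decidable (PreservesPair a b g) :=
  inferInstanceAs (Decidable (_ ∨ _))

/-- `g` normalizes the group generated by `z`, assumed to be of order five. -/
def NormalizesFiveCycle (z g : Perm (Fin 5)) : Prop :=
  g * z = z * g ∨ g * z = z⁻¹ * g

instance (z g : Perm (Fin 5)) : Decidable (NormalizesFiveCycle z g) :=
  inferInstanceAs (Decidable (_ ∨ _))

theorem standardPerm_cases : ∀ (j : Fin 4) (y : Perm (Fin 5)), Perm.sign y = 1 →
    (∃ a b, PreservesPair a b (standardPerm j) ∧ PreservesPair a b y) ∨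
    (∃ i, NormalizesFiveCycle (fiveCycle i) (standardPerm j) ∧
      NormalizesFiveCycle (fiveCycle i) y) ∨
    ∃ i, (orbitTable i).fst = standardPerm j ∧ ∃ a b,
      standardCommuting j a b * y = (orbitTable i).snd * standardCommuting j a b := by
  decide +kernel

theorem commute_standardCommuting : ∀ j a b,
    standardCommuting j a b * standardPerm j = standardPerm j * standardCommuting j a b := by
  decide +kernel

theorem Generates.forall_perm {α : Type*} [Fintype α] [DecidableEq α]
    {p : alternatingGroup α × alternatingGroup α} (hp : Generates p) {P : Perm α → Prop}
    (h1 : P 1) (hmul : ∀ g h, P g → P h → P (g * h)) (hinv : ∀ g, P g → P g⁻¹)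
    (h₁ : P p.1) (h₂ : P p.2) {g : Perm α} (hg : Perm.sign g = 1) : P g := by
  have hmem : (⟨g, hg⟩ : alternatingGroup α) ∈ Subgroup.closure {p.1, p.2} := by
    rw [show Subgroup.closure {p.1, p.2} = ⊤ from hp]
    exact Subgroup.mem_top _
  refine Subgroup.closure_induction (p := fun (x : alternatingGroup α) _ => P x) ?_ h1
    (fun x y _ _ => hmul x y) (fun x _ => hinv x) hmem
  rintro x (rfl | rfl)
  exacts [h₁, h₂]

theorem Generates.not_preservesPair {p : alternatingGroup (Fin 5) × alternatingGroup (Fin 5)}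
    (hp : Generates p) (a b : Fin 5) (h₁ : PreservesPair a b p.1) : ¬ PreservesPair a b p.2 := by
  intro h₂
  have hrot : ∀ a b, ¬ PreservesPair a b (standardPerm 3) := by decide +kernel
  refine hrot a b (hp.forall_perm (P := PreservesPair a b) (Or.inl ⟨rfl, rfl⟩) ?_ ?_ h₁ h₂
    (by decide +kernel))
  · rintro g h (⟨h₁, h₂⟩ | ⟨h₁, h₂⟩) (⟨h₃, h₄⟩ | ⟨h₃, h₄⟩) <;>
      simp [PreservesPair, h₁, h₂, h₃, h₄]
  · rintro g (⟨h₁, h₂⟩ | ⟨h₁, h₂⟩)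
    · exact Or.inl ⟨Perm.inv_eq_iff_eq.2 h₁.symm, Perm.inv_eq_iff_eq.2 h₂.symm⟩
    · exact Or.inr ⟨Perm.inv_eq_iff_eq.2 h₂.symm, Perm.inv_eq_iff_eq.2 h₁.symm⟩

theorem Generates.not_normalizesFiveCycle
    {p : alternatingGroup (Fin 5) × alternatingGroup (Fin 5)} (hp : Generates p) (i : Fin 6)
    (h₁ : NormalizesFiveCycle (fiveCycle i) p.1) : ¬ NormalizesFiveCycle (fiveCycle i) p.2 := by
  intro h₂
  have hthree : ∀ i, ¬ NormalizesFiveCycle (fiveCycle i) (standardPerm 2) := by decide +kernel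
  refine hthree i (hp.forall_perm (P := NormalizesFiveCycle (fiveCycle i)) ?_ ?_ ?_ h₁ h₂
    (by decide +kernel))
  · exact Or.inl (by rw [one_mul, mul_one])
  · rintro g h (hg | hg) (hh | hh)
    · exact Or.inl (SemiconjBy.mul_left hg hh)
    · exact Or.inr (SemiconjBy.mul_left (SemiconjBy.inv_right hg) hh)
    · exact Or.inr (SemiconjBy.mul_left hg hh)
    · refine Or.inl (SemiconjBy.mul_left (y := (fiveCycle i)⁻¹) ?_ hh)
      have := SemiconjBy.inv_right hg
      rwa [inv_inv] at this
  · rintro g (hg | hg)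
    · exact Or.inl (SemiconjBy.inv_symm_left hg)
    · refine Or.inr ?_
      have := (SemiconjBy.inv_symm_left hg).inv_right
      rwa [inv_inv] at this

theorem AutEquiv.of_conj {α : Type*} [Fintype α] [DecidableEq α]
    {p q : alternatingGroup α × alternatingGroup α} (s : Perm α)
    (h₁ : s * p.1 = q.1 * s) (h₂ : s * p.2 = q.2 * s) : AutEquiv p q :=
  ⟨MulAut.conjNormal s, Subtype.ext (by rw [MulAut.conjNormal_apply, h₁, mul_inv_cancel_right]),
    Subtype.ext (by rw [MulAut.conjNormal_apply, h₂, mul_inv_cancel_right])⟩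

theorem Generates.exists_autEquiv_orbitPair
    {p : alternatingGroup (Fin 5) × alternatingGroup (Fin 5)} (hp : Generates p) :
    ∃ i, AutEquiv p (orbitPair i) := by
  obtain ⟨j, -, s, hs⟩ := exists_conj_standardPerm p.1 p.1.2
  let φ : MulAut (alternatingGroup (Fin 5)) := MulAut.conjNormal s
  have hq := hp.map_mulEquiv φ
  have hq₁ : (φ p.1 : Perm (Fin 5)) = standardPerm j := by
    rw [MulAut.conjNormal_apply, mul_inv_eq_iff_eq_mul]
    exact Equiv.ext fun b => (hs b).symm
  rcases standardPerm_cases j (φ p.2) (φ p.2).2 with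
      ⟨a, b, h₁, h₂⟩ | ⟨i, h₁, h₂⟩ | ⟨i, h₁, a, b, h₂⟩
  · exact absurd h₂ (hq.not_preservesPair a b (hq₁ ▸ h₁))
  · exact absurd h₂ (hq.not_normalizesFiveCycle i (hq₁ ▸ h₁))
  · refine ⟨i, AutEquiv.trans (q := (φ p.1, φ p.2)) ⟨φ, rfl, rfl⟩
      (AutEquiv.of_conj (standardCommuting j a b) ?_ h₂)⟩
    change _ * (φ p.1 : Perm (Fin 5)) = (orbitTable i).fst * _
    rw [hq₁, h₁]
    exact commute_standardCommuting j a b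

theorem le_nineteen_of_generates {k : ℕ}
    (h : ∃ x y : Fin k → alternatingGroup (Fin 5), Subgroup.closure {x, y} = ⊤) : k ≤ 19 := by
  obtain ⟨x, y, hxy⟩ := h
  have hs : PowerGenerates fun i => (x i, y i) := hxy
  have := alternatingGroup.isSimpleGroup (α := Fin 5) (by simp)
  choose f hf using fun i => (hs.generates i).exists_autEquiv_orbitPair
  have hinj : Function.Injective f := fun i j hij => by
    by_contra hne
    exact hs.not_autEquiv hne ((hf i).trans (hij ▸ (hf j).symm))
  simpa using Fintype.card_le_of_injective f hinj

theorem orderOf_alternatingGroup_five (g : alternatingGroup (Fin 5)) :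
    orderOf g = 1 ∨ orderOf g = 2 ∨ orderOf g = 3 ∨ orderOf g = 5 := by
  obtain ⟨j, hj, -⟩ := exists_conj_standardPerm g g.2
  have hd := orderOf_dvd_of_pow_eq_one hj
  rw [Subgroup.orderOf_coe] at hd
  fin_cases j
  · exact Or.inl (Nat.dvd_one.1 hd)
  · have := (Nat.dvd_prime Nat.prime_two).1 hd
    tauto
  · have := (Nat.dvd_prime Nat.prime_three).1 hd
    tauto
  · have := (Nat.dvd_prime Nat.prime_five).1 hd
    tauto

theorem exists_orderOf_eq_five {a b c : alternatingGroup (Fin 5)}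
    (h : (1 : ℚ) / (orderOf a) + 1 / (orderOf b) + 1 / (orderOf c) < 1) :
    ∃ d ∈ ({a, b, c} : Set (alternatingGroup (Fin 5))), orderOf d = 5 := by
  by_contra! hne
  have key : ∀ d ∈ ({a, b, c} : Set (alternatingGroup (Fin 5))), (1 : ℚ) / 3 ≤ 1 / orderOf d := by
    intro d hd
    rcases orderOf_alternatingGroup_five d with h | h | h | h
    · rw [h]; norm_num
    · rw [h]; norm_num
    · rw [h]; norm_num
    · exact absurd h (hne d hd)
  have ha := key a (by simp)
  have hb := key b (by simp)
  have hc := key c (by simp)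
  linarith

theorem exists_conj_eq_zpow_of_orderOf_eq_five {x y : alternatingGroup (Fin 5)}
    (hx : orderOf x = 5) (hy : orderOf y = 5) : ∃ m : ℤ, IsConj (y ^ m) x := by
  have : Fact (Nat.Prime 5) := ⟨Nat.prime_five⟩
  have hcard : Nat.card (alternatingGroup (Fin 5)) = 5 * 12 := by
    rw [nat_card_alternatingGroup, Nat.card_fin]
    rfl
  have hfac : (Nat.card (alternatingGroup (Fin 5))).factorization 5 = 1 := by
    rw [hcard, Nat.factorization_mul (by norm_num) (by norm_num), Finsupp.add_apply,
      Nat.prime_five.factorization_self, Nat.factorization_eq_zero_of_not_dvd (by norm_num)]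
  let P : Sylow 5 (alternatingGroup (Fin 5)) :=
    Sylow.ofCard (Subgroup.zpowers x) (by rw [hfac, pow_one, Nat.card_zpowers, hx])
  let Q : Sylow 5 (alternatingGroup (Fin 5)) :=
    Sylow.ofCard (Subgroup.zpowers y) (by rw [hfac, pow_one, Nat.card_zpowers, hy])
  obtain ⟨g, hg⟩ := MulAction.exists_smul_eq (alternatingGroup (Fin 5)) P Q
  have hmem : g * x * g⁻¹ ∈ Q := by
    rw [← hg]
    exact Subgroup.smul_mem_pointwise_smul x (MulAut.conj g) _ (Subgroup.mem_zpowers x)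
  obtain ⟨m, hm⟩ := Subgroup.mem_zpowers_iff.1 (show g * x * g⁻¹ ∈ Subgroup.zpowers y from hmem)
  exact ⟨m, (isConj_iff.2 ⟨g, hm.symm⟩ : IsConj x (y ^ m)).symm⟩

theorem not_isBeauvilleGroup_alternatingGroup_five :
    ¬ IsBeauvilleGroup (alternatingGroup (Fin 5)) := by
  rintro ⟨a₁, b₁, c₁, a₂, b₂, c₂, ⟨-, -, h₁⟩, ⟨-, -, h₂⟩, hdisj⟩
  obtain ⟨x, hx, hx5⟩ := exists_orderOf_eq_five h₁
  obtain ⟨y, hy, hy5⟩ := exists_orderOf_eq_five h₂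
  obtain ⟨m, hm⟩ := exists_conj_eq_zpow_of_orderOf_eq_five hx5 hy5
  have hmem : x ∈ SigmaSet a₁ b₁ c₁ ∩ SigmaSet a₂ b₂ c₂ :=
    ⟨⟨x, hx, 1, by rw [zpow_one]⟩, ⟨y, hy, m, hm⟩⟩
  rw [hdisj, Set.mem_singleton_iff] at hmem
  rw [hmem, orderOf_one] at hx5
  omega

end DegreeFiveBound

section Main

theorem exists_generates_iff_le_d2 {T : Type*} [Group T] [Finite T] [IsSimpleGroup T]
    (hT : ∃ a b : T, a * b ≠ b * a) (k : ℕ) :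
    (∃ x y : Fin k → T, Subgroup.closure {x, y} = ⊤) ↔ k ≤ d2 T := by
  have hequiv : ∀ p q : {p : T × T // Subgroup.closure {p.1, p.2} = ⊤},
      Quot.mk (fun p q : {p : T × T // Subgroup.closure {p.1, p.2} = ⊤} =>
        ∃ φ : MulAut T, φ p.val.1 = q.val.1 ∧ φ p.val.2 = q.val.2) p = Quot.mk _ q →
      AutEquiv p.1 q.1 := fun p q h =>
    (Equivalence.comap AutEquiv.equivalence Subtype.val).eqvGen_iff.1 (Quot.eqvGen_exact h)
  constructor
  · rintro ⟨x, y, hxy⟩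
    have hs : PowerGenerates fun i => (x i, y i) := hxy
    have hinj : Function.Injective fun i : Fin k =>
        Quot.mk (fun p q : {p : T × T // Subgroup.closure {p.1, p.2} = ⊤} =>
          ∃ φ : MulAut T, φ p.val.1 = q.val.1 ∧ φ p.val.2 = q.val.2)
          ⟨(x i, y i), hs.generates i⟩ := fun i j hij => by
      by_contra hne
      exact hs.not_autEquiv hne (hequiv _ _ hij)
    simpa [d2] using Nat.card_le_card_of_injective _ hinj
  · intro hk
    let f := fun i : Fin k => (((Finite.equivFin _).symm (Fin.castLE hk i) :
      Quot (fun p q : {p : T × T // Subgroup.closure {p.1, p.2} = ⊤} =>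
        ∃ φ : MulAut T, φ p.val.1 = q.val.1 ∧ φ p.val.2 = q.val.2))).out
    have := powerGenerates_of_pairwise hT (t := fun i => (f i).1) (fun i => (f i).2)
      fun i j hij h => hij ?_
    · exact ⟨_, _, this⟩
    · have := Quot.sound (r := fun p q : {p : T × T // Subgroup.closure {p.1, p.2} = ⊤} =>
        ∃ φ : MulAut T, φ p.val.1 = q.val.1 ∧ φ p.val.2 = q.val.2) h
      rw [Quot.out_eq, Quot.out_eq] at this
      exact Fin.castLE_injective hk ((Finite.equivFin _).symm.injective this)

theorem powersBeauville_alternatingGroup {n : ℕ} (hn : 6 ≤ n) :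
    PowersBeauville (alternatingGroup (Fin n)) := by
  rcases Nat.lt_or_ge n 11 with h | h
  · interval_cases n
    exacts [powersBeauville_alternatingGroup_six, powersBeauville_alternatingGroup_seven,
      powersBeauville_alternatingGroup_eight, powersBeauville_alternatingGroup_nine,
      powersBeauville_alternatingGroup_ten]
  · exact powersBeauville_alternatingGroup_of_le h

end Main

theorem alternating_power_beauville_iff (n k : ℕ) (hn : 5 ≤ n) (hk : 1 ≤ k) :
    (IsBeauvilleGroup (Fin k → alternatingGroup (Fin n)) ↔
      ((∃ x y : Fin k → alternatingGroup (Fin n), Subgroup.closure {x, y} = ⊤) ∧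
        ¬ Nonempty ((Fin k → alternatingGroup (Fin n)) ≃* alternatingGroup (Fin 5)))) ∧
    (((∃ x y : Fin k → alternatingGroup (Fin n), Subgroup.closure {x, y} = ⊤) ∧
        ¬ Nonempty ((Fin k → alternatingGroup (Fin n)) ≃* alternatingGroup (Fin 5))) ↔
      ((n = 5 ∧ 2 ≤ k ∧ k ≤ 19) ∨
        (5 < n ∧ k ≤ d2 (alternatingGroup (Fin n))))) := by
  have hcard : 5 ≤ Nat.card (Fin n) := by simpa using hn
  have := alternatingGroup.isSimpleGroup hcard
  have h12 : IsBeauvilleGroup (Fin k → alternatingGroup (Fin n)) →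
      (∃ x y : Fin k → alternatingGroup (Fin n), Subgroup.closure {x, y} = ⊤) ∧
        ¬ Nonempty ((Fin k → alternatingGroup (Fin n)) ≃* alternatingGroup (Fin 5)) := fun h =>
    ⟨h.exists_generates, fun ⟨e⟩ =>
      not_isBeauvilleGroup_alternatingGroup_five (h.of_mulEquiv e)⟩
  have h23 : ((∃ x y : Fin k → alternatingGroup (Fin n), Subgroup.closure {x, y} = ⊤) ∧
      ¬ Nonempty ((Fin k → alternatingGroup (Fin n)) ≃* alternatingGroup (Fin 5))) →
      (n = 5 ∧ 2 ≤ k ∧ k ≤ 19) ∨ (5 < n ∧ k ≤ d2 (alternatingGroup (Fin n))) := by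
    rintro ⟨hgen, hiso⟩
    rcases hn.eq_or_lt with rfl | hlt
    · refine Or.inl ⟨rfl, ?_, le_nineteen_of_generates hgen⟩
      by_contra! hk2
      obtain rfl : k = 1 := by omega
      exact hiso ⟨MulEquiv.funUnique (Fin 1) _⟩
    · exact Or.inr ⟨hlt, (exists_generates_iff_le_d2
        (exists_mul_ne_mul_alternatingGroup hcard) k).1 hgen⟩
  have h31 : (n = 5 ∧ 2 ≤ k ∧ k ≤ 19) ∨ (5 < n ∧ k ≤ d2 (alternatingGroup (Fin n))) →
      IsBeauvilleGroup (Fin k → alternatingGroup (Fin n)) := by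
    rintro (⟨rfl, hk2, hk19⟩ | ⟨hlt, hd⟩)
    · exact isBeauvilleGroup_alternatingGroup_five hk2 hk19
    · exact powersBeauville_alternatingGroup hlt k hk ((exists_generates_iff_le_d2
        (exists_mul_ne_mul_alternatingGroup hcard) k).2 hd)
  exact ⟨⟨h12, fun h => h31 (h23 h)⟩, h23, fun h => h12 (h31 h)⟩
end

section
/- Let G be a finite group, and for i = 1, 2 let (aᵢ, bᵢ, cᵢ) be a triple of elements of G with aᵢ·bᵢ·cᵢ = 1, whose entries have orders lᵢ, mᵢ, nᵢ respectively. Let Σᵢ be the set of all elements of G conjugate to a power of aᵢ, bᵢ or cᵢ, and for a prime p let Σᵢ^(p) be the set of elements of order p in Σᵢ. Then Σ₁ ∩ Σ₂ = {1} if and only if Σ₁^(p) ∩ Σ₂^(p) = ∅ for every prime p dividing both l₁·m₁·n₁ and l₂·m₂·n₂. In particular, if l₁·m₁·n₁ and l₂·m₂·n₂ are coprime, then Σ₁ ∩ Σ₂ = {1}. -/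
namespace SigmaSet

variable {G : Type*} [Group G] {a b c g : G}

theorem one_mem (a b c : G) : (1 : G) ∈ SigmaSet a b c :=
  ⟨a, by simp, 0, by simp⟩

theorem pow_mem (hg : g ∈ SigmaSet a b c) (k : ℕ) : g ^ k ∈ SigmaSet a b c := by
  obtain ⟨d, hd, m, hm⟩ := hg
  refine ⟨d, hd, m * k, ?_⟩
  rw [zpow_mul, zpow_natCast]
  exact hm.pow k

theorem orderOf_dvd (hg : g ∈ SigmaSet a b c) :
    orderOf g ∣ orderOf a * orderOf b * orderOf c := by
  obtain ⟨d, hd, m, hm⟩ := hg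
  obtain ⟨x, rfl⟩ := isConj_iff.mp hm
  have hx : orderOf (x * d ^ m * x⁻¹) ∣ orderOf d := by
    rw [orderOf_dvd_iff_pow_eq_one, conj_pow, ← zpow_natCast, zpow_comm, zpow_natCast,
      pow_orderOf_eq_one, one_zpow, mul_one, mul_inv_cancel]
  refine hx.trans ?_
  rcases hd with rfl | rfl | rfl
  · exact (Dvd.intro _ rfl).mul_right _
  · exact (Dvd.intro_left _ rfl).mul_right _
  · exact Dvd.intro_left _ rfl

end SigmaSet

theorem sigma_inter_trivial_iff_prime_order
    {G : Type*} [Group G] [Finite G]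
    (a₁ b₁ c₁ a₂ b₂ c₂ : G) (h₁ : a₁ * b₁ * c₁ = 1) (h₂ : a₂ * b₂ * c₂ = 1) :
    ((SigmaSet a₁ b₁ c₁ ∩ SigmaSet a₂ b₂ c₂ = {1}) ↔
      ∀ p : ℕ, p.Prime →
        p ∣ orderOf a₁ * orderOf b₁ * orderOf c₁ →
        p ∣ orderOf a₂ * orderOf b₂ * orderOf c₂ →
        {g ∈ SigmaSet a₁ b₁ c₁ | orderOf g = p} ∩
          {g ∈ SigmaSet a₂ b₂ c₂ | orderOf g = p} = ∅) ∧
    (Nat.Coprime (orderOf a₁ * orderOf b₁ * orderOf c₁)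
        (orderOf a₂ * orderOf b₂ * orderOf c₂) →
      SigmaSet a₁ b₁ c₁ ∩ SigmaSet a₂ b₂ c₂ = {1}) := by
  have one_mem_inter : (1 : G) ∈ SigmaSet a₁ b₁ c₁ ∩ SigmaSet a₂ b₂ c₂ :=
    ⟨SigmaSet.one_mem .., SigmaSet.one_mem ..⟩
  refine ⟨⟨fun h p hp _ _ => ?_, fun h => ?_⟩, fun h => ?_⟩
  · rw [Set.eq_empty_iff_forall_notMem]
    rintro g ⟨⟨hg₁, hgp⟩, hg₂, -⟩
    have hg : g = 1 := h.subset ⟨hg₁, hg₂⟩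
    rw [hg, orderOf_one] at hgp
    exact hp.ne_one hgp.symm
  · refine Set.Subset.antisymm ?_ (Set.singleton_subset_iff.mpr one_mem_inter)
    rintro g ⟨hg₁, hg₂⟩
    by_contra hg
    have hp := Nat.minFac_prime (mt orderOf_eq_one_iff.mp hg)
    have hpg := Nat.minFac_dvd (orderOf g)
    have hord := orderOf_pow_orderOf_div (orderOf_pos g).ne' hpg
    exact (h _ hp (hpg.trans (SigmaSet.orderOf_dvd hg₁))
      (hpg.trans (SigmaSet.orderOf_dvd hg₂))).subset
      ⟨⟨SigmaSet.pow_mem hg₁ _, hord⟩, SigmaSet.pow_mem hg₂ _, hord⟩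
  · refine Set.Subset.antisymm ?_ (Set.singleton_subset_iff.mpr one_mem_inter)
    rintro g ⟨hg₁, hg₂⟩
    exact orderOf_eq_one_iff.mp (Nat.eq_one_of_dvd_coprimes h
      (SigmaSet.orderOf_dvd hg₁) (SigmaSet.orderOf_dvd hg₂))
end

section
/- Let H be a nontrivial finite group and k ≥ 1. If the direct power H^k can be generated by two elements, then k ≤ d₂(H), where d₂(H) is the number of normal subgroups N of the free group F₂ of rank 2 such that F₂/N is isomorphic to H. -/
/-- `d₂ H`: the number of normal subgroups `N` of the free group `F₂` of rank 2
with `F₂ ⧸ N ≅ H`. -/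
noncomputable def d2F (H : Type*) [Group H] : ℕ :=
  Nat.card {N : Subgroup (FreeGroup (Fin 2)) //
    ∃ _ : N.Normal, Nonempty ((FreeGroup (Fin 2) ⧸ N) ≃* H)}

/-- A finite group is a quotient of `F₂` by only finitely many normal subgroups. -/
theorem finite_normal_subgroups_quotient_equiv (H : Type*) [Group H] [Finite H] :
    Finite {N : Subgroup (FreeGroup (Fin 2)) //
      ∃ _ : N.Normal, Nonempty ((FreeGroup (Fin 2) ⧸ N) ≃* H)} := by
  have : Finite (FreeGroup (Fin 2) →* H) := Finite.of_equiv _ (FreeGroup.lift (α := Fin 2))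
  refine ((Set.finite_range (MonoidHom.ker : (FreeGroup (Fin 2) →* H) → _)).subset ?_).to_subtype
  rintro N ⟨_, ⟨e⟩⟩
  refine ⟨e.toMonoidHom.comp (QuotientGroup.mk' N), ?_⟩
  ext x
  simp

/-- The coordinates of a surjection onto a direct power of a nontrivial group have pairwise
distinct kernels. -/
theorem injective_ker_evalMonoidHom_comp {G H ι : Type*} [Group G] [Group H] [Nontrivial H]
    (f : G →* (ι → H)) (hf : Function.Surjective f) :
    Function.Injective fun i => ((Pi.evalMonoidHom (fun _ : ι => H) i).comp f).ker := by
  classical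
  intro i j hij
  by_contra hne
  obtain ⟨h, hh⟩ := exists_ne (1 : H)
  obtain ⟨w, hw⟩ := hf (Pi.mulSingle i h)
  have hj : w ∈ ((Pi.evalMonoidHom (fun _ : ι => H) j).comp f).ker := by
    simp [MonoidHom.mem_ker, hw, Pi.mulSingle_eq_of_ne (Ne.symm hne)]
  have hi : w ∈ ((Pi.evalMonoidHom (fun _ : ι => H) i).comp f).ker :=
    hij.ge hj
  exact hh (by simpa [MonoidHom.mem_ker, hw] using hi)

theorem le_d2_of_power_two_generated
    {H : Type*} [Group H] [Finite H] (hH : Nontrivial H)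
    (k : ℕ) (hk : 1 ≤ k)
    (hgen : ∃ x y : Fin k → H, Subgroup.closure {x, y} = ⊤) :
    k ≤ d2F H := by
  obtain ⟨x, y, hxy⟩ := hgen
  let f : FreeGroup (Fin 2) →* (Fin k → H) := FreeGroup.lift ![x, y]
  have hf : Function.Surjective f := by
    rw [← MonoidHom.range_eq_top, FreeGroup.range_lift_eq_closure, Matrix.range_cons_cons_empty]
    exact hxy
  have hsurj (i : Fin k) : Function.Surjective
      ((Pi.evalMonoidHom (fun _ : Fin k => H) i).comp f) :=
    (Function.surjective_eval i).comp hf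
  have := finite_normal_subgroups_quotient_equiv H
  rw [d2F, ← Nat.card_fin k]
  exact Nat.card_le_card_of_injective
    (fun i => ⟨_, MonoidHom.normal_ker _,
      ⟨QuotientGroup.quotientKerEquivOfSurjective _ (hsurj i)⟩⟩)
    fun _ _ hij => injective_ker_evalMonoidHom_comp f hf (congrArg Subtype.val hij)
end

section
/- Let H be a non-abelian finite simple group, and let Γ be a group having k pairwise distinct normal subgroups N₁, ..., N_k such that Γ/Nᵢ is isomorphic to H for each i = 1, ..., k. Then Γ/(N₁ ∩ ⋯ ∩ N_k) is isomorphic to the direct product H^k. -/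
/-- A non-abelian simple group is perfect. -/
theorem IsSimpleGroup.commutator_eq_top_of_nonabelian {H : Type*} [Group H] [IsSimpleGroup H]
    (hnonab : ∃ a b : H, a * b ≠ b * a) : ⁅(⊤ : Subgroup H), (⊤ : Subgroup H)⁆ = ⊤ := by
  refine (IsSimpleGroup.eq_bot_or_eq_top_of_normal _ inferInstance).resolve_left fun h => ?_
  obtain ⟨a, b, hab⟩ := hnonab
  rw [Subgroup.commutator_eq_bot_iff_le_centralizer] at h
  exact hab (Subgroup.mem_centralizer_iff.1 (h (Subgroup.mem_top b)) a (Subgroup.mem_top a))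

/-- Surjective homomorphisms to simple groups either have equal kernels, or each maps the
kernel of the other onto its codomain. -/
theorem MonoidHom.map_ker_eq_top_of_ker_ne {Γ H K : Type*} [Group Γ] [Group H] [Group K]
    [IsSimpleGroup H] [IsSimpleGroup K] {f : Γ →* H} {g : Γ →* K}
    (hf : Function.Surjective f) (hg : Function.Surjective g) (hne : f.ker ≠ g.ker) :
    g.ker.map f = ⊤ := by
  refine (IsSimpleGroup.eq_bot_or_eq_top_of_normal _
    (Subgroup.Normal.map inferInstance f hf)).resolve_left fun h => ?_
  have hle : g.ker ≤ f.ker := (Subgroup.map_eq_bot_iff _).1 h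
  rcases IsSimpleGroup.eq_bot_or_eq_top_of_normal _
    (Subgroup.Normal.map (inferInstance : f.ker.Normal) g hg) with h' | h'
  · exact hne (le_antisymm ((Subgroup.map_eq_bot_iff _).1 h') hle)
  · have htop : f.ker = ⊤ := by
      rw [← sup_eq_left.2 hle, ← Subgroup.comap_map_eq, h', Subgroup.comap_top]
    obtain ⟨x, hx⟩ := exists_ne (1 : H)
    obtain ⟨y, rfl⟩ := hf x
    exact hx (f.mem_ker.1 (htop ▸ Subgroup.mem_top y))

/-- If a homomorphism maps two normal subgroups onto a perfect group, it also maps their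
intersection onto that group. -/
theorem Subgroup.map_inf_eq_top_of_perfect {Γ H : Type*} [Group Γ] [Group H]
    (hH : ⁅(⊤ : Subgroup H), (⊤ : Subgroup H)⁆ = ⊤) (f : Γ →* H) (A B : Subgroup Γ)
    [A.Normal] [B.Normal] (hA : A.map f = ⊤) (hB : B.map f = ⊤) : (A ⊓ B).map f = ⊤ := by
  rw [eq_top_iff, ← hH]
  calc ⁅(⊤ : Subgroup H), (⊤ : Subgroup H)⁆ = ⁅A, B⁆.map f := by
        rw [Subgroup.map_commutator, hA, hB]
    _ ≤ (A ⊓ B).map f := Subgroup.map_mono (Subgroup.commutator_le_inf A B)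

/-- Surjective homomorphisms to a non-abelian simple group with pairwise distinct kernels
are jointly surjective. -/
theorem MonoidHom.pi_surjective_of_injective_ker {Γ H ι : Type*} [Group Γ] [Group H]
    [IsSimpleGroup H] [Finite ι] (hnonab : ∃ a b : H, a * b ≠ b * a) (f : ι → Γ →* H)
    (hf : ∀ i, Function.Surjective (f i)) (hinj : Function.Injective fun i => (f i).ker) :
    Function.Surjective (MonoidHom.pi f) := by
  classical
  have key : ∀ (i : ι) (s : Finset ι), i ∉ s → (s.inf fun j => (f j).ker).Normal ∧
      (s.inf fun j => (f j).ker).map (f i) = ⊤ := by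
    intro i s
    induction s using Finset.induction_on with
    | empty =>
      intro _
      rw [Finset.inf_empty]
      exact ⟨inferInstance, Subgroup.map_top_of_surjective _ (hf i)⟩
    | insert j s _ ih =>
      intro hi
      rw [Finset.mem_insert, not_or] at hi
      obtain ⟨hnormal, hmap⟩ := ih hi.2
      rw [Finset.inf_insert]
      exact ⟨inferInstance, Subgroup.map_inf_eq_top_of_perfect
        (IsSimpleGroup.commutator_eq_top_of_nonabelian hnonab) _ _ _
        (MonoidHom.map_ker_eq_top_of_ker_ne (hf i) (hf j) (hinj.ne hi.1)) hmap⟩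
  intro y
  have lift : ∀ s : Finset ι, ∃ g : Γ, ∀ i ∈ s, f i g = y i := by
    intro s
    induction s using Finset.induction_on with
    | empty => exact ⟨1, by simp⟩
    | insert i s hi ih =>
      obtain ⟨g, hg⟩ := ih
      have hmem : (f i g)⁻¹ * y i ∈ (s.inf fun j => (f j).ker).map (f i) :=
        (key i s hi).2 ▸ Subgroup.mem_top _
      obtain ⟨h, hker, hh⟩ := hmem
      refine ⟨g * h, fun j hj => ?_⟩
      rw [map_mul]
      rcases Finset.mem_insert.1 hj with rfl | hj
      · rw [hh, mul_inv_cancel_left]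
      · have hone : f j h = 1 :=
          (f j).mem_ker.1 (Finset.inf_le (f := fun j => (f j).ker) hj hker)
        rw [hone, mul_one, hg j hj]
  have := Fintype.ofFinite ι
  obtain ⟨g, hg⟩ := lift Finset.univ
  exact ⟨g, funext fun i => hg i (Finset.mem_univ i)⟩

theorem quotient_iInf_mulEquiv_pow
    {H Γ : Type*} [Group H] [Finite H] [Group Γ]
    (hsimple : IsSimpleGroup H) (hnonab : ∃ a b : H, a * b ≠ b * a)
    (k : ℕ) (N : Fin k → Subgroup Γ) [inst : ∀ i, (N i).Normal]
    (hinj : Function.Injective N)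
    (hquot : ∀ i, Nonempty ((Γ ⧸ N i) ≃* H)) :
    haveI : (⨅ i, N i).Normal :=
      ⟨fun g hg h => Subgroup.mem_iInf.2 fun i =>
        (inst i).conj_mem g (Subgroup.mem_iInf.1 hg i) h⟩
    Nonempty ((Γ ⧸ ⨅ i, N i) ≃* (Fin k → H)) := by
  have : (⨅ i, N i).Normal := Subgroup.normal_iInf_normal inst
  let f : Fin k → Γ →* H := fun i => (hquot i).some.toMonoidHom.comp (QuotientGroup.mk' (N i))
  have hf : ∀ i, Function.Surjective (f i) := fun i =>
    (hquot i).some.surjective.comp (QuotientGroup.mk'_surjective (N i))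
  have hker : ∀ i, (f i).ker = N i := fun i => by
    ext x
    simp [f]
  have hsurj := MonoidHom.pi_surjective_of_injective_ker hnonab f hf (by simpa only [hker])
  have hkerpi : (⨅ i, N i) = (MonoidHom.pi f).ker := by
    ext x
    simp only [Subgroup.mem_iInf, ← hker, MonoidHom.mem_ker, funext_iff, MonoidHom.pi_apply,
      Pi.one_apply]
  exact ⟨(QuotientGroup.quotientMulEquivOfEq hkerpi).trans
    (QuotientGroup.quotientKerEquivOfSurjective _ hsurj)⟩
end

section
/- Let H be a non-abelian finite simple group and k ≥ 1. Then the direct power H^k can be generated by two elements if and only if k ≤ d₂(H). -/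
/-- Two generating pairs have the same class in the quotient counted by `d2` only if an
automorphism carries one to the other. -/
theorem exists_mulAut_of_quot_mk_eq {H : Type*} [Group H]
    {p q : {p : H × H // Subgroup.closure {p.1, p.2} = ⊤}}
    (h : Quot.mk (fun p q : {p : H × H // Subgroup.closure {p.1, p.2} = ⊤} =>
      ∃ φ : MulAut H, φ p.val.1 = q.val.1 ∧ φ p.val.2 = q.val.2) p = Quot.mk _ q) :
    ∃ φ : MulAut H, φ p.val.1 = q.val.1 ∧ φ p.val.2 = q.val.2 := by
  have h' := Quot.eqvGen_exact h
  clear h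
  induction h' with
  | rel _ _ h => exact h
  | refl _ => exact ⟨1, rfl, rfl⟩
  | symm _ _ _ ih =>
    obtain ⟨φ, h1, h2⟩ := ih
    exact ⟨φ⁻¹, by rw [← h1, MulAut.inv_apply_self], by rw [← h2, MulAut.inv_apply_self]⟩
  | trans _ _ _ _ _ ih ih' =>
    obtain ⟨φ, h1, h2⟩ := ih
    obtain ⟨ψ, h3, h4⟩ := ih'
    exact ⟨ψ * φ, by rw [MulAut.mul_apply, h1, h3], by rw [MulAut.mul_apply, h2, h4]⟩

/-- If a subgroup `K` maps onto the target, then the image of `K ⊓ N` is normal for every normal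
subgroup `N`. -/
theorem Subgroup.map_inf_normal_of_map_eq_top {G H : Type*} [Group G] [Group H] (f : G →* H)
    {K N : Subgroup G} [hN : N.Normal] (hK : K.map f = ⊤) : ((K ⊓ N).map f).Normal := by
  refine ⟨?_⟩
  rintro _ ⟨n, ⟨hnK, hnN⟩, rfl⟩ h
  obtain ⟨g, hg, rfl⟩ : h ∈ K.map f := hK ▸ Subgroup.mem_top h
  exact ⟨g * n * g⁻¹, ⟨K.mul_mem (K.mul_mem hg hnK) (K.inv_mem hg), hN.conj_mem n hnN g⟩,
    by simp⟩

/-- If each coordinate `i` of a subgroup `K` of a power of a non-abelian simple group can be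
made non-trivial while killing any other single coordinate, then `K` is the whole power. -/
theorem Subgroup.eq_top_of_forall_exists_separating {ι H : Type*} [Finite ι] [Group H]
    (hsimple : IsSimpleGroup H) (hnonab : ∃ a b : H, a * b ≠ b * a) (K : Subgroup (ι → H))
    (hK : ∀ i, K.map (Pi.evalMonoidHom (fun _ => H) i) = ⊤)
    (hsep : ∀ i j, i ≠ j → ∃ g ∈ K, g j = 1 ∧ g i ≠ 1) : K = ⊤ := by
  classical
  cases nonempty_fintype ι
  have hnormal (S : Set ι) : (Subgroup.pi S (fun _ => (⊥ : Subgroup H))).Normal := by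
    refine ⟨fun n hn g => ?_⟩
    simp only [Subgroup.mem_pi, Subgroup.mem_bot] at hn ⊢
    intro i hi
    simp [hn i hi]
  have htop (S : Set ι) (i : ι)
      (h : ∃ g ∈ K, (∀ j ∈ S, g j = 1) ∧ g i ≠ 1) (a : H) :
      ∃ g ∈ K, (∀ j ∈ S, g j = 1) ∧ g i = a := by
    have := hnormal S
    have hN := Subgroup.map_inf_normal_of_map_eq_top (N := Subgroup.pi S fun _ => ⊥) _ (hK i)
    obtain ⟨g, hg, hgS, hgi⟩ := h
    rcases hN.eq_bot_or_eq_top with hb | ht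
    · refine absurd ?_ hgi
      rw [← Subgroup.mem_bot, ← hb]
      exact ⟨g, ⟨hg, hgS⟩, rfl⟩
    · obtain ⟨g, ⟨hg, hgS⟩, rfl⟩ := ht ▸ Subgroup.mem_top a
      exact ⟨g, hg, hgS, rfl⟩
  have hall (S : Finset ι) (i : ι) (hi : i ∉ S) (a : H) :
      ∃ g ∈ K, (∀ j ∈ S, g j = 1) ∧ g i = a := by
    induction S using Finset.induction_on generalizing a with
    | empty =>
      obtain ⟨g, hg, rfl⟩ : a ∈ K.map _ := hK i ▸ Subgroup.mem_top a
      exact ⟨g, hg, by simp, rfl⟩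
    | insert j S hj ih =>
      rw [Finset.mem_insert, not_or] at hi
      obtain ⟨b, c, hbc⟩ := hnonab
      obtain ⟨g, hg, hgS, hgi⟩ := ih hi.2 b
      obtain ⟨g', hg', hgj', hgi'⟩ := htop {j} i (by simpa using hsep i j hi.1) c
      refine htop (insert j S : Finset ι) i ⟨g * g' * g⁻¹ * g'⁻¹, ?_, ?_, ?_⟩ a
      · exact K.mul_mem (K.mul_mem (K.mul_mem hg hg') (K.inv_mem hg)) (K.inv_mem hg')
      · intro l hl
        rcases Finset.mem_insert.mp hl with rfl | hl
        · simp [hgj' l rfl]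
        · simp [hgS l hl]
      · intro h
        simp only [Pi.mul_apply, Pi.inv_apply, hgi, hgi'] at h
        exact hbc (by rwa [mul_inv_eq_one, mul_inv_eq_iff_eq_mul] at h)
  refine eq_top_iff.mpr fun f _ => Subgroup.pi_mem_of_mulSingle_mem f fun i => ?_
  obtain ⟨g, hg, hgS, hgi⟩ := hall (Finset.univ.erase i) i (by simp) (f i)
  convert hg using 1
  ext l
  by_cases hl : l = i
  · subst hl; simp [hgi]
  · simp [hl, hgS l]

/-- Two surjections from `K` onto a finite group with nested kernels differ by an
automorphism. -/
theorem exists_mulAut_of_ker_le {K H : Type*} [Group K] [Group H] [Finite H] {f g : K →* H}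
    (hf : Function.Surjective f) (hg : Function.Surjective g) (h : f.ker ≤ g.ker) :
    ∃ φ : MulAut H, ∀ x, φ (f x) = g x := by
  let ψ : H →* H := f.liftOfSurjective hf ⟨g, h⟩
  have hψ (x : K) : ψ (f x) = g x := MonoidHom.liftOfRightInverse_comp_apply _ _ _ _ x
  have hsurj : Function.Surjective ψ := fun y => by
    obtain ⟨x, rfl⟩ := hg y
    exact ⟨f x, hψ x⟩
  exact ⟨MulEquiv.ofBijective ψ ⟨Finite.injective_iff_surjective.mpr hsurj, hsurj⟩, hψ⟩

theorem Subgroup.map_eval_closure_pair {ι H : Type*} [Group H] (x y : ι → H) (i : ι) :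
    (Subgroup.closure {x, y}).map (Pi.evalMonoidHom (fun _ => H) i) =
      Subgroup.closure {x i, y i} := by
  rw [MonoidHom.map_closure, Set.image_pair]
  rfl

/-- Tuples of generating pairs, no two of which are `Aut H`-conjugate, generate the power. -/
theorem closure_pair_eq_top_of_not_conj {ι H : Type*} [Finite ι] [Group H] [Finite H]
    (hsimple : IsSimpleGroup H) (hnonab : ∃ a b : H, a * b ≠ b * a) (x y : ι → H)
    (hgen : ∀ i, Subgroup.closure {x i, y i} = ⊤)
    (hconj : ∀ i j, i ≠ j → ¬ ∃ φ : MulAut H, φ (x i) = x j ∧ φ (y i) = y j) :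
    Subgroup.closure {x, y} = ⊤ := by
  have hmap (i : ι) := (Subgroup.map_eval_closure_pair x y i).trans (hgen i)
  refine Subgroup.eq_top_of_forall_exists_separating hsimple hnonab _ hmap fun i j hij => ?_
  by_contra! hcon
  let ev (l : ι) : Subgroup.closure {x, y} →* H :=
    (Pi.evalMonoidHom (fun _ => H) l).comp (Subgroup.subtype _)
  have hev (l : ι) : Function.Surjective (ev l) := fun a => by
    obtain ⟨g, hg, rfl⟩ := hmap l ▸ Subgroup.mem_top a
    exact ⟨⟨g, hg⟩, rfl⟩
  obtain ⟨φ, hφ⟩ := exists_mulAut_of_ker_le (hev j) (hev i) fun g hg => hcon g g.2 hg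
  exact hconj j i hij.symm ⟨φ, hφ ⟨x, Subgroup.subset_closure (by simp)⟩,
    hφ ⟨y, Subgroup.subset_closure (by simp)⟩⟩

/-- Distinct coordinates of a generating pair of a power are not `Aut H`-conjugate. -/
theorem eq_of_conj_of_closure_pair_eq_top {ι H : Type*} [Group H] [Nontrivial H] {x y : ι → H}
    (hxy : Subgroup.closure {x, y} = ⊤) {i j : ι} (φ : MulAut H)
    (hx : φ (x i) = x j) (hy : φ (y i) = y j) : i = j := by
  classical
  by_contra hij
  have hle : Subgroup.closure {x, y} ≤
      (φ.toMonoidHom.comp (Pi.evalMonoidHom (fun _ => H) i)).eqLocus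
        (Pi.evalMonoidHom (fun _ => H) j) := by
    rw [Subgroup.closure_le, Set.pair_subset_iff]
    exact ⟨hx, hy⟩
  obtain ⟨a, ha⟩ := exists_ne (1 : H)
  have h : φ (Pi.mulSingle (M := fun _ => H) j a i) = Pi.mulSingle (M := fun _ => H) j a j :=
    hle (show Pi.mulSingle j a ∈ _ from hxy ▸ Subgroup.mem_top _)
  rw [Pi.mulSingle_eq_same, Pi.mulSingle_eq_of_ne hij, map_one] at h
  exact ha h.symm

theorem power_two_generated_iff_le_d2
    {H : Type*} [Group H] [Finite H]
    (hsimple : IsSimpleGroup H) (hnonab : ∃ a b : H, a * b ≠ b * a)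
    (k : ℕ) (hk : 1 ≤ k) :
    (∃ x y : Fin k → H, Subgroup.closure {x, y} = ⊤) ↔ k ≤ d2 H := by
  constructor
  · rintro ⟨x, y, hxy⟩
    have hgen (i : Fin k) : Subgroup.closure {x i, y i} = ⊤ := by
      rw [← Subgroup.map_eval_closure_pair, hxy]
      exact Subgroup.map_top_of_surjective _ (Function.surjective_eval i)
    rw [← Nat.card_fin k]
    refine Nat.card_le_card_of_injective (fun i => Quot.mk _ ⟨(x i, y i), hgen i⟩) ?_
    intro i j hij
    obtain ⟨φ, hx, hy⟩ := exists_mulAut_of_quot_mk_eq hij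
    exact eq_of_conj_of_closure_pair_eq_top hxy φ hx hy
  · intro h
    let e := (Fin.castLEEmb h).trans (Finite.equivFin _).symm.toEmbedding
    let p (i : Fin k) := (e i).out
    refine ⟨fun i => (p i).val.1, fun i => (p i).val.2,
      closure_pair_eq_top_of_not_conj hsimple hnonab _ _ (fun i => (p i).2) fun i j hij hφ => ?_⟩
    refine hij (e.injective ?_)
    rw [← Quot.out_eq (e i), ← Quot.out_eq (e j)]
    exact Quot.sound hφ
end

section
/- Let H be a non-abelian finite simple group, let k ≥ 1, and let a = (a_j), b = (b_j), c = (c_j) be elements of G = H^k with a·b·c = 1. Then {a, b, c} generates G if and only if for every j the set {a_j, b_j, c_j} generates H and, for all j ≠ j', there is no automorphism φ of H with φ(a_j) = a_{j'}, φ(b_j) = b_{j'} and φ(c_j) = c_{j'}. -/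
open scoped commutatorElement

/-- The values at the coordinate `i` of those elements of `S` that are trivial on `T`. -/
def Subgroup.valuesTrivialOn {ι H : Type*} [Group H] (S : Subgroup (ι → H)) (T : Set ι) (i : ι) :
    Subgroup H :=
  (S ⊓ Subgroup.pi T fun _ => ⊥).map (Pi.evalMonoidHom (fun _ => H) i)

theorem Subgroup.mem_valuesTrivialOn {ι H : Type*} [Group H] {S : Subgroup (ι → H)} {T : Set ι}
    {i : ι} {h : H} :
    h ∈ S.valuesTrivialOn T i ↔ ∃ s ∈ S, (∀ t ∈ T, s t = 1) ∧ s i = h := by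
  simp [Subgroup.valuesTrivialOn, Subgroup.mem_map, Subgroup.mem_pi, and_assoc]

theorem Subgroup.valuesTrivialOn_normal {ι H : Type*} [Group H] {S : Subgroup (ι → H)}
    (T : Set ι) {i : ι} (hS : ∀ h, ∃ s ∈ S, s i = h) : (S.valuesTrivialOn T i).Normal := by
  refine ⟨fun n hn g => ?_⟩
  obtain ⟨s, hs, hsT, rfl⟩ := mem_valuesTrivialOn.1 hn
  obtain ⟨u, hu, rfl⟩ := hS g
  exact mem_valuesTrivialOn.2 ⟨u * s * u⁻¹, S.mul_mem (S.mul_mem hu hs) (S.inv_mem hu),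
    fun t ht => by simp [hsT t ht], rfl⟩

/-- If two coordinates of a subgroup of a power of a finite simple group are surjective and no
automorphism carries the first to the second, then elements trivial at the first coordinate
take every value at the second. -/
theorem Subgroup.valuesTrivialOn_singleton_eq_top {ι H : Type*} [Group H] [Finite H]
    [IsSimpleGroup H] {S : Subgroup (ι → H)} {i j : ι} (hi : ∀ h, ∃ s ∈ S, s i = h)
    (hj : ∀ h, ∃ s ∈ S, s j = h) (hij : ¬ ∃ φ : MulAut H, ∀ s ∈ S, φ (s j) = s i) :
    S.valuesTrivialOn {j} i = ⊤ := by
  refine (valuesTrivialOn_normal {j} hi).eq_bot_or_eq_top.resolve_left fun hbot => hij ?_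
  let f : S →* H := (Pi.evalMonoidHom (fun _ => H) j).comp S.subtype
  let g : S →* H := (Pi.evalMonoidHom (fun _ => H) i).comp S.subtype
  have hf : Function.Surjective f := fun h => by
    obtain ⟨s, hs, rfl⟩ := hj h
    exact ⟨⟨s, hs⟩, rfl⟩
  have hfg : f.ker ≤ g.ker := fun s hs => by
    have : s.1 i ∈ S.valuesTrivialOn {j} i :=
      mem_valuesTrivialOn.2 ⟨s, s.2, by rintro t rfl; exact hs, rfl⟩
    rwa [hbot, Subgroup.mem_bot] at this
  let ψ : H →* H := f.liftOfSurjective hf ⟨g, hfg⟩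
  have hψ : ∀ s (hs : s ∈ S), ψ (s j) = s i := fun s hs =>
    f.liftOfRightInverse_comp_apply _ _ ⟨g, hfg⟩ ⟨s, hs⟩
  have hsurj : Function.Surjective ψ := fun h => by
    obtain ⟨s, hs, rfl⟩ := hi h
    exact ⟨s j, hψ s hs⟩
  exact ⟨MulEquiv.ofBijective ψ ⟨Finite.injective_iff_surjective.2 hsurj, hsurj⟩, hψ⟩

theorem Subgroup.valuesTrivialOn_eq_top {ι H : Type*} [Group H] [IsSimpleGroup H]
    (hnonab : ∃ a b : H, a * b ≠ b * a) {S : Subgroup (ι → H)} {i : ι}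
    (hi : ∀ h, ∃ s ∈ S, s i = h) (T : Finset ι)
    (hT : ∀ t ∈ T, S.valuesTrivialOn {t} i = ⊤) : S.valuesTrivialOn (T : Set ι) i = ⊤ := by
  classical
  induction T using Finset.induction_on with
  | empty =>
    refine eq_top_iff.2 fun h _ => ?_
    obtain ⟨s, hs, rfl⟩ := hi h
    exact mem_valuesTrivialOn.2 ⟨s, hs, by simp, rfl⟩
  | insert t T _ ih =>
    refine (valuesTrivialOn_normal _ hi).eq_bot_or_eq_top.resolve_left fun hbot => ?_
    obtain ⟨a, b, hab⟩ := hnonab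
    obtain ⟨s, hs, hst, rfl⟩ := mem_valuesTrivialOn.1
      (hT t (Finset.mem_insert_self t T) ▸ Subgroup.mem_top a)
    obtain ⟨u, hu, huT, rfl⟩ := mem_valuesTrivialOn.1
      (ih (fun x hx => hT x (Finset.mem_insert_of_mem hx)) ▸ Subgroup.mem_top b)
    have hmem : ⁅s i, u i⁆ ∈ S.valuesTrivialOn ((insert t T : Finset ι) : Set ι) i := by
      refine mem_valuesTrivialOn.2 ⟨⁅s, u⁆, S.mul_mem (S.mul_mem (S.mul_mem hs hu)
        (S.inv_mem hs)) (S.inv_mem hu), fun x hx => ?_, rfl⟩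
      rcases Finset.mem_insert.1 (Finset.mem_coe.1 hx) with rfl | hx
      · simp [commutatorElement_def, hst]
      · simp [commutatorElement_def, huT x hx]
    rw [hbot, Subgroup.mem_bot, commutatorElement_eq_one_iff_mul_comm] at hmem
    exact hab hmem

/-- A subgroup of a finite power of a non-abelian finite simple group is everything as soon as
its coordinates are surjective and pairwise not related by an automorphism. -/
theorem Subgroup.eq_top_of_forall_not_exists_mulAut {ι H : Type*} [Finite ι] [Group H] [Finite H]
    [IsSimpleGroup H] (hnonab : ∃ a b : H, a * b ≠ b * a) {S : Subgroup (ι → H)}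
    (hS : ∀ i h, ∃ s ∈ S, s i = h)
    (haut : ∀ j i, j ≠ i → ¬ ∃ φ : MulAut H, ∀ s ∈ S, φ (s j) = s i) : S = ⊤ := by
  classical
  have := Fintype.ofFinite ι
  refine eq_top_iff.2 fun x _ => Subgroup.pi_mem_of_mulSingle_mem x fun i => ?_
  have htop := valuesTrivialOn_eq_top hnonab (hS i) (Finset.univ.erase i) fun t ht =>
    valuesTrivialOn_singleton_eq_top (hS i) (hS t) (haut t i (Finset.ne_of_mem_erase ht))
  obtain ⟨s, hs, hs1, hsi⟩ := mem_valuesTrivialOn.1 (htop ▸ Subgroup.mem_top (x i))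
  convert hs
  ext t
  by_cases ht : t = i
  · subst ht
    simp [hsi]
  · rw [Pi.mulSingle_eq_of_ne ht, hs1 t (by simp [ht])]

theorem Subgroup.map_eval_closure_triple {ι H : Type*} [Group H] (a b c : ι → H) (j : ι) :
    (Subgroup.closure {a, b, c}).map (Pi.evalMonoidHom (fun _ => H) j) =
      Subgroup.closure {a j, b j, c j} := by
  simp [MonoidHom.map_closure, Set.image_insert_eq]

theorem power_generating_triple_iff
    {H : Type*} [Group H] [Finite H]
    (hsimple : IsSimpleGroup H) (hnonab : ∃ a b : H, a * b ≠ b * a)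
    (k : ℕ) (a b c : Fin k → H) (habc : a * b * c = 1) :
    Subgroup.closure ({a, b, c} : Set (Fin k → H)) = ⊤ ↔
      ((∀ j, Subgroup.closure ({a j, b j, c j} : Set H) = ⊤) ∧
        ∀ j j', j ≠ j' →
          ¬ ∃ φ : MulAut H, φ (a j) = a j' ∧ φ (b j) = b j' ∧ φ (c j) = c j') := by
  constructor
  · intro h
    refine ⟨fun j => ?_, fun j j' hne ⟨φ, ha, hb, hc⟩ => ?_⟩
    · rw [← Subgroup.map_eval_closure_triple, h]
      exact Subgroup.map_top_of_surjective _ (Function.surjective_eval j)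
    · have heq : φ.toMonoidHom.comp (Pi.evalMonoidHom (fun _ => H) j) =
          Pi.evalMonoidHom (fun _ => H) j' :=
        MonoidHom.eq_of_eqOn_dense h (by simp [Set.EqOn, ha, hb, hc])
      obtain ⟨x, hx⟩ := exists_ne (1 : H)
      have hφ := DFunLike.congr_fun heq (Pi.mulSingle j x)
      simp [Pi.mulSingle_eq_of_ne hne.symm] at hφ
      exact hx hφ
  · rintro ⟨hgen, haut⟩
    refine Subgroup.eq_top_of_forall_not_exists_mulAut hnonab (fun i h => ?_)
      fun j i hne ⟨φ, hφ⟩ => haut j i hne ⟨φ, ?_⟩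
    · exact Subgroup.mem_map.1
        (Subgroup.map_eval_closure_triple a b c i ▸ hgen i ▸ Subgroup.mem_top h)
    · exact ⟨hφ a (Subgroup.subset_closure (by simp)), hφ b (Subgroup.subset_closure (by simp)),
        hφ c (Subgroup.subset_closure (by simp))⟩
end

section
/- Let H be a finite group, G = H^k, and for i = 1, 2 let Tᵢ = (aᵢ, bᵢ, cᵢ) be a triple of elements of G with aᵢ·bᵢ·cᵢ = 1, and let Σᵢ be the set of elements of G conjugate to a power of aᵢ, bᵢ or cᵢ. Let p be a prime. If for every d ∈ {a₁, b₁, c₁} and every d' ∈ {a₂, b₂, c₂} the p-summits S_p(d) and S_p(d') are disjoint, then no element of G of order p belongs to both Σ₁ and Σ₂. Moreover, if this disjointness holds for every prime p dividing the order of at least one of a₁, b₁, c₁, a₂, b₂, c₂, then Σ₁ ∩ Σ₂ = {1}. -/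
/-- The `p`-summit of `g = (g₁, …, g_k) ∈ H^k`: the set of indices `j` at which the
exponent of `p` in `orderOf (g j)` attains its maximum value, provided that maximum
is nonzero; it is empty if `p` divides no `orderOf (g j)`. -/
def pSummit {H : Type*} [Group H] {k : ℕ} (p : ℕ) (g : Fin k → H) : Set (Fin k) :=
  {j | (orderOf (g j)).factorization p ≠ 0 ∧
    ∀ j', (orderOf (g j')).factorization p ≤ (orderOf (g j)).factorization p}

theorem factorization_max_of_dvd_mul_prime {p m n : ℕ} (hp : p.Prime) (hn : n ∣ m * p)
    (hnm : ¬ n ∣ m) :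
    n.factorization p ≠ 0 ∧
      ∀ n' : ℕ, n' ∣ m * p → n'.factorization p ≤ n.factorization p := by
  have hm : m ≠ 0 := by
    rintro rfl
    exact hnm (dvd_zero n)
  have hmp : m * p ≠ 0 := mul_ne_zero hm hp.ne_zero
  have hn0 : n ≠ 0 := ne_zero_of_dvd_ne_zero hmp hn
  have hmul (q : ℕ) :
      (m * p).factorization q = m.factorization q + p.factorization q := by
    rw [Nat.factorization_mul hm hp.ne_zero, Finsupp.add_apply]
  have hle {n' : ℕ} (h : n' ∣ m * p) (q : ℕ) :
      n'.factorization q ≤ m.factorization q + p.factorization q :=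
    hmul q ▸ (Nat.factorization_le_iff_dvd (ne_zero_of_dvd_ne_zero hmp h) hmp).2 h q
  have hlt : m.factorization p < n.factorization p := by
    by_contra! h
    refine hnm ((Nat.factorization_le_iff_dvd hn0 hm).1 fun q => ?_)
    rcases eq_or_ne q p with rfl | hq
    · exact h
    · simpa [hp.factorization, Finsupp.single_apply, hq.symm] using hle hn q
  refine ⟨by lia, fun n' hn' => ?_⟩
  have := hle hn' p
  rw [hp.factorization_self] at this
  lia

theorem mem_pSummit_of_isConj_zpow {H : Type*} [Group H] {k p : ℕ} (hp : p.Prime)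
    {d g : Fin k → H} {m : ℤ} (hg : orderOf g = p) (h : IsConj (d ^ m) g) {j : Fin k}
    (hj : g j ≠ 1) : j ∈ pSummit p d := by
  obtain ⟨c, rfl⟩ := isConj_iff.1 h
  have hdvd (i : Fin k) : orderOf (d i) ∣ m.natAbs * p := by
    have hpow : (d ^ m) ^ p = 1 := by
      rw [← conj_eq_one_iff (a := c), ← conj_pow, ← hg, pow_orderOf_eq_one]
    have hpow' : d i ^ (m * p) = 1 := by
      rw [zpow_mul, zpow_natCast]
      exact congrFun hpow i
    simpa [Int.natAbs_mul] using
      Int.natCast_dvd.1 (orderOf_dvd_iff_zpow_eq_one.2 hpow')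
  have hndvd : ¬ orderOf (d j) ∣ m.natAbs := by
    rw [← Int.natCast_dvd, orderOf_dvd_iff_zpow_eq_one]
    intro h1
    exact hj (by simp [h1])
  obtain ⟨h0, hmax⟩ := factorization_max_of_dvd_mul_prime hp (hdvd j) hndvd
  exact ⟨h0, fun i => hmax _ (hdvd i)⟩

theorem one_mem_sigmaSet {G : Type*} [Group G] (a b c : G) : (1 : G) ∈ SigmaSet a b c :=
  ⟨a, by simp, 0, by simp⟩

theorem pow_mem_sigmaSet {G : Type*} [Group G] {a b c g : G} (hg : g ∈ SigmaSet a b c)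
    (n : ℕ) : g ^ n ∈ SigmaSet a b c := by
  obtain ⟨d, hd, m, h⟩ := hg
  refine ⟨d, hd, m * n, ?_⟩
  rw [zpow_mul, zpow_natCast]
  exact h.pow n

theorem exists_orderOf_dvd_of_mem_sigmaSet {G : Type*} [Group G] {a b c g : G}
    (hg : g ∈ SigmaSet a b c) : ∃ d ∈ ({a, b, c} : Set G), orderOf g ∣ orderOf d := by
  obtain ⟨d, hd, m, h⟩ := hg
  refine ⟨d, hd, orderOf_dvd_of_pow_eq_one ?_⟩
  have h1 := h.pow (orderOf d)
  rwa [← zpow_natCast, ← zpow_mul, mul_comm, zpow_mul, zpow_natCast, pow_orderOf_eq_one,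
    one_zpow, isConj_one_right] at h1

theorem notMem_sigmaSet_of_disjoint_pSummit {H : Type*} [Group H] {k p : ℕ}
    {a₁ b₁ c₁ a₂ b₂ c₂ : Fin k → H} (hp : p.Prime)
    (hdisj : ∀ d ∈ ({a₁, b₁, c₁} : Set (Fin k → H)),
      ∀ d' ∈ ({a₂, b₂, c₂} : Set (Fin k → H)), pSummit p d ∩ pSummit p d' = ∅)
    {g : Fin k → H} (hg : orderOf g = p) :
    ¬ (g ∈ SigmaSet a₁ b₁ c₁ ∧ g ∈ SigmaSet a₂ b₂ c₂) := by
  rintro ⟨⟨d, hd, m, h⟩, ⟨d', hd', m', h'⟩⟩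
  obtain ⟨j, hj⟩ : ∃ j, g j ≠ 1 := by
    by_contra! hone
    obtain rfl : g = 1 := funext hone
    exact hp.ne_one (hg ▸ orderOf_one)
  have hmem : j ∈ pSummit p d ∩ pSummit p d' :=
    ⟨mem_pSummit_of_isConj_zpow hp hg h hj, mem_pSummit_of_isConj_zpow hp hg h' hj⟩
  simp [hdisj d hd d' hd'] at hmem

theorem disjoint_summits
    {H : Type*} [Group H] [Finite H] {k : ℕ}
    (a₁ b₁ c₁ a₂ b₂ c₂ : Fin k → H)
    (h₁ : a₁ * b₁ * c₁ = 1) (h₂ : a₂ * b₂ * c₂ = 1) :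
    (∀ p : ℕ, p.Prime →
      (∀ d ∈ ({a₁, b₁, c₁} : Set (Fin k → H)), ∀ d' ∈ ({a₂, b₂, c₂} : Set (Fin k → H)),
        pSummit p d ∩ pSummit p d' = ∅) →
      ∀ g : Fin k → H, orderOf g = p →
        ¬ (g ∈ SigmaSet a₁ b₁ c₁ ∧ g ∈ SigmaSet a₂ b₂ c₂)) ∧
    ((∀ p : ℕ, p.Prime →
        (p ∣ orderOf a₁ ∨ p ∣ orderOf b₁ ∨ p ∣ orderOf c₁ ∨
          p ∣ orderOf a₂ ∨ p ∣ orderOf b₂ ∨ p ∣ orderOf c₂) →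
        ∀ d ∈ ({a₁, b₁, c₁} : Set (Fin k → H)), ∀ d' ∈ ({a₂, b₂, c₂} : Set (Fin k → H)),
          pSummit p d ∩ pSummit p d' = ∅) →
      SigmaSet a₁ b₁ c₁ ∩ SigmaSet a₂ b₂ c₂ = {1}) := by
 
  refine ⟨fun p hp hdisj g hg => notMem_sigmaSet_of_disjoint_pSummit hp hdisj hg,
    fun hdisj => Set.Subset.antisymm ?_ ?_⟩
  · rintro g ⟨hg₁, hg₂⟩
    by_contra hne
    obtain ⟨p, hp, hpg⟩ := Nat.exists_prime_and_dvd (mt orderOf_eq_one_iff.1 hne)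
    have hdvd : p ∣ orderOf a₁ ∨ p ∣ orderOf b₁ ∨ p ∣ orderOf c₁ ∨
        p ∣ orderOf a₂ ∨ p ∣ orderOf b₂ ∨ p ∣ orderOf c₂ := by
      obtain ⟨d, rfl | rfl | rfl, hd⟩ := exists_orderOf_dvd_of_mem_sigmaSet hg₁ <;>
        simp [hpg.trans hd]
    exact notMem_sigmaSet_of_disjoint_pSummit hp (hdisj p hp hdvd)
      (orderOf_pow_orderOf_div (orderOf_pos g).ne' hpg)
      ⟨pow_mem_sigmaSet hg₁ _, pow_mem_sigmaSet hg₂ _⟩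
  · rintro _ rfl
    exact ⟨one_mem_sigmaSet .., one_mem_sigmaSet ..⟩
end
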